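/- Let X be a smooth irreducible projective surface over an algebraically closed field of characteristic 0, and let φ : X → ℙ^N with N ≥ 4 be an uncrumpled map such that Y = φ(X) is not ruled by lines. Then for a general point x ∈ X, the resolved inner projection φ̃ : X̃ → ℙ^{N−1} from y = φ(x) (where X̃ is the blow-up of X at x) is again an uncrumpled map. -/

import Mathlib

/-!
Common framework: classical projective varieties over an algebraically closed
field, formalized via `Projectivization`.
-/

open MvPolynomial Module Set Filter

namespace PinchPaper

variable (k : Type) [Field k]

/-- The classical points of projective `N`-space over `k`. -/
abbrev Pr (N : ℕ) := Projectivization k (Fin (N + 1) → k)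

variable {k}

/-- A (homogeneous) polynomial vanishes at a point of projective space. -/
def Vanishes {N : ℕ} (f : MvPolynomial (Fin (N + 1)) k) (p : Pr k N) : Prop :=
  ∀ (v : Fin (N + 1) → k) (hv : v ≠ 0), Projectivization.mk k v hv = p → eval v f = 0

/-- Zariski-closed (projective algebraic) subsets of projective space: common zero
loci of families of homogeneous polynomials. -/
def IsAlgSet {N : ℕ} (Z : Set (Pr k N)) : Prop :=
  ∃ S : Set (MvPolynomial (Fin (N + 1)) k),
    (∀ f ∈ S, ∃ d, f.IsHomogeneous d) ∧ Z = {p | ∀ f ∈ S, Vanishes f p}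

/-- A projective variety: a nonempty algebraic set which is irreducible. -/
def IsVariety {N : ℕ} (Z : Set (Pr k N)) : Prop :=
  IsAlgSet Z ∧ Z.Nonempty ∧
    ∀ Z₁ Z₂ : Set (Pr k N), IsAlgSet Z₁ → IsAlgSet Z₂ → Z ⊆ Z₁ ∪ Z₂ → Z ⊆ Z₁ ∨ Z ⊆ Z₂

/-- `Z` has dimension `n`, via lengths of chains of subvarieties. -/
def HasDim {N : ℕ} (Z : Set (Pr k N)) (n : ℕ) : Prop :=
  Order.krullDim {W : Set (Pr k N) // IsVariety W ∧ W ⊆ Z} = (n : ℕ∞)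

/-- The polynomials vanishing identically on `Z` (as a `k`-submodule). -/
noncomputable def vanishingIdeal {N : ℕ} (Z : Set (Pr k N)) :
    Submodule k (MvPolynomial (Fin (N + 1)) k) :=
  ⨅ p ∈ Z, LinearMap.ker (MvPolynomial.aeval (R := k) (Projectivization.rep p)).toLinearMap

/-- The Hilbert function of the homogeneous coordinate ring of `Z`. -/
noncomputable def hilb {N : ℕ} (Z : Set (Pr k N)) (m : ℕ) : ℕ :=
  finrank k (↥(homogeneousSubmodule (Fin (N + 1)) k m) ⧸
    (Submodule.comap (homogeneousSubmodule (Fin (N + 1)) k m).subtype (vanishingIdeal Z)))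

/-- `Z` (of dimension `n`) has degree `d`: the Hilbert polynomial of `Z` has degree `n`
and leading coefficient `d / n!`. -/
def HasDegree {N : ℕ} (Z : Set (Pr k N)) (n d : ℕ) : Prop :=
  ∃ P : Polynomial ℚ, P.degree = (n : ℕ) ∧ P.leadingCoeff * (n.factorial : ℚ) = (d : ℚ) ∧
    ∀ᶠ m : ℕ in atTop, (hilb Z m : ℚ) = P.eval (m : ℚ)

/-- A curve `B` has (arithmetic, hence for smooth curves geometric) genus `g`:
its Hilbert polynomial is `P(m) = d·m + (1 - g)`. -/
def HasGenus {N : ℕ} (B : Set (Pr k N)) (g : ℕ) : Prop :=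
  ∃ d : ℕ, ∀ᶠ m : ℕ in atTop, (hilb B m : ℤ) = d * m + 1 - g

/-- A line in projective space: the set of points lying in a 2-dimensional linear subspace. -/
def IsLine {N : ℕ} (L : Set (Pr k N)) : Prop :=
  ∃ W : Submodule k (Fin (N + 1) → k), finrank k W = 2 ∧
    L = {p | Projectivization.submodule p ≤ W}

/-- A 2-plane in projective space. -/
def Is2Plane {N : ℕ} (L : Set (Pr k N)) : Prop :=
  ∃ W : Submodule k (Fin (N + 1) → k), finrank k W = 3 ∧
    L = {p | Projectivization.submodule p ≤ W}

/-- `Y` is non-degenerate: no nonzero linear form vanishes on it. -/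
def Nondegenerate {N : ℕ} (Y : Set (Pr k N)) : Prop :=
  ∀ f : MvPolynomial (Fin (N + 1)) k, f.IsHomogeneous 1 → (∀ p ∈ Y, Vanishes f p) → f = 0

/-- `Y` is ruled by lines: it contains infinitely many lines (equivalently, its Fano
scheme of lines is positive-dimensional). -/
def RuledByLines {N : ℕ} (Y : Set (Pr k N)) : Prop :=
  {L : Set (Pr k N) | IsLine L ∧ L ⊆ Y}.Infinite

/-- The differential of `f` at `v`, as a linear functional. -/
noncomputable def diffAt {N : ℕ} (f : MvPolynomial (Fin (N + 1)) k) (v : Fin (N + 1) → k) :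
    (Fin (N + 1) → k) →ₗ[k] k :=
  ∑ j, eval v (pderiv j f) • (LinearMap.proj j : (Fin (N + 1) → k) →ₗ[k] k)

/-- The affine cone over the embedded Zariski tangent space of `Z` at `p`. -/
noncomputable def embTangent {N : ℕ} (Z : Set (Pr k N)) (p : Pr k N) :
    Submodule k (Fin (N + 1) → k) :=
  ⨅ f ∈ {f : MvPolynomial (Fin (N + 1)) k |
      (∃ d, f.IsHomogeneous d) ∧ ∀ q ∈ Z, Vanishes f q},
    LinearMap.ker (diffAt f (Projectivization.rep p))

/-- A smooth projective surface (embedded in some projective space). -/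
def IsSmoothSurface {N : ℕ} (Z : Set (Pr k N)) : Prop :=
  IsVariety Z ∧ HasDim Z 2 ∧ ∀ p ∈ Z, finrank k (embTangent Z p) = 3

/-- A smooth projective curve. -/
def IsSmoothCurve {N : ℕ} (Z : Set (Pr k N)) : Prop :=
  IsVariety Z ∧ HasDim Z 1 ∧ ∀ p ∈ Z, finrank k (embTangent Z p) = 2

/-- `F` is a local homogeneous representation of `φ` near `p ∈ X`. -/
def LocalRep {M N : ℕ} (X : Set (Pr k M)) (φ : Pr k M → Pr k N) (p : Pr k M)
    (F : Fin (N + 1) → MvPolynomial (Fin (M + 1)) k) : Prop :=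
  (∃ d, ∀ i, (F i).IsHomogeneous d) ∧
  (fun i => eval (Projectivization.rep p) (F i)) ≠ 0 ∧
  ∀ q ∈ X, ∀ (v : Fin (M + 1) → k) (hv : v ≠ 0), Projectivization.mk k v hv = q →
    ∀ hFv : (fun i => eval v (F i)) ≠ 0,
      φ q = Projectivization.mk k (fun i => eval v (F i)) hFv

/-- `φ` is a morphism on the projective set `X`: locally given by homogeneous polynomials. -/
def IsMorphismOn {M N : ℕ} (X : Set (Pr k M)) (φ : Pr k M → Pr k N) : Prop :=
  ∀ p ∈ X, ∃ F, LocalRep X φ p F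

/-- The Jacobian of a tuple of polynomials at `v`, as a linear map. -/
noncomputable def jacobian {M N : ℕ} (F : Fin (N + 1) → MvPolynomial (Fin (M + 1)) k)
    (v : Fin (M + 1) → k) : (Fin (M + 1) → k) →ₗ[k] (Fin (N + 1) → k) :=
  Matrix.mulVecLin (Matrix.of fun i j => eval v (pderiv j (F i)))

/-- `φ` (defined on the surface `X`) is ramified at `p`: its differential has rank ≤ 1,
i.e. the image of the affine tangent cone has rank ≤ 2. -/
def RamifiedAt {M N : ℕ} (X : Set (Pr k M)) (φ : Pr k M → Pr k N) (p : Pr k M) : Prop :=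
  ∀ F, LocalRep X φ p F →
    finrank k ((embTangent X p).map (jacobian F (Projectivization.rep p))) ≤ 2

/-- The ramification locus of `φ` on `X`. -/
def RamLocus {M N : ℕ} (X : Set (Pr k M)) (φ : Pr k M → Pr k N) : Set (Pr k M) :=
  {p | p ∈ X ∧ RamifiedAt X φ p}

/-- `φ` is unramified at `p` (injective differential on Zariski tangent spaces). -/
def UnramifiedAt {M N : ℕ} (X : Set (Pr k M)) (φ : Pr k M → Pr k N) (p : Pr k M) : Prop :=
  ∀ F, LocalRep X φ p F → ∀ w ∈ embTangent X p,
    jacobian F (Projectivization.rep p) w ∈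
      Submodule.span k {(fun i => eval (Projectivization.rep p) (F i))} →
    w ∈ Submodule.span k {Projectivization.rep p}

/-- `φ` is a closed embedding on `X`: injective, closed image, unramified, and the
embedded tangent spaces of the image match those of `X`. -/
def IsClosedEmbeddingOn {M N : ℕ} (X : Set (Pr k M)) (φ : Pr k M → Pr k N) : Prop :=
  InjOn φ X ∧ IsAlgSet (φ '' X) ∧ (∀ p ∈ X, UnramifiedAt X φ p) ∧
    ∀ p ∈ X, finrank k (embTangent (φ '' X) (φ p)) = finrank k (embTangent X p)

/-- `φ` is generically injective on `X` (i.e. birational onto its image). -/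
def GenericallyInjectiveOn {M N : ℕ} (X : Set (Pr k M)) (φ : Pr k M → Pr k N) : Prop :=
  ∃ Z : Set (Pr k M), IsAlgSet Z ∧ ¬ X ⊆ Z ∧ InjOn φ (X \ Z)

/-- An uncrumpled map: a morphism with non-degenerate image, birational onto its
image, with finite ramification locus. -/
def Uncrumpled {M N : ℕ} (X : Set (Pr k M)) (φ : Pr k M → Pr k N) : Prop :=
  IsMorphismOn X φ ∧ Nondegenerate (φ '' X) ∧ GenericallyInjectiveOn X φ ∧
    (RamLocus X φ).Finite

/-- The ramification locus of the composite of `φ` with the linear projection given by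
the matrix `L`; ramification means the image of the affine tangent cone has rank ≤ `r`. -/
def ProjRamLocus {M N T : ℕ} (X : Set (Pr k M)) (φ : Pr k M → Pr k N)
    (L : Matrix (Fin T) (Fin (N + 1)) k) (r : ℕ) : Set (Pr k M) :=
  {p | p ∈ X ∧ ∀ F, LocalRep X φ p F →
    finrank k ((embTangent X p).map
      ((Matrix.mulVecLin L).comp (jacobian F (Projectivization.rep p)))) ≤ r}

/-- A property holds for a general matrix: it holds on a nonempty Zariski-open set. -/
def ForGenericMatrix {a b : ℕ} (P : Matrix (Fin a) (Fin b) k → Prop) : Prop :=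
  ∃ G : MvPolynomial (Fin a × Fin b) k, G ≠ 0 ∧
    ∀ L : Matrix (Fin a) (Fin b) k, eval (fun ij => L ij.1 ij.2) G ≠ 0 → P L

/-- A property holds for a general vector. -/
def ForGenericVector {b : ℕ} (P : (Fin b → k) → Prop) : Prop :=
  ∃ G : MvPolynomial (Fin b) k, G ≠ 0 ∧ ∀ a : Fin b → k, eval a G ≠ 0 → P a

/-- A property holds for a general point of `X`: it holds away from a proper closed subset. -/
def ForGeneralPointOn {M : ℕ} (X : Set (Pr k M)) (P : Pr k M → Prop) : Prop :=
  ∃ Z : Set (Pr k M), IsAlgSet Z ∧ ¬ X ⊆ Z ∧ ∀ x ∈ X \ Z, P x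

/-- The pinch point scheme length: `𝔓(φ) = n` iff the composition of `φ` with a general
linear projection to `ℙ³` has exactly `n` pinch (ramification) points.  (By
[Eisenbud–Harris, 12.6] this equals `deg (6ζ² + 4ζK + K² − c₂)`.) -/
def HasPinch {M N : ℕ} (X : Set (Pr k M)) (φ : Pr k M → Pr k N) (n : ℕ) : Prop :=
  ForGenericMatrix (fun L : Matrix (Fin 4) (Fin (N + 1)) k =>
    (∀ p ∈ X, L.mulVec (Projectivization.rep (φ p)) ≠ 0) ∧
    (ProjRamLocus X φ L 2).ncard = n ∧ (ProjRamLocus X φ L 2).Finite)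

/-- A rational normal scroll in `ℙ^N`: a smooth non-degenerate surface of minimal
degree `N − 1` which is ruled by lines. -/
def IsRationalNormalScroll {N : ℕ} (Y : Set (Pr k N)) : Prop :=
  IsSmoothSurface Y ∧ Nondegenerate Y ∧ RuledByLines Y ∧ HasDegree Y 2 (N - 1)

/-- The exceptional fiber of `β` over `x`. -/
def ExcFiber {M' M : ℕ} (Xt : Set (Pr k M')) (β : Pr k M' → Pr k M) (x : Pr k M) :
    Set (Pr k M') := {q | q ∈ Xt ∧ β q = x}

/-- `β : X̃ → X` is the blow-up of the surface `X` at the (smooth) point `x`: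
a birational morphism which is an isomorphism away from `x`, whose fiber over `x`
is an irreducible curve, smooth along that fiber. -/
def IsBlowupAt {M' M : ℕ} (Xt : Set (Pr k M')) (X : Set (Pr k M))
    (β : Pr k M' → Pr k M) (x : Pr k M) : Prop :=
  x ∈ X ∧ IsVariety Xt ∧ HasDim Xt 2 ∧ IsMorphismOn Xt β ∧ β '' Xt = X ∧
    InjOn β {q | q ∈ Xt ∧ β q ≠ x} ∧
    IsVariety (ExcFiber Xt β x) ∧ HasDim (ExcFiber Xt β x) 1 ∧
    ∀ q ∈ ExcFiber Xt β x, finrank k (embTangent Xt q) = 3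

/-- `φ̃ : X̃ → ℙ^{N'}` resolves the inner projection of `φ : X → ℙ^N` from `y = φ x`
(via the blow-up `β : X̃ → X` and with projection given by a linear map `L` whose
kernel is the line of `y`). -/
def ResolvesInnerProj {M M' N N' : ℕ} (X : Set (Pr k M)) (φ : Pr k M → Pr k N)
    (x : Pr k M) (Xt : Set (Pr k M')) (β : Pr k M' → Pr k M)
    (φt : Pr k M' → Pr k N') (L : (Fin (N + 1) → k) →ₗ[k] (Fin (N' + 1) → k)) : Prop :=
  IsMorphismOn Xt φt ∧ LinearMap.ker L = Projectivization.submodule (φ x) ∧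
    ∀ q ∈ Xt, β q ≠ x → ∀ (v : Fin (N + 1) → k) (hv : v ≠ 0),
      Projectivization.mk k v hv = φ (β q) → ∀ hLv : L v ≠ 0,
        φt q = Projectivization.mk k (L v) hLv

/-- The standard quadratic (Veronese) monomials. -/
def veroneseVec (v : Fin 3 → k) : Fin 6 → k :=
  ![v 0 * v 0, v 0 * v 1, v 0 * v 2, v 1 * v 1, v 1 * v 2, v 2 * v 2]

/-- The image of the Veronese embedding `ℙ² → ℙ⁵`. -/
def veroneseImage (k : Type) [Field k] : Set (Pr k 5) :=
  {p | ∃ (v : Fin 3 → k) (hv : veroneseVec v ≠ 0), p = Projectivization.mk k (veroneseVec v) hv}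

/-- `Y` is (projectively equivalent to) the Veronese surface in `ℙ⁵`
(the existence of the linear isomorphism forces `N = 5`). -/
def IsVeroneseSurface {N : ℕ} (Y : Set (Pr k N)) : Prop :=
  ∃ σ : (Fin 6 → k) ≃ₗ[k] (Fin (N + 1) → k),
    Y = Projectivization.map σ.toLinearMap σ.injective '' veroneseImage k

/-- `Y ⊂ ℙ^N` is linearly normal: it is not an isomorphic linear projection of a
non-degenerate variety in `ℙ^{N+1}`. -/
def LinearlyNormal {N : ℕ} (Y : Set (Pr k N)) : Prop :=
  ¬ ∃ (Y' : Set (Pr k (N + 1))) (π : Pr k (N + 1) → Pr k N)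
      (L : (Fin (N + 1 + 1) → k) →ₗ[k] (Fin (N + 1) → k)),
      IsVariety Y' ∧ Nondegenerate Y' ∧
      (∀ q ∈ Y', ∀ (v : Fin (N + 1 + 1) → k) (hv : v ≠ 0),
        Projectivization.mk k v hv = q →
          ∃ hLv : L v ≠ 0, π q = Projectivization.mk k (L v) hLv) ∧
      π '' Y' = Y ∧ InjOn π Y' ∧
      ∀ q ∈ Y', Disjoint (LinearMap.ker L) (embTangent Y' q)

/-- A del Pezzo surface of degree `d` in `ℙ^N`: a smooth non-degenerate linearly normal
surface of degree `d` (for `d = N` this characterizes anticanonically embedded del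
Pezzo surfaces). -/
def IsDelPezzoOfDegree {N : ℕ} (Y : Set (Pr k N)) (d : ℕ) : Prop :=
  IsSmoothSurface Y ∧ Nondegenerate Y ∧ LinearlyNormal Y ∧ HasDegree Y 2 d

/-- `F` is isomorphic to `ℙ¹` (as a projective variety). -/
def IsIsoToP1 {M : ℕ} (F : Set (Pr k M)) : Prop :=
  ∃ ψ : Pr k 1 → Pr k M, IsMorphismOn Set.univ ψ ∧ Set.BijOn ψ Set.univ F ∧
    ∃ ψ' : Pr k M → Pr k 1, IsMorphismOn F ψ' ∧ ∀ t, ψ' (ψ t) = t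

/-- `ρ : X → B` exhibits `X` as a `ℙ¹`-bundle over the curve `B`
(all fibers are isomorphic to `ℙ¹`). -/
def IsP1Bundle {M m : ℕ} (X : Set (Pr k M)) (B : Set (Pr k m))
    (ρ : Pr k M → Pr k m) : Prop :=
  IsMorphismOn X ρ ∧ ρ '' X = B ∧ ∀ b ∈ B, IsIsoToP1 {p | p ∈ X ∧ ρ p = b}

/-- The hyperplane cut out by the linear form with coefficients `a`. -/
def hyperplaneOf {N : ℕ} (a : Fin (N + 1) → k) : Set (Pr k N) :=
  {p | Vanishes (∑ i, MvPolynomial.C (a i) * MvPolynomial.X i) p}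

/-- A rational normal curve of degree `N` in `ℙ^N`: a non-degenerate curve of degree `N`. -/
def IsRationalNormalCurve {N : ℕ} (C : Set (Pr k N)) : Prop :=
  IsVariety C ∧ HasDim C 1 ∧ Nondegenerate C ∧ HasDegree C 1 N

/-- The Gauss degree `γ₁` of an embedded curve `X ⊂ ℙ^N`: the number of ramification
points of a general linear projection `X → ℙ¹`. -/
def HasGaussDegree {N : ℕ} (X : Set (Pr k N)) (γ : ℕ) : Prop :=
  ForGenericMatrix (fun L : Matrix (Fin 2) (Fin (N + 1)) k =>
    (∀ p ∈ X, L.mulVec (Projectivization.rep p) ≠ 0) ∧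
    (ProjRamLocus X id L 1).ncard = γ ∧ (ProjRamLocus X id L 1).Finite)

end PinchPaper

namespace PinchPaper

section Differentials

variable {k : Type} [Field k] {σ : Type} [Fintype σ] {F : Type} [Field F] [Algebra k F]

/-- The differential of `f` at the point `a`, applied to the vector `c`. -/
noncomputable def dd (a c : σ → F) (f : MvPolynomial σ k) : F :=
  ∑ j, aeval a (pderiv j f) * c j

/-- The tangent space at `a` of the zero locus of `I`. -/
noncomputable def Tg (I : Ideal (MvPolynomial σ k)) (a : σ → F) : Submodule F (σ → F) where
  carrier := {c | ∀ f ∈ I, dd a c f = 0}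
  zero_mem' := fun f _ => by simp [dd]
  add_mem' := fun hc hd f hf => by
    have h1 := hc f hf
    have h2 := hd f hf
    simp only [dd] at h1 h2 ⊢
    simp [mul_add, Finset.sum_add_distrib, h1, h2]
  smul_mem' := fun t c hc f hf => by
    have h1 := hc f hf
    simp only [dd] at h1 ⊢
    have : ∀ j, aeval a (pderiv j f) * (t • c) j = t * (aeval a (pderiv j f) * c j) := by
      intro j; simp; ring
    rw [Finset.sum_congr rfl (fun j _ => this j), ← Finset.mul_sum, h1, mul_zero]

lemma mem_Tg {I : Ideal (MvPolynomial σ k)} {a c : σ → F} :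
    c ∈ Tg I a ↔ ∀ f ∈ I, dd a c f = 0 := Iff.rfl

lemma dd_add (a c : σ → F) (f g : MvPolynomial σ k) : dd a c (f + g) = dd a c f + dd a c g := by
  simp [dd, add_mul, Finset.sum_add_distrib]

lemma dd_mul (a c : σ → F) (f g : MvPolynomial σ k) :
    dd a c (f * g) = aeval a f * dd a c g + aeval a g * dd a c f := by
  simp only [dd, Finset.mul_sum, ← Finset.sum_add_distrib]
  refine Finset.sum_congr rfl fun j _ => ?_
  simp [Derivation.leibniz]; ring

lemma dd_C (a c : σ → F) (r : k) : dd a c (C r) = 0 := by simp [dd]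

lemma dd_X [DecidableEq σ] (a c : σ → F) (i : σ) : dd a c (X i : MvPolynomial σ k) = c i := by
  simp [dd, pderiv_X, Pi.single_apply, apply_ite]

/-- A map satisfying the Leibniz rule over the evaluation at `a` is given by `dd`. -/
lemma eq_dd_of_leibniz {A : Type*} [CommRing A] [Algebra k A] (e : A →+* F) (d : A →+ F)
    (hd : ∀ x y, d (x * y) = e x * d y + e y * d x) (hC : ∀ r : k, d (algebraMap k A r) = 0)
    (he : ∀ r : k, e (algebraMap k A r) = algebraMap k F r)
    (Q : σ → A) (f : MvPolynomial σ k) :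
    d (aeval Q f) = dd (fun j => e (Q j)) (fun j => d (Q j)) f := by
  classical
  have hev : ∀ g : MvPolynomial σ k, e (aeval Q g) = aeval (fun j => e (Q j)) g := by
    intro g
    induction g using MvPolynomial.induction_on with
    | C r => simp [he]
    | add p q hp hq => simp [hp, hq]
    | mul_X p i hp => simp [hp]
  induction f using MvPolynomial.induction_on with
  | C r => simp [dd_C, hC]
  | add p q hp hq => simp [hp, hq, dd_add]
  | mul_X p i hp =>
    rw [map_mul, hd, hp, dd_mul, hev, hev, aeval_X, dd_X, aeval_X]

lemma derivation_aeval (δ : Derivation k F F) (a : σ → F) (f : MvPolynomial σ k) :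
    δ (aeval a f) = dd a (fun j => δ (a j)) f := by
  have := eq_dd_of_leibniz (k := k) (RingHom.id F) (δ : F →+ F) (by intro x y; simp)
    (by simp) (by simp) a f
  simpa using this

lemma dd_eq_derivation (a : σ → F) (D : Derivation k (MvPolynomial σ k) (MvPolynomial σ k))
    (f : MvPolynomial σ k) : aeval a (D f) = dd a (fun j => aeval a (D (X j))) f := by
  have := eq_dd_of_leibniz (k := k) (A := MvPolynomial σ k) (aeval a : _ →ₐ[k] F).toRingHom
    (((aeval a : _ →ₐ[k] F) : _ →+ F).comp (D : _ →+ MvPolynomial σ k)) (by intro x y; simp)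
    (by simp) (by simp) X f
  simpa using this

lemma dd_smul_vec (a c : σ → F) (t : F) (f : MvPolynomial σ k) :
    dd a (t • c) f = t * dd a c f := by
  simp only [dd, Finset.mul_sum, Pi.smul_apply, smul_eq_mul]
  exact Finset.sum_congr rfl fun j _ => by ring

lemma dd_sum_vec {ι : Type*} (s : Finset ι) (a : σ → F) (c : ι → σ → F) (f : MvPolynomial σ k) :
    dd a (∑ i ∈ s, c i) f = ∑ i ∈ s, dd a (c i) f := by
  simp only [dd, Finset.sum_apply, Finset.mul_sum]
  exact Finset.sum_comm

/-- Euler's identity. -/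
lemma dd_self {f : MvPolynomial σ k} {d : ℕ} (hf : f.IsHomogeneous d) (a : σ → F) :
    dd a a f = d * aeval a f := by
  have := congrArg (aeval a) hf.sum_X_mul_pderiv
  simp only [map_sum, map_mul, aeval_X, nsmul_eq_mul, map_natCast] at this
  rw [← this, dd]
  exact Finset.sum_congr rfl fun j _ => by ring

end Differentials

section Lifting

lemma exists_ringHom_lift {K F B : Type} [Field K] [CharZero K] [Field F] [CommRing B]
    (i : K →+* F) (g : K →+* B) (π : B →+* F) (hπ : Function.Surjective π)
    (hker : ∀ x y, π x = 0 → π y = 0 → x * y = 0) (hg : ∀ x, π (g x) = i x) :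
    ∃ s : F →+* B, (∀ x, π (s x) = x) ∧ ∀ x, s (i x) = g x := by
  let := i.toAlgebra
  let := g.toAlgebra
  have : CharZero F := charZero_of_injective_algebraMap i.injective
  obtain ⟨ι, v, hv⟩ := exists_isTranscendenceBasis' K F
  have : Algebra.IsAlgebraic (IntermediateField.adjoin K (Set.range v)) F := hv.isAlgebraic_field
  have : Algebra.FormallySmooth K F :=
    Algebra.FormallySmooth.of_algebraicIndependent_of_isSeparable hv.1
  let π' : B →ₐ[K] F := { π with commutes' := hg }
  have hnil : IsNilpotent (RingHom.ker (π' : B →+* F)) := by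
    refine ⟨2, ?_⟩
    rw [pow_two, Ideal.zero_eq_bot, eq_bot_iff, Ideal.mul_le]
    intro x hx y hy
    exact hker x y hx hy
  let s := Algebra.FormallySmooth.liftOfSurjective (AlgHom.id K F) π' hπ hnil
  refine ⟨s, fun x => ?_, fun x => s.commutes x⟩
  exact Algebra.FormallySmooth.liftOfSurjective_apply (AlgHom.id K F) π' hπ hnil x

variable {k : Type} [Field k] [CharZero k] {σ : Type} [Fintype σ]
  {F : Type} [Field F] [Algebra k F]

/-- Every tangent vector at the generic point `a` is the velocity of a derivation of `F`. -/
theorem exists_derivation (a c : σ → F)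
    (hc : ∀ f : MvPolynomial σ k, aeval a f = 0 → dd a c f = 0) :
    ∃ δ : Derivation k F F, ∀ j, δ (a j) = c j := by
  let R := MvPolynomial σ k
  let A := (aeval (R := k) a).range
  let G : R →ₐ[k] TrivSqZeroExt F F := aeval (fun j => TrivSqZeroExt.inl (a j) + TrivSqZeroExt.inr (c j))
  have hG1 : ∀ f, (G f).fst = aeval a f := by
    intro f
    have : ((TrivSqZeroExt.fstHom k F F).comp G) = aeval a := by
      ext j; simp [G, -DualNumber.inr_eq_smul_eps]
    exact DFunLike.congr_fun this f
  have hG2 : ∀ f, (G f).snd = dd a c f := by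
    intro f
    have := eq_dd_of_leibniz (k := k) (A := TrivSqZeroExt F F) (TrivSqZeroExt.fstHom k F F).toRingHom
      (TrivSqZeroExt.sndHom F F : TrivSqZeroExt F F →+ F) (by intro x y; simp [TrivSqZeroExt.snd_mul, mul_comm])
      (by intro r; simp [TrivSqZeroExt.algebraMap_eq_inl'])
      (by intro r; simp [TrivSqZeroExt.algebraMap_eq_inl'])
      (fun j => TrivSqZeroExt.inl (a j) + TrivSqZeroExt.inr (c j)) f
    simpa [G, -DualNumber.inr_eq_smul_eps] using this
  have hker : ∀ f, aeval a f = 0 → G f = 0 := by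
    intro f hf
    ext
    · simpa [hG1] using hf
    · simpa [hG2] using hc f hf
  let K := FractionRing A
  have : CharZero K :=
    have : CharZero A := charZero_of_injective_algebraMap (algebraMap k A).injective
    charZero_of_injective_algebraMap (IsFractionRing.injective A K)
  let q : R →+* A := (aeval (R := k) a).rangeRestrict.toRingHom
  have hq : Function.Surjective q := (aeval (R := k) a).rangeRestrict_surjective
  have hqv : ∀ f, ((q f : A) : F) = aeval a f := fun f => rfl
  let g0 : A →+* TrivSqZeroExt F F := RingHom.liftOfSurjective q hq ⟨G.toRingHom, by
    intro f hf
    have : aeval a f = 0 := by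
      rw [← hqv]; exact congrArg Subtype.val (hf : q f = 0)
    exact hker f this⟩
  have hg0 : ∀ f, g0 (q f) = G f := fun f => by
    have := RingHom.liftOfRightInverse_comp_apply q _ (Function.rightInverse_surjInv hq)
      ⟨G.toRingHom, by
        intro f hf
        have : aeval a f = 0 := by
          rw [← hqv]; exact congrArg Subtype.val (hf : q f = 0)
        exact hker f this⟩ f
    exact this
  have hg0fst : ∀ x, (g0 x).fst = (x : F) := by
    intro x
    obtain ⟨f, rfl⟩ := hq x
    rw [hg0, hG1, hqv]
  have hunit : ∀ y : nonZeroDivisors A, IsUnit (g0 y) := by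
    intro y
    rw [TrivSqZeroExt.isUnit_iff_isUnit_fst, hg0fst, isUnit_iff_ne_zero]
    intro h
    exact nonZeroDivisors.coe_ne_zero y (Subtype.ext h)
  let g : K →+* TrivSqZeroExt F F := IsLocalization.lift hunit
  let i : K →+* F := IsFractionRing.lift (g := A.val.toRingHom) Subtype.val_injective
  have hi : ∀ x : A, i (algebraMap A K x) = x := fun x => by
    simp [i]
  obtain ⟨s, hs1, hs2⟩ := exists_ringHom_lift i g (TrivSqZeroExt.fstHom k F F).toRingHom
    (fun x => ⟨TrivSqZeroExt.inl x, by simp⟩) (by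
      intro x y hx hy
      have hx' : x.fst = 0 := hx
      have hy' : y.fst = 0 := hy
      ext <;> simp [hx', hy']) (by
      have : ((TrivSqZeroExt.fstHom k F F).toRingHom.comp g) = i := by
        apply IsLocalization.ringHom_ext (nonZeroDivisors A)
        ext1 x
        simp only [RingHom.comp_apply, g, IsLocalization.lift_eq, hi]
        exact hg0fst x
      intro x
      exact DFunLike.congr_fun this x)
  have hs1' : ∀ x, (s x).fst = x := hs1
  have hsA : ∀ f, s (aeval a f) = G f := by
    intro f
    rw [← hqv, ← hi, hs2]
    simp only [g, IsLocalization.lift_eq, hg0]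
  refine ⟨Derivation.mk' (R := k) (A := F) (M := F)
    { toFun := fun x => (s x).snd
      map_add' := fun x y => by simp
      map_smul' := fun r x => by
        have : s (r • x) = G (C r) * s x := by
          rw [Algebra.smul_def, map_mul, ← hsA]; simp
        rw [this]
        simp [hG1, hG2, dd_C, Algebra.smul_def] } (fun x y => by
        simp [hs1', mul_comm]), fun j => ?_⟩
  classical
  have := hsA (X j)
  simp only [aeval_X] at this
  change (s (a j)).snd = c j
  rw [this, hG2, dd_X]

end Lifting

section Stable

variable {k : Type} [Field k] {F : Type} [Field F] [Algebra k F] {m : Type}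

/-- A subspace of `F^m` is stable if it is closed under entrywise application of derivations in a
given set. -/
def StableUnder (S : Set (Derivation k F F)) (U : Submodule F (m → F)) : Prop :=
  ∀ δ ∈ S, ∀ u ∈ U, (fun j => δ (u j)) ∈ U

lemma derivation_span_mem {ι : Type*} (δ : Derivation k F F) (w : ι → m → F)
    (U : Submodule F (m → F)) (hw : ∀ i, w i ∈ U) (hδ : ∀ i, (fun j => δ (w i j)) ∈ U) {u : m → F}
    (hu : u ∈ Submodule.span F (Set.range w)) : (fun j => δ (u j)) ∈ U := by
  have key : u ∈ U ∧ (fun j => δ (u j)) ∈ U := by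
    induction hu using Submodule.span_induction with
    | mem x hx =>
      obtain ⟨i, rfl⟩ := hx
      exact ⟨hw i, hδ i⟩
    | zero => exact ⟨U.zero_mem, by convert U.zero_mem using 1; ext; simp⟩
    | add x y _ _ hx hy =>
      refine ⟨U.add_mem hx.1 hy.1, ?_⟩
      convert U.add_mem hx.2 hy.2 using 1
      ext; simp
    | smul t x _ hx =>
      refine ⟨U.smul_mem t hx.1, ?_⟩
      convert U.add_mem (U.smul_mem t hx.2) (U.smul_mem (δ t) hx.1) using 1
      ext; simp [mul_comm]
  exact key.2

variable [CharZero k] [IsAlgClosed k]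

lemma mem_range_of_derivation_eq_zero (u : F) (hu : ∀ δ : Derivation k F F, δ u = 0) :
    ∃ r : k, algebraMap k F r = u := by
  by_cases hal : IsAlgebraic k u
  · have hint : IsIntegral k u := hal.isIntegral
    have h1 := IsAlgClosed.degree_eq_one_of_irreducible k (minpoly.irreducible hint)
    exact minpoly.mem_range_of_degree_eq_one k u h1
  · exfalso
    have htr : Transcendental k u := hal
    obtain ⟨δ, hδ⟩ := exists_derivation (k := k) (σ := Unit) (fun _ => u) (fun _ => 1) (by
      intro f hf
      have hai : AlgebraicIndependent k (fun _ : Unit => u) :=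
        algebraicIndependent_unique_type_iff.2 htr
      have : f = 0 := (injective_iff_map_eq_zero _).1 hai f hf
      simp [this, dd])
    have := hδ ()
    rw [hu] at this
    exact zero_ne_one this

variable [Fintype m]

/-- A proper subspace stable under all derivations lies in a hyperplane defined over `k`. -/
theorem eq_top_of_stable (U : Submodule F (m → F)) (hU : StableUnder (k := k) Set.univ U)
    (g : m → F) (hgU : g ∈ U)
    (hg : ∀ l : m → k, ∑ j, algebraMap k F (l j) * g j = 0 → l = 0) : U = ⊤ := by
  classical
  by_contra hne
  let P : (m → F) → Prop := fun l => l ≠ 0 ∧ ∀ u ∈ U, ∑ j, l j * u j = 0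
  have hex : ∃ n : ℕ, ∃ l, P l ∧ (Finset.univ.filter fun j => l j ≠ 0).card = n := by
    obtain ⟨f, hf, hfU⟩ := Submodule.exists_le_ker_of_lt_top U (lt_top_iff_ne_top.2 hne)
    have hval : ∀ u, f u = ∑ j, f (Pi.single j 1) * u j := by
      intro u
      conv_lhs => rw [pi_eq_sum_univ' u]
      simp [map_sum, mul_comm]
    refine ⟨_, fun j => f (Pi.single j 1), ⟨?_, ?_⟩, rfl⟩
    · intro h
      apply hf
      refine LinearMap.ext fun u => ?_
      rw [hval, LinearMap.zero_apply]
      exact Finset.sum_eq_zero fun j _ => by rw [show f (Pi.single j 1) = 0 from congrFun h j, zero_mul]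
    · intro u hu
      rw [← hval]
      exact hfU hu
  obtain ⟨l, ⟨hl0, hlU⟩, hcard⟩ := Nat.find_spec hex
  have hmin : ∀ l' : m → F, (∀ u ∈ U, ∑ j, l' j * u j = 0) →
      (Finset.univ.filter fun j => l' j ≠ 0).card < (Finset.univ.filter fun j => l j ≠ 0).card →
      l' = 0 := by
    intro l' hl' hc
    by_contra h0
    rw [hcard] at hc
    exact Nat.find_min hex hc ⟨l', ⟨h0, hl'⟩, rfl⟩
  obtain ⟨i, hi⟩ := Function.ne_iff.1 hl0
  have hi' : l i ≠ 0 := hi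
  have hconst : ∀ j, ∃ r : k, algebraMap k F r = l j / l i := by
    intro j
    apply mem_range_of_derivation_eq_zero
    intro δ
    have h0 := hmin (fun j => δ (l j / l i)) (by
      intro u hu
      have h1 : ∑ j, l j / l i * u j = 0 := by
        have := hlU u hu
        simp only [div_mul_eq_mul_div]
        rw [← Finset.sum_div, this, zero_div]
      have h2 : ∑ j, l j / l i * δ (u j) = 0 := by
        have := hlU _ (hU δ trivial u hu)
        simp only [div_mul_eq_mul_div]
        rw [← Finset.sum_div, this, zero_div]
      have h3 := congrArg δ h1
      simp only [map_sum, Derivation.leibniz, smul_eq_mul, Finset.sum_add_distrib, map_zero] at h3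
      rw [h2, zero_add] at h3
      rw [← h3]
      exact Finset.sum_congr rfl fun j _ => mul_comm _ _) (by
      apply Finset.card_lt_card
      refine ⟨fun j => ?_, fun h => ?_⟩
      · simp only [Finset.mem_filter, Finset.mem_univ, true_and]
        intro h hj
        simp [hj] at h
      · have := h (Finset.mem_filter.2 ⟨Finset.mem_univ i, hi'⟩)
        simp [div_self hi'] at this)
    exact congrFun h0 j
  choose r hr using hconst
  have : r = 0 := hg r (by
    have := hlU g hgU
    simp only [hr, div_mul_eq_mul_div]
    rw [← Finset.sum_div, this, zero_div])
  have h1 := hr i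
  rw [this, div_self hi'] at h1
  simp at h1

end Stable

section Homog

variable {k : Type} [Field k] {σ : Type} {A : Type*} [CommRing A] [Algebra k A]

lemma aeval_mul_of_isHomogeneous {f : MvPolynomial σ k} {d : ℕ} (hf : f.IsHomogeneous d)
    (t : A) (a : σ → A) : aeval (fun j => t * a j) f = t ^ d * aeval a f := by
  simp only [aeval_def, eval₂_eq, Finset.mul_sum]
  refine Finset.sum_congr rfl fun m hm => ?_
  simp only [mul_pow, Finset.prod_mul_distrib, Finset.prod_pow_eq_pow_sum]
  have : ∑ i ∈ m.support, m i = d := by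
    have := hf (mem_support_iff.1 hm)
    rw [Finsupp.weight_apply] at this
    simpa [Finsupp.sum] using this
  rw [this]; ring

lemma eval_mul_of_isHomogeneous {f : MvPolynomial σ k} {d : ℕ} (hf : f.IsHomogeneous d)
    (t : k) (a : σ → k) : eval (fun j => t * a j) f = t ^ d * eval a f :=
  aeval_mul_of_isHomogeneous (A := k) hf t a

/-- The restriction of `f` to the line spanned by `v`. -/
noncomputable def lineP (v : σ → k) : MvPolynomial σ k →ₐ[k] Polynomial k :=
  aeval (fun j => Polynomial.X * Polynomial.C (v j))

lemma eval_lineP (v : σ → k) (f : MvPolynomial σ k) (t : k) :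
    (lineP v f).eval t = eval (fun j => t * v j) f := by
  induction f using MvPolynomial.induction_on with
  | C r => simp [lineP, ← Polynomial.C_eq_algebraMap]
  | add p q hp hq => simp [hp, hq]
  | mul_X p i hp =>
    simp only [map_mul, Polynomial.eval_mul, hp, eval_X]
    congr 1
    rw [lineP, aeval_X, Polynomial.eval_mul, Polynomial.eval_X, Polynomial.eval_C]


lemma aeval_C_comp (f : MvPolynomial σ k) (v : σ → k) :
    aeval (fun j => Polynomial.C (v j)) f = Polynomial.C (eval v f) := by
  have : (aeval (fun j => Polynomial.C (v j)) : MvPolynomial σ k →ₐ[k] Polynomial k) =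
      (Algebra.ofId k (Polynomial k)).comp (aeval v) := by
    ext j; simp [Algebra.ofId_apply]
  rw [this]; rfl

lemma coeff_lineP (v : σ → k) (f : MvPolynomial σ k) (d : ℕ) :
    (lineP v f).coeff d = eval v (homogeneousComponent d f) := by
  conv_lhs => rw [← sum_homogeneousComponent f, map_sum, Polynomial.finset_sum_coeff]
  have : ∀ i, (lineP v (homogeneousComponent i f)).coeff d =
      if i = d then eval v (homogeneousComponent i f) else 0 := by
    intro i
    rw [lineP, aeval_mul_of_isHomogeneous (homogeneousComponent_isHomogeneous i f), aeval_C_comp,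
      Polynomial.coeff_X_pow_mul', Polynomial.coeff_C]
    split_ifs <;> first | rfl | omega
  simp only [this, Finset.sum_ite_eq', Finset.mem_range]
  split_ifs with h
  · rfl
  · rw [homogeneousComponent_eq_zero _ _ (by omega)]; simp

end Homog

section Cone

variable {k : Type} [Field k] {M : ℕ}

/-- The affine cone (without the vertex) over a set of points of projective space. -/
def cone (X : Set (Pr k M)) : Set (Fin (M + 1) → k) := {v | ∃ h : v ≠ 0, Projectivization.mk k v h ∈ X}

/-- The ideal of a set of points of projective space. -/
def Van (X : Set (Pr k M)) : Ideal (MvPolynomial (Fin (M + 1)) k) where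
  carrier := {f | ∀ v ∈ cone X, eval v f = 0}
  zero_mem' := fun v _ => by simp
  add_mem' := fun ha hb v hv => by simp [ha v hv, hb v hv]
  smul_mem' := fun c f hf v hv => by simp [hf v hv]

lemma mem_Van {X : Set (Pr k M)} {f : MvPolynomial (Fin (M + 1)) k} :
    f ∈ Van X ↔ ∀ v ∈ cone X, eval v f = 0 := Iff.rfl

lemma smul_mem_cone {X : Set (Pr k M)} {v : Fin (M + 1) → k} (hv : v ∈ cone X) {t : k}
    (ht : t ≠ 0) : (fun j => t * v j) ∈ cone X := by
  obtain ⟨h, hX⟩ := hv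
  have h' : (fun j => t * v j) ≠ 0 := smul_ne_zero ht h
  refine ⟨h', ?_⟩
  have : Projectivization.mk k (fun j => t * v j) h' = Projectivization.mk k v h := by
    rw [Projectivization.mk_eq_mk_iff']
    exact ⟨t, rfl⟩
  rwa [this]

lemma rep_mem_cone {X : Set (Pr k M)} {p : Pr k M} (hp : p ∈ X) : p.rep ∈ cone X :=
  ⟨p.rep_nonzero, by rwa [p.mk_rep]⟩

lemma vanishes_iff {f : MvPolynomial (Fin (M + 1)) k} {d : ℕ} (hf : f.IsHomogeneous d)
    {v : Fin (M + 1) → k} (hv : v ≠ 0) :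
    Vanishes f (Projectivization.mk k v hv) ↔ eval v f = 0 := by
  refine ⟨fun h => h v hv rfl, fun h w hw hwv => ?_⟩
  obtain ⟨t, rfl⟩ := (Projectivization.mk_eq_mk_iff' k w v hw hv).1 hwv
  exact (eval_mul_of_isHomogeneous hf t v).trans (by rw [h, mul_zero])

variable [Infinite k]

lemma eval_homogeneousComponent_eq_zero {v : Fin (M + 1) → k} {f : MvPolynomial (Fin (M + 1)) k}
    (h : ∀ t : k, t ≠ 0 → eval (fun j => t * v j) f = 0) (d : ℕ) :
    eval v (homogeneousComponent d f) = 0 := by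
  rw [← coeff_lineP]
  have : lineP v f = 0 := by
    have h2 : lineP v f * Polynomial.X = 0 := by
      apply Polynomial.funext
      intro t
      by_cases ht : t = 0
      · simp [ht]
      · simp [eval_lineP, h t ht]
    rcases mul_eq_zero.1 h2 with h | h
    · exact h
    · exact absurd h Polynomial.X_ne_zero
  simp [this]

lemma homogeneousComponent_mem_Van {X : Set (Pr k M)} {f : MvPolynomial (Fin (M + 1)) k}
    (hf : f ∈ Van X) (d : ℕ) : homogeneousComponent d f ∈ Van X := fun _ hv =>
  eval_homogeneousComponent_eq_zero (fun _ ht => hf _ (smul_mem_cone hv ht)) d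

/-- The closed set of points at which all homogeneous components of `f` vanish. -/
def homZero (f : MvPolynomial (Fin (M + 1)) k) : Set (Pr k M) :=
  {p | ∀ g ∈ Set.range (fun d => homogeneousComponent d f), Vanishes g p}

omit [Infinite k] in
lemma isAlgSet_homZero (f : MvPolynomial (Fin (M + 1)) k) : IsAlgSet (homZero f) :=
  ⟨_, by rintro _ ⟨d, rfl⟩; exact ⟨d, homogeneousComponent_isHomogeneous d f⟩, rfl⟩

omit [Infinite k] in
lemma mk_mem_homZero {f : MvPolynomial (Fin (M + 1)) k} {v : Fin (M + 1) → k} (hv : v ≠ 0) :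
    Projectivization.mk k v hv ∈ homZero f ↔ lineP v f = 0 := by
  simp only [homZero, mem_setOf_eq, forall_mem_range,
    vanishes_iff (homogeneousComponent_isHomogeneous _ f), ← coeff_lineP]
  rw [Polynomial.ext_iff]; simp

omit [Infinite k] in
lemma eval_eq_zero_of_mem_homZero {f : MvPolynomial (Fin (M + 1)) k} {v : Fin (M + 1) → k} (hv : v ≠ 0)
    (h : Projectivization.mk k v hv ∈ homZero f) : eval v f = 0 := by
  rw [mk_mem_homZero] at h
  have := eval_lineP v f 1
  simpa [h] using this.symm

omit [Infinite k] in
lemma mem_Van_of_subset_homZero {X : Set (Pr k M)} {f : MvPolynomial (Fin (M + 1)) k}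
    (h : X ⊆ homZero f) : f ∈ Van X := fun _ hv =>
  eval_eq_zero_of_mem_homZero hv.1 (h hv.2)

lemma Van_isPrime {X : Set (Pr k M)} (hX : IsVariety X) : (Van X).IsPrime := by
  refine ⟨?_, ?_⟩
  · obtain ⟨p, hp⟩ := hX.2.1
    intro h
    have : (1 : MvPolynomial (Fin (M + 1)) k) ∈ Van X := h ▸ Submodule.mem_top
    have := this _ (rep_mem_cone hp)
    simp at this
  · intro f g hfg
    have := hX.2.2 (homZero f) (homZero g) (isAlgSet_homZero f) (isAlgSet_homZero g) (by
      intro p hp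
      induction p using Projectivization.ind with | h v hv =>
      have hv' : v ∈ cone X := ⟨hv, hp⟩
      rw [mem_union, mk_mem_homZero, mk_mem_homZero, ← mul_eq_zero, ← map_mul]
      ext d
      rw [coeff_lineP]
      simpa using homogeneousComponent_mem_Van hfg d v hv')
    exact this.imp mem_Van_of_subset_homZero mem_Van_of_subset_homZero

omit [Infinite k] in
lemma mem_of_Van {X : Set (Pr k M)} (hX : IsAlgSet X) {v : Fin (M + 1) → k} (hv : v ≠ 0)
    (h : ∀ f ∈ Van X, eval v f = 0) : Projectivization.mk k v hv ∈ X := by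
  obtain ⟨S, hS, rfl⟩ := hX
  intro f hf
  obtain ⟨d, hd⟩ := hS f hf
  rw [vanishes_iff hd]
  refine h f fun w hw => ?_
  obtain ⟨hw, hw2⟩ := hw
  exact (vanishes_iff hd hw).1 (hw2 f hf)

omit [Infinite k] in
lemma mem_Van_iff_of_isHomogeneous {X : Set (Pr k M)} {f : MvPolynomial (Fin (M + 1)) k} {d : ℕ}
    (hf : f.IsHomogeneous d) : f ∈ Van X ↔ ∀ q ∈ X, Vanishes f q := by
  constructor
  · intro h q hq
    induction q using Projectivization.ind with | h v hv =>
    rw [vanishes_iff hf]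
    exact h v ⟨hv, hq⟩
  · rintro h v ⟨hv, hv2⟩
    exact (vanishes_iff hf hv).1 (h _ hv2)

lemma mem_embTangent {X : Set (Pr k M)} {p : Pr k M} {c : Fin (M + 1) → k} :
    c ∈ embTangent X p ↔ ∀ f ∈ Van X, (∃ d, f.IsHomogeneous d) → dd (k := k) p.rep c f = 0 := by
  simp only [embTangent, Submodule.mem_iInf, mem_setOf_eq, LinearMap.mem_ker, diffAt]
  constructor
  · rintro h f hf ⟨d, hd⟩
    have := h f ⟨⟨d, hd⟩, (mem_Van_iff_of_isHomogeneous hd).1 hf⟩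
    simpa [dd, coe_aeval_eq_eval] using this
  · rintro h f ⟨⟨d, hd⟩, h2⟩
    have := h f ((mem_Van_iff_of_isHomogeneous hd).2 h2) ⟨d, hd⟩
    simpa [dd, coe_aeval_eq_eval] using this

lemma mem_Tg_iff_homogeneous {F : Type} [Field F] [Algebra k F] {X : Set (Pr k M)}
    {a c : Fin (M + 1) → F} : c ∈ Tg (Van X) a ↔
      ∀ f ∈ Van X, (∃ d, f.IsHomogeneous d) → dd a c f = 0 := by
  refine ⟨fun h f hf _ => h f hf, fun h f hf => ?_⟩
  rw [← sum_homogeneousComponent f]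
  have : ∀ s : Finset ℕ, dd a c (∑ i ∈ s, homogeneousComponent i f) = 0 := by
    intro s
    induction s using Finset.induction_on with
    | empty => simp [dd]
    | insert i s his ih =>
      rw [Finset.sum_insert his, dd_add, ih, add_zero]
      exact h _ (homogeneousComponent_mem_Van hf i) ⟨i, homogeneousComponent_isHomogeneous i f⟩
  exact this _

lemma embTangent_eq (X : Set (Pr k M)) (p : Pr k M) : embTangent X p = Tg (Van X) p.rep := by
  ext c; rw [mem_embTangent, mem_Tg_iff_homogeneous]

lemma Tg_smul {F : Type} [Field F] [Algebra k F] (X : Set (Pr k M)) (a : Fin (M + 1) → F) {t : F}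
    (ht : t ≠ 0) : Tg (Van X) (fun j => t * a j) = Tg (Van X) a := by
  ext c
  simp only [mem_Tg_iff_homogeneous]
  refine forall₂_congr fun f _ => forall_congr' fun ⟨d, hd⟩ => ?_
  have : dd (fun j => t * a j) c f = t ^ (d - 1) * dd a c f := by
    simp only [dd, Finset.mul_sum]
    refine Finset.sum_congr rfl fun j _ => ?_
    rw [aeval_mul_of_isHomogeneous (hd.pderiv), mul_assoc]
  rw [this]
  simp [ht]

/-- A property of vectors in the cone over `X` that holds away from a proper closed subset. -/
def Gen (X : Set (Pr k M)) (P : (Fin (M + 1) → k) → Prop) : Prop :=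
  ∃ g ∉ Van X, ∀ v ∈ cone X, eval v g ≠ 0 → P v

omit [Infinite k] in
lemma Gen.and {X : Set (Pr k M)} (hp : (Van X).IsPrime) {P Q : (Fin (M + 1) → k) → Prop}
    (hP : Gen X P) (hQ : Gen X Q) : Gen X (fun v => P v ∧ Q v) := by
  obtain ⟨g, hg, h1⟩ := hP
  obtain ⟨h, hh, h2⟩ := hQ
  refine ⟨g * h, fun hm => (hp.mem_or_mem hm).elim hg hh, fun v hv hne => ?_⟩
  rw [map_mul] at hne
  exact ⟨h1 v hv (left_ne_zero_of_mul hne), h2 v hv (right_ne_zero_of_mul hne)⟩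

lemma Gen.forGeneral {X : Set (Pr k M)} {P : Pr k M → Prop} {Q : (Fin (M + 1) → k) → Prop}
    (h : Gen X Q) (hQ : ∀ v (hv : v ≠ 0), Projectivization.mk k v hv ∈ X → Q v →
      P (Projectivization.mk k v hv)) :
    ForGeneralPointOn X P := by
  obtain ⟨g, hg, h1⟩ := h
  refine ⟨homZero g, isAlgSet_homZero g, fun hs => hg (mem_Van_of_subset_homZero hs), ?_⟩
  rintro x ⟨hx, hxg⟩
  induction x using Projectivization.ind with | h v hv =>
  have hv' : v ∈ cone X := ⟨hv, hx⟩
  obtain ⟨t, ht, hne⟩ : ∃ t : k, t ≠ 0 ∧ eval (fun j => t * v j) g ≠ 0 := by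
    by_contra! hcon
    apply hxg
    rw [mk_mem_homZero]
    ext d
    rw [coeff_lineP]
    simpa using eval_homogeneousComponent_eq_zero hcon d
  have hc := smul_mem_cone hv' ht
  have := hQ _ hc.1 hc.2 (h1 _ hc hne)
  have heq : Projectivization.mk k (fun j => t * v j) hc.1 = Projectivization.mk k v hv := by
    rw [Projectivization.mk_eq_mk_iff']; exact ⟨t, rfl⟩
  rwa [heq] at this

end Cone

section Minor

variable {k : Type} [Field k] {σ : Type} {F : Type} [Field F] [Algebra k F]

/-- Linear independence at a point persists on the nonvanishing locus of a minor. -/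
lemma exists_minor {r : ℕ} {m : Type} [Fintype m] (w : Fin r → m → MvPolynomial σ k) (v : σ → F)
    (h : LinearIndependent F (fun i j => aeval v (w i j))) :
    ∃ μ : MvPolynomial σ k, aeval v μ ≠ 0 ∧ ∀ (F' : Type) [Field F'] [Algebra k F'] (a : σ → F'),
      aeval a μ ≠ 0 → LinearIndependent F' (fun i j => aeval a (w i j)) := by
  classical
  let A : Matrix (Fin r) m F := Matrix.of fun i j => aeval v (w i j)
  have hrank : A.rank = r := by simpa using LinearIndependent.rank_matrix (M := A) h
  rw [Matrix.rank_eq_finrank_span_cols] at hrank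
  obtain ⟨f, hf, -, hli⟩ := Submodule.exists_fun_fin_finrank_span_eq F (Set.range A.col)
  choose c hc using hf
  let c' : Fin r → m := fun i => c (Fin.cast hrank.symm i)
  have hli' : LinearIndependent F (fun i => A.col (c' i)) := by
    have := hli.comp (Fin.cast hrank.symm) (Fin.cast_injective _)
    have h2 : (fun i => A.col (c' i)) = f ∘ Fin.cast hrank.symm := funext fun i => hc _
    rw [h2]; exact this
  let μ : MvPolynomial σ k := (Matrix.of fun i i' => w i (c' i')).det
  have hμ : ∀ (F' : Type) [Field F'] [Algebra k F'] (a : σ → F'),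
      aeval a μ = (Matrix.of fun i i' => aeval a (w i (c' i'))).det := by
    intro F' _ _ a
    rw [AlgHom.map_det]; rfl
  refine ⟨μ, ?_, fun F' _ _ a ha => ?_⟩
  · rw [hμ, ← isUnit_iff_ne_zero, ← Matrix.isUnit_iff_isUnit_det,
      ← Matrix.linearIndependent_cols_iff_isUnit]
    exact hli'
  · rw [hμ, ← isUnit_iff_ne_zero, ← Matrix.isUnit_iff_isUnit_det,
      ← Matrix.linearIndependent_rows_iff_isUnit] at ha
    exact LinearIndependent.of_comp
      (LinearMap.pi fun i' => LinearMap.proj (c' i') : (m → F') →ₗ[F'] (Fin r → F')) ha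

end Minor

section Frame

variable {k : Type} [Field k] {n : ℕ} (I : Ideal (MvPolynomial (Fin n) k))

lemma exists_rows (v : Fin n → k) :
    ∃ (A : Matrix (Fin n) (Fin n) (MvPolynomial (Fin n) k)) (b : Set (Fin n)),
      eval v A.det ≠ 0 ∧ (∀ i ∈ b, ∃ f ∈ I, ∀ j, A i j = pderiv j f) ∧
      ∀ c : Fin n → k, (∀ i ∈ b, ∑ j, eval v (A i j) * c j = 0) → c ∈ Tg I v := by
  classical
  let G : Set (Fin n → k) := {u | ∃ f ∈ I, u = fun j => eval v (pderiv j f)}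
  obtain ⟨b, hbG, hspan, hli⟩ := exists_linearIndependent k G
  have hs : LinearIndepOn k id b := hli
  let B := Basis.extend hs
  have : Fintype (hs.extend (subset_univ b)) := FiniteDimensional.fintypeBasisIndex B
  have hcard : Fintype.card (hs.extend (subset_univ b)) = n := by
    rw [← finrank_eq_card_basis B]; simp
  let e : hs.extend (subset_univ b) ≃ Fin n := Fintype.equivFinOfCardEq hcard
  let u : Fin n → Fin n → k := fun i => e.symm i
  have hu : LinearIndependent k u := by
    have := B.linearIndependent.comp e.symm e.symm.injective
    have h2 : u = B ∘ e.symm := funext fun i => by simp [u, B]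
    rw [h2]; exact this
  have hex : ∀ i, ∃ f, u i ∈ b → f ∈ I ∧ u i = fun j => eval v (pderiv j f) := by
    intro i
    by_cases hi : u i ∈ b
    · obtain ⟨f, hf, hf2⟩ := hbG hi
      exact ⟨f, fun _ => ⟨hf, hf2⟩⟩
    · exact ⟨0, fun h => absurd h hi⟩
  choose f hf using hex
  let A : Matrix (Fin n) (Fin n) (MvPolynomial (Fin n) k) := Matrix.of fun i j =>
    if u i ∈ b then pderiv j (f i) else C (u i j)
  have hA : ∀ i j, eval v (A i j) = u i j := by
    intro i j
    simp only [A, Matrix.of_apply]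
    split_ifs with h
    · exact (congrFun (hf i h).2 j).symm
    · simp
  refine ⟨A, {i | u i ∈ b}, ?_, ?_, ?_⟩
  · have : eval v A.det = (Matrix.of u).det := by
      rw [RingHom.map_det]
      congr 1
      ext i j
      exact hA i j
    rw [this, ← isUnit_iff_ne_zero, ← Matrix.isUnit_iff_isUnit_det,
      ← Matrix.linearIndependent_rows_iff_isUnit]
    exact hu
  · intro i hi
    refine ⟨f i, (hf i hi).1, fun j => ?_⟩
    simp only [A, Matrix.of_apply]
    exact if_pos hi
  · intro c hc
    have hb : ∀ w ∈ b, ∑ j, w j * c j = 0 := by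
      intro w hw
      have hw' : w ∈ hs.extend (subset_univ b) := hs.subset_extend _ hw
      have hui : u (e ⟨w, hw'⟩) = w := by simp [u]
      have := hc (e ⟨w, hw'⟩) (by simp only [mem_setOf_eq, hui]; exact hw)
      simpa only [hA, hui] using this
    have hall : ∀ w ∈ Submodule.span k G, ∑ j, w j * c j = 0 := by
      intro w hw
      rw [← hspan] at hw
      induction hw using Submodule.span_induction with
      | mem x hx => exact hb x hx
      | zero => simp
      | add x y _ _ hx hy => simp [add_mul, Finset.sum_add_distrib, hx, hy]
      | smul t x _ hx => simp [mul_assoc, ← Finset.mul_sum, hx]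
    intro f hf
    exact hall _ (Submodule.subset_span ⟨f, hf, rfl⟩)

/-- A frame of derivations spanning the tangent spaces near a point. -/
lemma exists_frame (v : Fin n → k) (hv3 : finrank k (Tg I v) = 3) :
    ∃ (D : Fin 3 → Derivation k (MvPolynomial (Fin n) k) (MvPolynomial (Fin n) k))
      (Δ : MvPolynomial (Fin n) k), eval v Δ ≠ 0 ∧
      ∀ (F : Type) [Field F] [Algebra k F] (a : Fin n → F), aeval a Δ ≠ 0 →
        LinearIndependent F (fun i j => aeval a (D i (X j))) ∧
        ∀ c ∈ Tg I a, ∃ t : Fin 3 → F, c = ∑ i, t i • fun j => aeval a (D i (X j)) := by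
  classical
  obtain ⟨A, b, hdet, hb, hTg⟩ := exists_rows I v
  let D : Fin n → Derivation k (MvPolynomial (Fin n) k) (MvPolynomial (Fin n) k) := fun i =>
    mkDerivation k (fun j => A.adjugate j i)
  have hDX : ∀ i j, D i (X j) = A.adjugate j i := fun i j => by simp [D, mkDerivation_X]
  have key : ∀ (F : Type) [Field F] [Algebra k F] (a : Fin n → F), aeval a A.det ≠ 0 →
      LinearIndependent F (fun i j => aeval a (D i (X j))) ∧
      (∀ c : Fin n → F, aeval a A.det • c =
        ∑ i, (∑ j, aeval a (A i j) * c j) • fun j => aeval a (D i (X j))) ∧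
      ∀ i i', ∑ j, aeval a (A i' j) * aeval a (D i (X j)) = if i' = i then aeval a A.det else 0 := by
    intro F _ _ a ha
    let A' : Matrix (Fin n) (Fin n) F := Matrix.of fun i j => aeval a (A i j)
    have hA' : (aeval a).mapMatrix A = A' := rfl
    have hdet' : aeval a A.det = A'.det := by rw [AlgHom.map_det, hA']
    have hadj : ∀ i j, aeval a (D i (X j)) = A'.adjugate j i := by
      intro i j
      rw [hDX, ← hA', ← AlgHom.map_adjugate]; rfl
    refine ⟨?_, ?_, ?_⟩
    · have : IsUnit A'.adjugate := by
        rw [Matrix.isUnit_iff_isUnit_det, Matrix.det_adjugate, ← hdet']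
        exact (isUnit_iff_ne_zero.2 ha).pow _
      rw [← Matrix.linearIndependent_cols_iff_isUnit] at this
      convert this using 1
      ext i j
      exact hadj i j
    · intro c
      have h1 : (A'.adjugate * A').mulVec c = A'.det • c := by
        rw [Matrix.adjugate_mul, Matrix.smul_mulVec, Matrix.one_mulVec]
      rw [hdet', ← h1, ← Matrix.mulVec_mulVec]
      ext j
      rw [Finset.sum_apply]
      simp only [Pi.smul_apply, smul_eq_mul, hadj]
      simp only [Matrix.mulVec, dotProduct]
      exact Finset.sum_congr rfl fun i _ => mul_comm _ _
    · intro i i'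
      have h1 : (A' * A'.adjugate) i' i = (A'.det • (1 : Matrix (Fin n) (Fin n) F)) i' i := by
        rw [Matrix.mul_adjugate]
      rw [hdet']
      simp only [hadj]
      rw [Matrix.mul_apply] at h1
      simp only [Matrix.smul_apply, Matrix.one_apply, smul_eq_mul, mul_ite, mul_one, mul_zero] at h1
      exact h1
  have hTgb : ∀ (F : Type) [Field F] [Algebra k F] (a : Fin n → F), aeval a A.det ≠ 0 →
      ∀ c ∈ Tg I a, c = ∑ i : {i // i ∉ b}, ((aeval a A.det)⁻¹ * ∑ j, aeval a (A i j) * c j) •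
        fun j => aeval a (D i (X j)) := by
    intro F _ _ a ha c hc
    obtain ⟨-, h2, -⟩ := key F a ha
    have h3 : ∀ i ∈ b, ∑ j, aeval a (A i j) * c j = 0 := by
      intro i hi
      obtain ⟨f, hf, hfA⟩ := hb i hi
      simp only [hfA]
      exact hc f hf
    have h4 : c = (aeval a A.det)⁻¹ • ∑ i, (∑ j, aeval a (A i j) * c j) •
        fun j => aeval a (D i (X j)) := by
      rw [← h2, smul_smul, inv_mul_cancel₀ ha, one_smul]
    conv_lhs => rw [h4]
    rw [Finset.smul_sum]
    simp only [smul_smul]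
    rw [← Finset.sum_filter_add_sum_filter_not Finset.univ (fun i => i ∉ b), add_eq_left.2]
    · exact (Finset.sum_subtype _ (by simp) _)
    · refine Finset.sum_eq_zero fun i hi => ?_
      rw [h3 i (by simpa using hi)]; simp
  have hdetv : aeval v A.det ≠ 0 := hdet
  obtain ⟨k1, k2, k3⟩ := key k v hdetv
  have hspan : Tg I v = Submodule.span k (Set.range fun (i : {i // i ∉ b}) => fun j => aeval v (D i (X j))) := by
    apply le_antisymm
    · intro c hc
      rw [hTgb k v hdetv c hc]
      exact Submodule.sum_mem _ fun i _ => Submodule.smul_mem _ _ (Submodule.subset_span ⟨i, rfl⟩)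
    · rw [Submodule.span_le]
      rintro _ ⟨i, rfl⟩
      apply hTg
      intro i' hi'
      have := k3 i i'
      rw [if_neg (by rintro rfl; exact i.2 hi')] at this
      exact this
  have hcard : Fintype.card {i // i ∉ b} = 3 := by
    rw [← hv3, hspan, finrank_span_eq_card]
    exact k1.comp _ Subtype.val_injective
  let e : Fin 3 ≃ {i // i ∉ b} := (Fintype.equivFinOfCardEq hcard).symm
  refine ⟨fun i => D (e i), A.det, hdet, fun F _ _ a ha => ⟨?_, fun c hc => ?_⟩⟩
  · exact (key F a ha).1.comp _ (Subtype.val_injective.comp e.injective)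
  · have := hTgb F a ha c hc
    exact ⟨fun i => (aeval a A.det)⁻¹ * ∑ j, aeval a (A (e i) j) * c j, by
      rw [← e.sum_comp] at this; exact this⟩

end Frame

section Tangent

variable {k : Type} [Field k] {σ m : Type} [Fintype σ] {F : Type} [Field F] [Algebra k F]

/-- The differential at `a` of the polynomial map `Φ`. -/
noncomputable def dmap (Φ : m → MvPolynomial σ k) (a : σ → F) : (σ → F) →ₗ[F] (m → F) where
  toFun c := fun j => dd a c (Φ j)
  map_add' c c' := by ext j; simp [dd, mul_add, Finset.sum_add_distrib]
  map_smul' t c := by ext j; simp [dd_smul_vec]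

lemma dmap_apply (Φ : m → MvPolynomial σ k) (a c : σ → F) (j : m) : dmap Φ a c j = dd a c (Φ j) := rfl

/-- The image of the tangent space at `a` under the differential of `Φ`. -/
noncomputable def Sp (I : Ideal (MvPolynomial σ k)) (Φ : m → MvPolynomial σ k) (a : σ → F) :
    Submodule F (m → F) := (Tg I a).map (dmap Φ a)

variable {I : Ideal (MvPolynomial σ k)} {Φ : m → MvPolynomial σ k} {a : σ → F}

lemma derivation_mem_Tg (ha : ∀ f ∈ I, aeval a f = 0) (δ : Derivation k F F) :
    (fun j => δ (a j)) ∈ Tg I a := fun f hf => by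
  rw [← derivation_aeval, ha f hf, map_zero]

lemma derivation_mem_Sp (ha : ∀ f ∈ I, aeval a f = 0) (δ : Derivation k F F) :
    (fun j => δ (aeval a (Φ j))) ∈ Sp I Φ a :=
  ⟨_, derivation_mem_Tg ha δ, by ext j; rw [dmap_apply, derivation_aeval]⟩

lemma derivation_dd_of_eq_zero (δ : Derivation k F F) (hδ : ∀ j, δ (a j) = 0) (c : σ → F)
    (f : MvPolynomial σ k) : δ (dd a c f) = dd a (fun j => δ (c j)) f := by
  simp only [dd, map_sum]
  refine Finset.sum_congr rfl fun j _ => ?_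
  have : δ (aeval a (pderiv j f)) = 0 := by
    rw [derivation_aeval]; simp [dd, hδ]
  simp [this]

/-- The tangent space does not move along derivations that kill the point. -/
lemma Sp_stable (δ : Derivation k F F) (hδ : ∀ j, δ (a j) = 0) {u : m → F} (hu : u ∈ Sp I Φ a) :
    (fun j => δ (u j)) ∈ Sp I Φ a := by
  obtain ⟨c, hc, rfl⟩ := hu
  refine ⟨fun j => δ (c j), fun f hf => ?_, ?_⟩
  · rw [← derivation_dd_of_eq_zero δ hδ, hc f hf, map_zero]
  · ext j
    simp only [dmap_apply]
    rw [derivation_dd_of_eq_zero δ hδ]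

end Tangent

section Chart

variable {k : Type} [Field k] {M N : ℕ}

lemma self_mem_Tg [Infinite k] {X : Set (Pr k M)} {F : Type} [Field F] [Algebra k F] {a : Fin (M + 1) → F}
    (ha : ∀ f ∈ Van X, aeval a f = 0) : a ∈ Tg (Van X) a := by
  rw [mem_Tg_iff_homogeneous]
  rintro f hf ⟨d, hd⟩
  rw [dd_self hd, ha f hf, mul_zero]

lemma self_mem_Sp [Infinite k] [CharZero k] {X : Set (Pr k M)} {F : Type} [Field F] [Algebra k F]
    {a : Fin (M + 1) → F} (ha : ∀ f ∈ Van X, aeval a f = 0) {m : Type}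
    {Φ : m → MvPolynomial (Fin (M + 1)) k} {d : ℕ} (hd : d ≠ 0) (hΦ : ∀ j, (Φ j).IsHomogeneous d) :
    (fun j => aeval a (Φ j)) ∈ Sp (Van X) Φ a := by
  have : CharZero F := charZero_of_injective_algebraMap (algebraMap k F).injective
  have hd' : (d : F) ≠ 0 := by exact_mod_cast hd
  refine ⟨(d : F)⁻¹ • a, Submodule.smul_mem _ _ (self_mem_Tg ha), ?_⟩
  ext j
  rw [map_smul, Pi.smul_apply, dmap_apply, dd_self (hΦ j), smul_eq_mul, inv_mul_cancel_left₀ hd']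

lemma jacobian_apply (Φ : Fin (N + 1) → MvPolynomial (Fin (M + 1)) k) (v c : Fin (M + 1) → k) :
    jacobian Φ v c = dmap Φ v c := by
  ext j; simp [jacobian, dmap_apply, dd, Matrix.mulVec, dotProduct]

/-- A frame of derivations of the cone over `X` together with a representation of `φ`, immersive
where `Δ` does not vanish. -/
structure MapChart (X : Set (Pr k M)) (φ : Pr k M → Pr k N) where
  D : Fin 3 → Derivation k (MvPolynomial (Fin (M + 1)) k) (MvPolynomial (Fin (M + 1)) k)
  Δ : MvPolynomial (Fin (M + 1)) k
  Φ : Fin (N + 1) → MvPolynomial (Fin (M + 1)) k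
  deg : ℕ
  hom : ∀ j, (Φ j).IsHomogeneous deg
  pres : ∀ i, ∀ f ∈ Van X, D i f ∈ Van X
  tan : ∀ (F : Type) [Field F] [Algebra k F] (a : Fin (M + 1) → F), aeval a Δ ≠ 0 →
    ∀ c ∈ Tg (Van X) a, ∃ t : Fin 3 → F, c = ∑ i, t i • fun j => aeval a (D i (MvPolynomial.X j))
  li : ∀ (F : Type) [Field F] [Algebra k F] (a : Fin (M + 1) → F), aeval a Δ ≠ 0 →
    LinearIndependent F (fun i j => aeval a (D i (Φ j)))
  ne : ∀ (F : Type) [Field F] [Algebra k F] (a : Fin (M + 1) → F), aeval a Δ ≠ 0 →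
    (fun j => aeval a (Φ j)) ≠ 0
  rep : ∀ (v : Fin (M + 1) → k) (hv : v ≠ 0), Projectivization.mk k v hv ∈ X →
    ∀ h : (fun j => eval v (Φ j)) ≠ 0,
      φ (Projectivization.mk k v hv) = Projectivization.mk k (fun j => eval v (Φ j)) h

variable {X : Set (Pr k M)} {φ : Pr k M → Pr k N}

lemma finrank_Tg [Infinite k] (hX : IsSmoothSurface X) {v : Fin (M + 1) → k} (hv : v ∈ cone X) :
    finrank k (Tg (Van X) v) = 3 := by
  obtain ⟨h, hv⟩ := hv
  have h3 := hX.2.2 _ hv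
  rw [embTangent_eq] at h3
  obtain ⟨t, ht⟩ := (Projectivization.mk_eq_mk_iff' k _ _ (Projectivization.rep_nonzero _) h).1
    (Projectivization.mk_rep (Projectivization.mk k v h))
  have ht0 : t ≠ 0 := by
    rintro rfl
    rw [zero_smul] at ht
    exact Projectivization.rep_nonzero _ ht.symm
  have : Tg (Van X) (Projectivization.mk k v h).rep = Tg (Van X) v := by
    rw [← ht]; exact Tg_smul X v ht0
  rwa [this] at h3

namespace MapChart

variable (C : MapChart X φ) {F : Type} [Field F] [Algebra k F] {a : Fin (M + 1) → F}

lemma D_mem_Tg (ha : ∀ f ∈ Van X, aeval a f = 0) (i : Fin 3) :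
    (fun j => aeval a (C.D i (MvPolynomial.X j))) ∈ Tg (Van X) a := fun f hf => by
  rw [← dd_eq_derivation]; exact ha _ (C.pres i f hf)

lemma dmap_D (i : Fin 3) : dmap C.Φ a (fun j => aeval a (C.D i (MvPolynomial.X j))) =
    fun j => aeval a (C.D i (C.Φ j)) := by
  ext j; rw [dmap_apply, dd_eq_derivation]

lemma Sp_eq_span (ha : ∀ f ∈ Van X, aeval a f = 0) (hΔ : aeval a C.Δ ≠ 0) :
    Sp (Van X) C.Φ a = Submodule.span F (Set.range fun i j => aeval a (C.D i (C.Φ j))) := by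
  apply le_antisymm
  · rintro _ ⟨c, hc, rfl⟩
    obtain ⟨t, rfl⟩ := C.tan F a hΔ c hc
    simp only [map_sum, map_smul, dmap_D]
    exact Submodule.sum_mem _ fun i _ => Submodule.smul_mem _ _ (Submodule.subset_span ⟨i, rfl⟩)
  · rw [Submodule.span_le]
    rintro _ ⟨i, rfl⟩
    exact ⟨_, C.D_mem_Tg ha i, C.dmap_D i⟩

lemma finrank_Sp (ha : ∀ f ∈ Van X, aeval a f = 0) (hΔ : aeval a C.Δ ≠ 0) :
    finrank F (Sp (Van X) C.Φ a) = 3 := by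
  rw [C.Sp_eq_span ha hΔ, finrank_span_eq_card (C.li F a hΔ)]; simp

lemma dmap_injOn [CharZero k] (hΔ : aeval a C.Δ ≠ 0) {c : Fin (M + 1) → F} (hc : c ∈ Tg (Van X) a)
    (h0 : dmap C.Φ a c = 0) : c = 0 := by
  obtain ⟨t, rfl⟩ := C.tan F a hΔ c hc
  simp only [map_sum, map_smul, dmap_D] at h0
  have := Fintype.linearIndependent_iff.1 (C.li F a hΔ) t h0
  simp [this]

lemma deg_ne_zero (hΔ : aeval a C.Δ ≠ 0) : C.deg ≠ 0 := by
  intro h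
  have h0 : ∀ j, C.D 0 (C.Φ j) = 0 := by
    intro j
    have := C.hom j
    rw [h] at this
    rw [show C.Φ j = MvPolynomial.C (coeff 0 (C.Φ j)) from totalDegree_eq_zero_iff_eq_C.1
      (Nat.le_zero.1 this.totalDegree_le)]
    exact Derivation.map_algebraMap _ _
  apply (C.li F a hΔ).ne_zero 0
  ext j
  simp [h0]

lemma eval_mem_Sp [Infinite k] [CharZero k] (ha : ∀ f ∈ Van X, aeval a f = 0)
    (hΔ : aeval a C.Δ ≠ 0) : (fun j => aeval a (C.Φ j)) ∈ Sp (Van X) C.Φ a :=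
  self_mem_Sp ha (C.deg_ne_zero hΔ) C.hom

lemma not_ramifiedAt [Infinite k] {v : Fin (M + 1) → k} (hv : v ≠ 0)
    (hvX : Projectivization.mk k v hv ∈ X) (hΔ : eval v C.Δ ≠ 0) :
    ¬ RamifiedAt X φ (Projectivization.mk k v hv) := by
  intro hram
  have hvc : v ∈ cone X := ⟨hv, hvX⟩
  obtain ⟨t, ht⟩ := (Projectivization.mk_eq_mk_iff' k _ _ (Projectivization.rep_nonzero _) hv).1
    (Projectivization.mk_rep (Projectivization.mk k v hv))
  have ht0 : t ≠ 0 := by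
    rintro rfl
    rw [zero_smul] at ht
    exact Projectivization.rep_nonzero _ ht.symm
  have ht' : (Projectivization.mk k v hv).rep = fun j => t * v j := ht.symm
  have h2 := hram C.Φ ⟨⟨_, C.hom⟩, ?_, ?_⟩
  · have h3 : Submodule.map (jacobian C.Φ (Projectivization.mk k v hv).rep)
        (embTangent X (Projectivization.mk k v hv)) = Sp (Van X) C.Φ v := by
      rw [embTangent_eq, ht', Tg_smul X v ht0]
      have hjac : ∀ c, jacobian C.Φ (fun j => t * v j) c = t ^ (C.deg - 1) • dmap C.Φ v c := by
        intro c
        rw [jacobian_apply]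
        ext j
        simp only [dmap_apply, dd, Pi.smul_apply, smul_eq_mul, Finset.mul_sum]
        refine Finset.sum_congr rfl fun i _ => ?_
        rw [aeval_mul_of_isHomogeneous ((C.hom j).pderiv), mul_assoc]
      apply le_antisymm
      · rintro _ ⟨c, hc, rfl⟩
        rw [hjac]
        exact Submodule.smul_mem _ _ ⟨c, hc, rfl⟩
      · rintro _ ⟨c, hc, rfl⟩
        refine ⟨(t ^ (C.deg - 1))⁻¹ • c, Submodule.smul_mem _ _ hc, ?_⟩
        rw [map_smul, hjac, smul_smul, inv_mul_cancel₀ (pow_ne_zero _ ht0), one_smul]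
    rw [h3, C.finrank_Sp (fun f hf => hf v hvc) hΔ] at h2
    omega
  · rw [ht']
    intro h0
    apply C.ne k v hΔ
    ext j
    have := congrFun h0 j
    simp only [eval_mul_of_isHomogeneous (C.hom j)] at this
    exact (mul_eq_zero.1 this).resolve_left (pow_ne_zero _ ht0)
  · rintro q hq w hw rfl h
    exact C.rep w hw hq h

end MapChart

lemma exists_mapChart [Infinite k] (hX : IsSmoothSurface X) {p : Pr k M} (hp : p ∈ X)
    (hram : ¬ RamifiedAt X φ p) : ∃ C : MapChart X φ, eval p.rep C.Δ ≠ 0 := by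
  have hprime := Van_isPrime hX.1
  have hpc := rep_mem_cone hp
  simp only [RamifiedAt, not_forall, not_le] at hram
  obtain ⟨Φ, ⟨⟨d, hd⟩, hne, hrep⟩, hrk⟩ := hram
  have h3 := finrank_Tg hX hpc
  obtain ⟨D, Δ, hΔ, hD⟩ := exists_frame (Van X) p.rep h3
  have hDTg : ∀ v ∈ cone X, eval v Δ ≠ 0 →
      Tg (Van X) v = Submodule.span k (Set.range fun i j => aeval v (D i (MvPolynomial.X j))) := by
    intro v hv hΔv
    obtain ⟨h1, h2⟩ := hD k v hΔv
    apply Submodule.eq_of_le_of_finrank_le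
    · intro c hc
      obtain ⟨t, rfl⟩ := h2 c hc
      exact Submodule.sum_mem _ fun i _ => Submodule.smul_mem _ _ (Submodule.subset_span ⟨i, rfl⟩)
    · rw [finrank_span_eq_card h1, finrank_Tg hX hv]; simp
  have hli : LinearIndependent k (fun i j => aeval p.rep (D i (Φ j))) := by
    rw [linearIndependent_iff_card_le_finrank_span, Set.finrank]
    have h4 : Submodule.map (jacobian Φ p.rep) (embTangent X p) =
        Submodule.span k (Set.range fun i j => aeval p.rep (D i (Φ j))) := by
      rw [embTangent_eq, hDTg _ hpc hΔ, Submodule.map_span, ← Set.range_comp]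
      congr 2
      ext i j
      simp only [Function.comp_apply]
      rw [jacobian_apply, dmap_apply, dd_eq_derivation]
    rw [h4] at hrk
    rw [Fintype.card_fin]; exact hrk
  obtain ⟨μ, hμ, hμ2⟩ := exists_minor (fun i j => D i (Φ j)) p.rep hli
  obtain ⟨j0, hj0⟩ := Function.ne_iff.1 hne
  refine ⟨⟨D, Δ * (μ * Φ j0), Φ, d, hd, ?_, ?_, ?_, ?_, ?_⟩, ?_⟩
  · intro i f hf
    have : Δ * D i f ∈ Van X := by
      intro v hv
      by_cases hΔv : eval v Δ = 0
      · simp [hΔv]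
      · have : (fun j => aeval v (D i (MvPolynomial.X j))) ∈ Tg (Van X) v := by
          rw [hDTg v hv hΔv]
          exact Submodule.subset_span ⟨i, rfl⟩
        have := this f hf
        rw [← dd_eq_derivation] at this
        rw [map_mul]
        exact mul_eq_zero_of_right _ this
    exact (hprime.mem_or_mem this).resolve_left fun h => hΔ (h _ hpc)
  · intro F _ _ a ha
    rw [map_mul] at ha
    exact (hD F a (left_ne_zero_of_mul ha)).2
  · intro F _ _ a ha
    rw [map_mul, map_mul] at ha
    exact hμ2 F a (left_ne_zero_of_mul (right_ne_zero_of_mul ha))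
  · intro F _ _ a ha h
    rw [map_mul, map_mul] at ha
    exact right_ne_zero_of_mul (right_ne_zero_of_mul ha) (congrFun h j0)
  · intro v hv hvX h
    exact hrep _ hvX v hv rfl h
  · rw [map_mul, map_mul]
    exact mul_ne_zero hΔ (mul_ne_zero hμ hj0)

end Chart

section Generic

variable {k : Type} [Field k] {σ τ : Type}

lemma algHom_eval {T F : Type} [CommRing F] [Algebra k F] (ι : (T → k) →ₐ[k] F) (a : T → σ → k)
    (g : MvPolynomial σ k) :
    ι (fun t => eval (a t) g) = aeval (fun j => ι (fun t => a t j)) g := by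
  have : (ι.comp (Pi.algHom k (fun _ : T => k) fun t => (aeval (a t) : MvPolynomial σ k →ₐ[k] k))) =
      aeval (fun j => ι (fun t => a t j)) := by
    ext j
    simp only [AlgHom.comp_apply, aeval_X]
    congr 1
    ext t; simp
  exact DFunLike.congr_fun this g

/-- A field over which a dense family of closed points becomes a generic point. -/
lemma exists_generic {T : Type} (a : T → σ → k) (J : Ideal (MvPolynomial σ k)) [hJ : J.IsPrime]
    (h : ∀ g ∉ J, ∃ t, eval (a t) g ≠ 0) :
    ∃ (F : Type) (_ : Field F) (_ : Algebra k F) (ι : (T → k) →ₐ[k] F),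
      ∀ g ∉ J, aeval (fun j => ι (fun t => a t j)) g ≠ 0 := by
  let e : MvPolynomial σ k →ₐ[k] (T → k) :=
    Pi.algHom k (fun _ : T => k) fun t => (aeval (a t) : MvPolynomial σ k →ₐ[k] k)
  have he : ∀ g t, e g t = eval (a t) g := fun g t => rfl
  let S : Submonoid (T → k) := J.primeCompl.map e.toRingHom
  have hdisj : Disjoint ((⊥ : Ideal (T → k)) : Set (T → k)) (S : Set (T → k)) := by
    rw [Set.disjoint_left]
    rintro x hx ⟨g, hg, rfl⟩
    obtain ⟨t, ht⟩ := h g hg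
    exact ht (congrFun (hx : e g = 0) t)
  obtain ⟨P, hP, -, hPS⟩ := Ideal.exists_le_prime_disjoint _ S hdisj
  refine ⟨FractionRing ((T → k) ⧸ P), inferInstance, inferInstance,
    (Algebra.algHom k ((T → k) ⧸ P) _).comp (Ideal.Quotient.mkₐ k P), fun g hg => ?_⟩
  rw [← algHom_eval, AlgHom.comp_apply]
  intro h0
  have h1 : Ideal.Quotient.mkₐ k P (fun t => eval (a t) g) = 0 :=
    (IsFractionRing.injective ((T → k) ⧸ P) (FractionRing ((T → k) ⧸ P))) (by
      rw [map_zero]; exact h0)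
  exact Set.disjoint_left.1 hPS (Ideal.Quotient.eq_zero_iff_mem.1 h1) ⟨g, hg, rfl⟩

/-- The ideal of a set of points of affine space. -/
def AVan (V : Set (σ → k)) : Ideal (MvPolynomial σ k) where
  carrier := {f | ∀ v ∈ V, eval v f = 0}
  zero_mem' := fun v _ => by simp
  add_mem' := fun ha hb v hv => by simp [ha v hv, hb v hv]
  smul_mem' := fun c f hf v hv => by simp [hf v hv]

lemma mem_AVan {V : Set (σ → k)} {f : MvPolynomial σ k} : f ∈ AVan V ↔ ∀ v ∈ V, eval v f = 0 := Iff.rfl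

/-- The product of two sets of points. -/
def vprod (V : Set (σ → k)) (W : Set (τ → k)) : Set (σ ⊕ τ → k) :=
  {u | ∃ v ∈ V, ∃ w ∈ W, u = Sum.elim v w}

/-- Restriction of a polynomial to a fibre over the first factor. -/
noncomputable def fixL (v : σ → k) : MvPolynomial (σ ⊕ τ) k →ₐ[k] MvPolynomial τ k :=
  aeval (Sum.elim (fun j => C (v j)) X)

/-- Restriction of a polynomial to a fibre over the second factor. -/
noncomputable def fixR (w : τ → k) : MvPolynomial (σ ⊕ τ) k →ₐ[k] MvPolynomial σ k :=
  aeval (Sum.elim X (fun j => C (w j)))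

lemma aeval_fixR {F : Type} [CommRing F] [Algebra k F] (w : τ → k) (a : σ → F)
    (g : MvPolynomial (σ ⊕ τ) k) :
    aeval a (fixR w g) = aeval (Sum.elim a (fun j => algebraMap k F (w j))) g := by
  have : (aeval a).comp (fixR w) = aeval (R := k) (Sum.elim a (fun j => algebraMap k F (w j))) := by
    ext j; rcases j with j | j <;> simp [fixR]
  exact DFunLike.congr_fun this g

lemma eval_fixR (w : τ → k) (v : σ → k) (g : MvPolynomial (σ ⊕ τ) k) :
    eval v (fixR w g) = eval (Sum.elim v w) g := aeval_fixR (F := k) w v g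

lemma eval_fixL (w : τ → k) (v : σ → k) (g : MvPolynomial (σ ⊕ τ) k) :
    eval w (fixL v g) = eval (Sum.elim v w) g := by
  have : (aeval (R := k) w).comp (fixL v) = aeval (R := k) (Sum.elim v w) := by
    ext j; rcases j with j | j <;> simp [fixL]
  exact DFunLike.congr_fun this g

variable {V : Set (σ → k)} {W : Set (τ → k)}

/-- A family that is dense in the base and fibrewise dense is dense in the product. -/
lemma exists_eval_ne_zero (hV : (AVan V).IsPrime) (B : Set (σ → k))
    (hB : ∀ g ∉ AVan V, ∃ v ∈ B, eval v g ≠ 0) (C : (σ → k) → Set (τ → k))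
    (hC : ∀ v ∈ B, ∀ g ∉ AVan W, ∃ w ∈ C v, eval w g ≠ 0)
    {g : MvPolynomial (σ ⊕ τ) k} (hg : g ∉ AVan (vprod V W)) (hBV : B ⊆ V) :
    ∃ v ∈ B, ∃ w ∈ C v, eval (Sum.elim v w) g ≠ 0 := by
  simp only [mem_AVan, not_forall] at hg
  obtain ⟨_, ⟨v0, hv0, w0, hw0, rfl⟩, hne⟩ := hg
  obtain ⟨v, hv, hvne⟩ := hB (fixR w0 g) fun h => hne (by rw [← eval_fixR]; exact h v0 hv0)
  rw [eval_fixR, ← eval_fixL] at hvne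
  obtain ⟨w, hw, hwne⟩ := hC v hv (fixL v g) fun h => hvne (h w0 hw0)
  exact ⟨v, hv, w, hw, by rwa [eval_fixL] at hwne⟩

lemma AVan_vprod_isPrime (hV : (AVan V).IsPrime) (hW : (AVan W).IsPrime) :
    (AVan (vprod V W)).IsPrime := by
  have hne : ∀ {σ : Type} {V : Set (σ → k)}, (AVan V).IsPrime → V.Nonempty := by
    intro σ V h
    rw [nonempty_iff_ne_empty]
    rintro rfl
    exact h.ne_top ((Ideal.eq_top_iff_one _).2 (by simp [mem_AVan]))
  refine ⟨?_, fun {f g} hfg => ?_⟩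
  · obtain ⟨v, hv⟩ := hne hV
    obtain ⟨w, hw⟩ := hne hW
    intro h
    have h1 := (Ideal.eq_top_iff_one _).1 h (Sum.elim v w) ⟨v, hv, w, hw, rfl⟩
    simp at h1
  · by_contra! hcon
    obtain ⟨hf, hg⟩ := hcon
    simp only [mem_AVan, not_forall] at hf hg
    obtain ⟨_, ⟨v0, hv0, w0, hw0, rfl⟩, hf⟩ := hf
    obtain ⟨_, ⟨v1, hv1, w1, hw1, rfl⟩, hg⟩ := hg
    have h1 : fixR w0 f * fixR w1 g ∉ AVan V := fun h => (hV.mem_or_mem h).elim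
      (fun h => hf (by rw [← eval_fixR]; exact h v0 hv0))
      (fun h => hg (by rw [← eval_fixR]; exact h v1 hv1))
    simp only [mem_AVan, not_forall, map_mul] at h1
    obtain ⟨v, hv, hne⟩ := h1
    have h2 : fixL v f * fixL v g ∉ AVan W := fun h => (hW.mem_or_mem h).elim
      (fun h => left_ne_zero_of_mul hne (by rw [eval_fixR, ← eval_fixL]; exact h w0 hw0))
      (fun h => right_ne_zero_of_mul hne (by rw [eval_fixR, ← eval_fixL]; exact h w1 hw1))
    simp only [mem_AVan, not_forall, map_mul, eval_fixL] at h2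
    obtain ⟨w, hw, hne⟩ := h2
    apply hne
    rw [← map_mul]
    exact hfg _ ⟨v, hv, w, hw, rfl⟩

/-- A polynomial over an extension of `k` vanishing on the closed points of `W` vanishes at every
point satisfying the equations of `W`. -/
lemma eval_eq_zero_of_closed {F : Type} [Field F] [Algebra k F] (b : τ → F)
    (hb : ∀ f ∈ AVan W, aeval b f = 0) (h : MvPolynomial τ F)
    (hW : ∀ w ∈ W, eval (fun j => algebraMap k F (w j)) h = 0) : eval b h = 0 := by
  classical
  let B := Basis.ofVectorSpace k F
  let hl : Basis.ofVectorSpaceIndex k F → MvPolynomial τ k := fun i =>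
    h.support.sum fun m => monomial m (B.repr (coeff m h) i)
  have h1 : ∀ i, hl i ∈ AVan W := by
    intro i w hw
    have := hW w hw
    rw [eval_eq] at this
    have h2 := congrArg (fun x => B.repr x i) this
    simp only [map_sum, map_zero, Finsupp.coe_zero, Pi.zero_apply, Finsupp.coe_finset_sum,
      Finset.sum_apply] at h2
    simp only [hl, map_sum]
    rw [← h2]
    refine Finset.sum_congr rfl fun m _ => ?_
    have : coeff m h * ∏ i ∈ m.support, algebraMap k F (w i) ^ m i =
        (∏ i ∈ m.support, w i ^ m i) • coeff m h := by
      rw [Algebra.smul_def, map_prod, mul_comm]; simp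
    rw [this, map_smul, eval_monomial]
    simp [Finsupp.prod, mul_comm]
  let s : Finset (Basis.ofVectorSpaceIndex k F) := h.support.biUnion fun m => (B.repr (coeff m h)).support
  have h3 : ∀ m ∈ h.support, coeff m h = ∑ i ∈ s, algebraMap k F (B.repr (coeff m h) i) * B i := by
    intro m hm
    conv_lhs => rw [← B.linearCombination_repr (coeff m h), Finsupp.linearCombination_apply, Finsupp.sum]
    rw [Finset.sum_subset (Finset.subset_biUnion_of_mem (fun m => (B.repr (coeff m h)).support) hm)]
    · exact Finset.sum_congr rfl fun i _ => Algebra.smul_def _ _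
    · intro i _ hi
      rw [Finsupp.notMem_support_iff.1 hi, zero_smul]
  have h4 : eval b h = ∑ i ∈ s, B i * aeval b (hl i) := by
    rw [eval_eq]
    simp only [hl, map_sum, aeval_monomial, Finset.mul_sum]
    rw [Finset.sum_comm]
    refine Finset.sum_congr rfl fun m hm => ?_
    conv_lhs => rw [h3 m hm, Finset.sum_mul]
    refine Finset.sum_congr rfl fun i _ => ?_
    simp [Finsupp.prod]; ring
  rw [h4]
  exact Finset.sum_eq_zero fun i _ => by rw [hb _ (h1 i), mul_zero]

variable [Fintype σ] [Fintype τ] [CharZero k]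

/-- At a generic point of a product, derivations can be prescribed on one factor and be made to
vanish on the other. -/
lemma exists_derivation_left {F : Type} [Field F] [Algebra k F] (a : σ → F) (b : τ → F)
    (hb : ∀ f ∈ AVan W, aeval b f = 0)
    (hgen : ∀ g, aeval (Sum.elim a b) g = 0 → g ∈ AVan (vprod V W))
    (c : σ → F) (hc : c ∈ Tg (AVan V) a) :
    ∃ δ : Derivation k F F, (∀ j, δ (a j) = c j) ∧ ∀ j, δ (b j) = 0 := by
  obtain ⟨δ, hδ⟩ := exists_derivation (k := k) (Sum.elim a b) (Sum.elim c 0) (by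
    intro g hg
    have hg := hgen g hg
    have h1 : ∀ w ∈ W, fixR w g ∈ AVan V := fun w hw v hv => by
      rw [eval_fixR]; exact hg _ ⟨v, hv, w, hw, rfl⟩
    let q : MvPolynomial (σ ⊕ τ) k →ₐ[k] MvPolynomial τ F :=
      aeval (Sum.elim (fun j => C (a j)) X)
    have hq : ∀ (b : τ → F) f, eval b (q f) = aeval (Sum.elim a b) f := by
      intro b f
      have : ((aeval b : MvPolynomial τ F →ₐ[F] F).restrictScalars k).comp q = aeval (Sum.elim a b) := by
        ext j; rcases j with j | j <;> simp [q]
      exact DFunLike.congr_fun this f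
    have h2 := eval_eq_zero_of_closed b hb (∑ j, C (c j) * q (pderiv (Sum.inl j) g)) (by
      intro w hw
      have := hc _ (h1 w hw)
      have e1 := eq_dd_of_leibniz (k := k) (A := MvPolynomial (σ ⊕ τ) k)
        (aeval (Sum.elim a (fun j => algebraMap k F (w j))) : _ →ₐ[k] F).toRingHom
        { toFun := fun f => dd a c (fixR w f), map_zero' := by simp [dd], map_add' := by
            intro x y; rw [map_add, dd_add] } (by
          intro x y
          change dd a c (fixR w (x * y)) = aeval _ x * dd a c (fixR w y) + aeval _ y * dd a c (fixR w x)
          rw [map_mul, dd_mul, aeval_fixR, aeval_fixR]) (by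
          intro r
          change dd a c (fixR w (C r)) = 0
          rw [fixR, aeval_C]; exact dd_C _ _ _) (by simp) X g
      have e2 : dd a c (fixR w g) = dd (Sum.elim a fun j => algebraMap k F (w j))
          (fun j => dd a c (fixR w (X j))) g := by
        rw [aeval_X_left_apply] at e1
        refine e1.trans ?_
        congr 1
        ext j
        rcases j with j | j <;> simp
      rw [this] at e2
      simp only [map_sum, map_mul, eval_C, hq]
      rw [e2, dd, Fintype.sum_sum_type]
      classical
      have e3 : ∀ j, dd a c (fixR w (X (Sum.inl j))) = c j := by
        intro j; simp [fixR, dd_X]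
      have e4 : ∀ j, dd a c (fixR w (X (Sum.inr j) : MvPolynomial (σ ⊕ τ) k)) = 0 := by
        intro j; simp [fixR, dd_C]
      simp only [AddMonoidHom.coe_mk, ZeroHom.coe_mk, e3, e4, mul_zero, Finset.sum_const_zero, add_zero]
      refine Finset.sum_congr rfl fun j _ => ?_
      rw [mul_comm])
    rw [dd, Fintype.sum_sum_type]
    simp only [map_sum, map_mul, eval_C, hq] at h2
    simpa [mul_comm] using h2)
  exact ⟨δ, fun j => hδ (Sum.inl j), fun j => hδ (Sum.inr j)⟩

lemma exists_derivation_right {F : Type} [Field F] [Algebra k F] (a : σ → F) (b : τ → F)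
    (ha : ∀ f ∈ AVan V, aeval a f = 0)
    (hgen : ∀ g, aeval (Sum.elim a b) g = 0 → g ∈ AVan (vprod V W))
    (c : τ → F) (hc : c ∈ Tg (AVan W) b) :
    ∃ δ : Derivation k F F, (∀ j, δ (a j) = 0) ∧ ∀ j, δ (b j) = c j := by
  obtain ⟨δ, h1, h2⟩ := exists_derivation_left b a ha (W := V) (V := W) (fun g hg => by
    have h1 := hgen (rename Sum.swap g) (by
      rw [aeval_rename, ← hg]
      congr 2
      funext j; rcases j with j | j <;> rfl)
    rintro _ ⟨w, hw, v, hv, rfl⟩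
    have h2 := h1 _ ⟨v, hv, w, hw, rfl⟩
    rw [eval_rename] at h2
    rw [← h2]
    congr 2
    funext j; rcases j with j | j <;> rfl) c hc
  exact ⟨δ, h2, h1⟩

end Generic

section Specialize

variable {k : Type} [Field k] [IsAlgClosed k] {σ : Type} [Finite σ]

/-- A point over an extension field specializes to a closed point off a given hypersurface. -/
lemma exists_specialization {F : Type} [Field F] [Algebra k F] (a : σ → F) (g : MvPolynomial σ k)
    (hg : aeval a g ≠ 0) :
    ∃ v : σ → k, eval v g ≠ 0 ∧ ∀ f : MvPolynomial σ k, aeval a f = 0 → eval v f = 0 := by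
  by_contra! hcon
  let J : Ideal (MvPolynomial σ k) := RingHom.ker (aeval a : _ →ₐ[k] F)
  have hJ : J.IsPrime := RingHom.ker_isPrime _
  have h1 := MvPolynomial.IsPrime.vanishingIdeal_zeroLocus (K := k) J
  have : g ∈ J := by
    rw [← h1, mem_vanishingIdeal_iff]
    intro v hv
    by_contra hne
    obtain ⟨f, hf, hf2⟩ := hcon v hne
    exact hf2 (hv f hf)
  exact hg this

end Specialize

section SecondOrder

variable {k : Type} [Field k] {M N : ℕ}

lemma Sp_smul [Infinite k] {F : Type} [Field F] [Algebra k F] {m : Type} (X : Set (Pr k M))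
    {Φ : m → MvPolynomial (Fin (M + 1)) k} {d : ℕ} (hΦ : ∀ j, (Φ j).IsHomogeneous d)
    (a : Fin (M + 1) → F) {t : F} (ht : t ≠ 0) :
    Sp (Van X) Φ (fun j => t * a j) = Sp (Van X) Φ a := by
  have hd : ∀ c, dmap Φ (fun j => t * a j) c = t ^ (d - 1) • dmap Φ a c := by
    intro c
    ext j
    simp only [dmap_apply, dd, Pi.smul_apply, smul_eq_mul, Finset.mul_sum]
    refine Finset.sum_congr rfl fun i _ => ?_
    rw [aeval_mul_of_isHomogeneous ((hΦ j).pderiv), mul_assoc]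
  rw [Sp, Sp, Tg_smul X a ht]
  apply le_antisymm
  · rintro _ ⟨c, hc, rfl⟩
    rw [hd]
    exact Submodule.smul_mem _ _ ⟨c, hc, rfl⟩
  · rintro _ ⟨c, hc, rfl⟩
    refine ⟨(t ^ (d - 1))⁻¹ • c, Submodule.smul_mem _ _ hc, ?_⟩
    rw [map_smul, hd, smul_smul, inv_mul_cancel₀ (pow_ne_zero _ ht), one_smul]

variable {X : Set (Pr k M)} {φ : Pr k M → Pr k N}

/-- Two vectors representing the same point are parallel. -/
lemma mul_eq_mul_of_mk_eq {n : Type} {u w : n → k} {hu : u ≠ 0} {hw : w ≠ 0}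
    (h : Projectivization.mk k u hu = Projectivization.mk k w hw) (i j : n) : u i * w j = u j * w i := by
  obtain ⟨t, rfl⟩ := (Projectivization.mk_eq_mk_iff' k _ _ hu hw).1 h
  simp; ring

namespace MapChart

variable (C : MapChart X φ)

/-- Any local representation of `φ` is proportional to the one of a chart. -/
lemma mul_sub_mul_mem_Van (hp : (Van X).IsPrime) (hΔ : C.Δ ∉ Van X)
    {Ψ : Fin (N + 1) → MvPolynomial (Fin (M + 1)) k} {p : Pr k M} (hΨ : LocalRep X φ p Ψ)
    (i j : Fin (N + 1)) : Ψ i * C.Φ j - Ψ j * C.Φ i ∈ Van X := by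
  refine (hp.mem_or_mem (x := C.Δ) fun v hv => ?_).resolve_left hΔ
  by_cases h1 : eval v C.Δ = 0
  · simp [h1]
  by_cases h2 : (fun j => eval v (Ψ j)) = 0
  · have h3 : ∀ j, eval v (Ψ j) = 0 := fun j => congrFun h2 j
    simp [h3]
  · obtain ⟨hv0, hvX⟩ := hv
    have := mul_eq_mul_of_mk_eq ((hΨ.2.2 _ hvX v hv0 rfl h2).symm.trans
      (C.rep v hv0 hvX (C.ne k v h1))) i j
    simp [this]

lemma eq_zero_of_sum_mem [Infinite k] (hp : (Van X).IsPrime) (hΔ : C.Δ ∉ Van X)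
    (hφ : IsMorphismOn X φ) (hnd : Nondegenerate (φ '' X)) (l : Fin (N + 1) → k)
    (h : ∑ j, MvPolynomial.C (l j) * C.Φ j ∈ Van X) : l = 0 := by
  have h1 := hnd (∑ j, MvPolynomial.C (l j) * MvPolynomial.X j)
    (IsHomogeneous.sum _ _ _ fun j _ => by
      simpa using (isHomogeneous_C _ (l j)).mul (isHomogeneous_X k j)) (by
    rintro _ ⟨q, hq, rfl⟩
    obtain ⟨Ψ, hΨ⟩ := hφ q hq
    rw [hΨ.2.2 q hq q.rep q.rep_nonzero q.mk_rep hΨ.2.1, vanishes_iff (d := 1)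
      (IsHomogeneous.sum _ _ _ fun j _ => by
        simpa using (isHomogeneous_C _ (l j)).mul (isHomogeneous_X k j))]
    have h2 : ∑ j, MvPolynomial.C (l j) * Ψ j ∈ Van X := by
      have hne : ∃ i, C.Φ i ∉ Van X := by
        by_contra! hcon
        simp only [mem_Van, not_forall] at hΔ
        obtain ⟨v, hv, hne⟩ := hΔ
        exact C.ne k v hne (by ext j; exact hcon j v hv)
      obtain ⟨i, hi⟩ := hne
      refine (hp.mem_or_mem (x := C.Φ i) ?_).resolve_left hi
      have : C.Φ i * ∑ j, MvPolynomial.C (l j) * Ψ j = Ψ i * (∑ j, MvPolynomial.C (l j) * C.Φ j) -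
          ∑ j, MvPolynomial.C (l j) * (Ψ i * C.Φ j - Ψ j * C.Φ i) := by
        rw [Finset.mul_sum, Finset.mul_sum, ← Finset.sum_sub_distrib]
        exact Finset.sum_congr rfl fun j _ => by ring
      rw [this]
      exact Ideal.sub_mem _ (Ideal.mul_mem_left _ _ h) (Ideal.sum_mem _ fun j _ =>
        Ideal.mul_mem_left _ _ (C.mul_sub_mul_mem_Van hp hΔ hΨ i j))
    simpa using h2 _ (rep_mem_cone hq))
  classical
  ext j
  have := congrArg (fun f => eval (Pi.single j 1) f) h1
  simpa [Pi.single_apply] using this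

/-- A subspace which contains the image of a generic point and is stable under all derivations is
everything. -/
lemma eq_top_of_stable [IsAlgClosed k] [CharZero k] (hp : (Van X).IsPrime) (hΔ : C.Δ ∉ Van X)
    (hφ : IsMorphismOn X φ) (hnd : Nondegenerate (φ '' X)) {F : Type} [Field F] [Algebra k F]
    {a : Fin (M + 1) → F} (ha : ∀ f, aeval a f = 0 → f ∈ Van X) (U : Submodule F (Fin (N + 1) → F))
    (hU : ∀ (δ : Derivation k F F), ∀ u ∈ U, (fun j => δ (u j)) ∈ U)
    (hg : (fun j => aeval a (C.Φ j)) ∈ U) : U = ⊤ :=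
  PinchPaper.eq_top_of_stable U (fun δ _ => hU δ) _ hg fun l hl =>
    C.eq_zero_of_sum_mem hp hΔ hφ hnd l (ha _ (by simpa using hl))

/-- The frame field with constant coefficients `t`. -/
noncomputable def Dc (t : Fin 3 → k) :
    Derivation k (MvPolynomial (Fin (M + 1)) k) (MvPolynomial (Fin (M + 1)) k) := ∑ i, t i • C.D i

lemma Dc_apply (t : Fin 3 → k) (f : MvPolynomial (Fin (M + 1)) k) :
    C.Dc t f = ∑ i, t i • C.D i f := by
  simp only [Dc, Fin.sum_univ_three, Derivation.add_apply, Derivation.smul_apply]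

/-- The second fundamental form is generically nonzero. -/
lemma exists_second_order [IsAlgClosed k] [CharZero k] (hN : 4 ≤ N) (hp : (Van X).IsPrime)
    (hΔ : C.Δ ∉ Van X) (hφ : IsMorphismOn X φ) (hnd : Nondegenerate (φ '' X)) :
    ∃ (t : Fin 3 → k) (μ : MvPolynomial (Fin (M + 1)) k), μ ∉ Van X ∧ ∀ v : Fin (M + 1) → k,
      eval v μ ≠ 0 → (fun j => eval v (C.Dc t (C.Dc t (C.Φ j)))) ∉
        Submodule.span k (Set.range fun i j => eval v (C.D i (C.Φ j))) := by
  by_contra! hcon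
  let A := MvPolynomial (Fin (M + 1)) k ⧸ Van X
  let F := FractionRing A
  let e : MvPolynomial (Fin (M + 1)) k →ₐ[k] F :=
    (Algebra.algHom k A F).comp (Ideal.Quotient.mkₐ k (Van X))
  let a : Fin (M + 1) → F := fun j => e (MvPolynomial.X j)
  have hea : ∀ f, aeval a f = e f := fun f => by
    have : aeval a = e := by ext j; simp [a]
    rw [this]
  have ha : ∀ f, aeval a f = 0 ↔ f ∈ Van X := by
    intro f
    rw [hea, ← Ideal.Quotient.eq_zero_iff_mem]
    exact (IsFractionRing.injective A F).eq_iff' (map_zero _)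
  have haΔ : aeval a C.Δ ≠ 0 := fun h => hΔ ((ha _).1 h)
  have hS := C.Sp_eq_span (fun f hf => (ha f).2 hf) haΔ
  set S := Sp (Van X) C.Φ a with hSdef
  have hsq : ∀ t : Fin 3 → k, (fun j => aeval a (C.Dc t (C.Dc t (C.Φ j)))) ∈ S := by
    intro t
    by_contra hmem
    rw [hS] at hmem
    let w : Fin 4 → Fin (N + 1) → MvPolynomial (Fin (M + 1)) k :=
      Fin.cons (fun j => C.Dc t (C.Dc t (C.Φ j))) (fun i j => C.D i (C.Φ j))
    have hw : ∀ (F : Type) [Field F] [Algebra k F] (a : Fin (M + 1) → F), (fun i j => aeval a (w i j)) =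
        (Fin.cons (fun j => aeval a (C.Dc t (C.Dc t (C.Φ j)))) (fun i j => aeval a (C.D i (C.Φ j))) :
          Fin 4 → Fin (N + 1) → F) := by
      intro F _ _ a
      funext i
      refine Fin.cases ?_ (fun i => ?_) i <;> rfl
    obtain ⟨μ, hμ, hμ2⟩ := exists_minor w a (by
      rw [hw, linearIndependent_finCons]; exact ⟨C.li F a haΔ, hmem⟩)
    obtain ⟨v, hv, hv2⟩ := hcon t μ fun h => hμ ((ha _).2 h)
    have h3 := hμ2 k v hv
    rw [hw, linearIndependent_finCons] at h3
    exact h3.2 hv2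
  have hsym : ∀ i j, (fun l => aeval a (C.D i (C.D j (C.Φ l)))) +
      (fun l => aeval a (C.D j (C.D i (C.Φ l)))) ∈ S := by
    intro i j
    have h1 := hsq (Pi.single i 1 + Pi.single j 1)
    have h2 := hsq (Pi.single i 1)
    have h3 := hsq (Pi.single j 1)
    have e1 : ∀ i, C.Dc (Pi.single i 1) = C.D i := by
      intro i; ext1 f
      simp [Dc, Pi.single_apply, Fin.sum_univ_three]
    have e2 : C.Dc (Pi.single i 1 + Pi.single j 1) = C.D i + C.D j := by
      rw [← e1, ← e1]; simp [Dc, add_smul, Finset.sum_add_distrib]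
    rw [e1] at h2 h3
    rw [e2] at h1
    have h4 := S.sub_mem (S.sub_mem h1 h2) h3
    convert h4 using 1
    ext l
    simp
    ring
  have hasym : ∀ i j, (fun l => aeval a (C.D i (C.D j (C.Φ l)))) -
      (fun l => aeval a (C.D j (C.D i (C.Φ l)))) ∈ S := by
    intro i j
    let E := ⁅C.D i, C.D j⁆
    refine ⟨fun l => aeval a (E (MvPolynomial.X l)), fun f hf => ?_, ?_⟩
    · rw [← dd_eq_derivation, ha, Derivation.commutator_apply]
      exact Ideal.sub_mem _ (C.pres i _ (C.pres j _ hf)) (C.pres j _ (C.pres i _ hf))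
    · ext l
      rw [dmap_apply, ← dd_eq_derivation, Derivation.commutator_apply]
      simp
  have : CharZero F := charZero_of_injective_algebraMap (algebraMap k F).injective
  have hall : ∀ i j, (fun l => aeval a (C.D i (C.D j (C.Φ l)))) ∈ S := by
    intro i j
    have h1 := S.smul_mem (2⁻¹ : F) (S.add_mem (hsym i j) (hasym i j))
    convert h1 using 1
    ext l
    simp
    ring
  have htop := C.eq_top_of_stable hp hΔ hφ hnd (fun f hf => (ha f).1 hf) S (by
    intro δ u hu
    rw [hS] at hu
    refine derivation_span_mem δ _ S (fun i => ?_) (fun j => ?_) hu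
    · rw [hS]; exact Submodule.subset_span ⟨i, rfl⟩
    · obtain ⟨t, ht⟩ := C.tan F a haΔ _ (derivation_mem_Tg (fun f hf => (ha f).2 hf) δ)
      have : (fun l => δ (aeval a (C.D j (C.Φ l)))) =
          ∑ i, t i • fun l => aeval a (C.D i (C.D j (C.Φ l))) := by
        ext l
        rw [derivation_aeval, ht, dd_sum_vec]
        simp [dd_smul_vec, ← dd_eq_derivation]
      rw [this]
      exact S.sum_mem fun i _ => S.smul_mem _ (hall i j))
    (C.eval_mem_Sp (fun f hf => (ha f).2 hf) haΔ)
  have h3 := C.finrank_Sp (fun f hf => (ha f).2 hf) haΔ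
  rw [← hSdef, htop, finrank_top] at h3
  simp at h3
  omega

end MapChart

end SecondOrder

section TwoPoints

variable {k : Type} [Field k] {F : Type} [Field F] [Algebra k F] {m : Type}

lemma derivation_sup_span_mem (δ : Derivation k F F) (S U : Submodule F (m → F)) (g : m → F)
    (hS : ∀ u ∈ S, (fun j => δ (u j)) ∈ U) (hgU : g ∈ U) (hδg : (fun j => δ (g j)) ∈ U) :
    ∀ u ∈ S ⊔ Submodule.span F {g}, (fun j => δ (u j)) ∈ U := by
  intro u hu
  obtain ⟨s, hs, y, hy, rfl⟩ := Submodule.mem_sup.1 hu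
  obtain ⟨c, rfl⟩ := Submodule.mem_span_singleton.1 hy
  have : (fun j => δ ((s + c • g) j)) = (fun j => δ (s j)) + (c • (fun j => δ (g j)) + δ c • g) := by
    ext j; simp; ring
  rw [this]
  exact U.add_mem (hS s hs) (U.add_mem (U.smul_mem _ hδg) (U.smul_mem _ hgU))

lemma finrank_sup_span_le [Finite m] (S : Submodule F (m → F)) (g : m → F) :
    finrank F ↥(S ⊔ Submodule.span F {g}) ≤ finrank F S + 1 :=
  (Submodule.finrank_add_le_finrank_add_finrank _ _).trans
    (Nat.add_le_add_left (by simpa using finrank_span_le_card (R := F) ({g} : Set (m → F))) _)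

lemma finrank_sup_span [Finite m] (S : Submodule F (m → F)) {g : m → F} (hg : g ∉ S) :
    finrank F ↥(S ⊔ Submodule.span F {g}) = finrank F S + 1 := by
  apply le_antisymm (finrank_sup_span_le S g)
  apply Submodule.finrank_lt_finrank_of_lt
  refine lt_of_le_of_ne le_sup_left fun h => hg ?_
  rw [h]
  exact Submodule.mem_sup_right (Submodule.mem_span_singleton_self g)

variable [Fintype m]

/-- For two independent generic points, the image of no third point lies on the secant line. -/
lemma no_trisecant (Dx Dy : Set (Derivation k F F)) (Sx Sy Sz : Submodule F (m → F))
    (gx gy : m → F) (α β : F) (hα : α ≠ 0) (hβ : β ≠ 0) (hm : 5 ≤ Fintype.card m)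
    (hx3 : finrank F Sx = 3) (hy3 : finrank F Sy = 3) (hz3 : finrank F Sz = 3)
    (hgx : gx ∈ Sx) (hgy : gy ∈ Sy) (hgz : α • gx + β • gy ∈ Sz)
    (hdx : ∀ δ : Derivation k F F, (fun j => δ (gx j)) ∈ Sx)
    (hdy : ∀ δ : Derivation k F F, (fun j => δ (gy j)) ∈ Sy)
    (hdz : ∀ δ : Derivation k F F, (fun j => δ ((α • gx + β • gy) j)) ∈ Sz)
    (hsx : ∀ s ∈ Sx, ∃ δ ∈ Dy, (∀ j, δ (gx j) = s j) ∧ ∀ j, δ (gy j) = 0)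
    (hsy : ∀ s ∈ Sy, ∃ δ ∈ Dx, (∀ j, δ (gy j) = s j) ∧ ∀ j, δ (gx j) = 0)
    (hstx : ∀ δ ∈ Dx, ∀ u ∈ Sx, (fun j => δ (u j)) ∈ Sx)
    (hsty : ∀ δ ∈ Dy, ∀ u ∈ Sy, (fun j => δ (u j)) ∈ Sy)
    (hdec : ∀ δ : Derivation k F F, ∃ δ' ∈ Dy, ∃ δ'' ∈ Dx, δ = δ' + δ'')
    (htop : ∀ U : Submodule F (m → F), gx ∈ U →
      (∀ δ : Derivation k F F, ∀ u ∈ U, (fun j => δ (u j)) ∈ U) → U = ⊤) : False := by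
  have hglue : ∀ U : Submodule F (m → F), gx ∈ U → finrank F U ≤ 4 →
      (∀ δ ∈ Dx, ∀ u ∈ U, (fun j => δ (u j)) ∈ U) → (∀ δ ∈ Dy, ∀ u ∈ U, (fun j => δ (u j)) ∈ U) →
      False := by
    intro U hgU hU4 h1 h2
    have := htop U hgU (by
      intro δ u hu
      obtain ⟨δ', h', δ'', h'', rfl⟩ := hdec δ
      exact U.add_mem (h2 _ h' u hu) (h1 _ h'' u hu))
    rw [this, finrank_top, finrank_fintype_fun_eq_card] at hU4
    omega
  have hyx : gy ∉ Sx := by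
    intro hmem
    have hle : Sy ≤ Sx := by
      intro s hs
      obtain ⟨δ, hδ, h1, h2⟩ := hsy s hs
      have := hstx δ hδ _ hmem
      simp only [h1] at this
      exact this
    have heq := Submodule.eq_of_le_of_finrank_eq hle (by rw [hx3, hy3])
    exact hglue Sx hgx (by omega) hstx (heq ▸ hsty)
  have hxy : gx ∉ Sy := by
    intro hmem
    have hle : Sx ≤ Sy := by
      intro s hs
      obtain ⟨δ, hδ, h1, h2⟩ := hsx s hs
      have := hsty δ hδ _ hmem
      simp only [h1] at this
      exact this
    have heq := Submodule.eq_of_le_of_finrank_eq hle (by rw [hx3, hy3])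
    exact hglue Sx hgx (by omega) hstx (heq ▸ hsty)
  set U := Sz ⊔ Submodule.span F {gx} with hU
  have hU4 : finrank F U ≤ 4 := by
    have h1 := finrank_sup_span_le Sz gx
    rw [hz3, ← hU] at h1
    exact h1
  have hgxU : gx ∈ U := Submodule.mem_sup_right (Submodule.mem_span_singleton_self gx)
  have hgyU : gy ∈ U := by
    have h1 : β • gy ∈ U := by
      have := U.sub_mem (Submodule.mem_sup_left hgz) (U.smul_mem α hgxU)
      simpa using this
    exact (Submodule.smul_mem_iff _ hβ).1 h1
  have hSxU : Sx ≤ U := by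
    intro s hs
    obtain ⟨δ, -, h1, h2⟩ := hsx s hs
    have h3 : (fun j => δ ((α • gx + β • gy) j)) = α • s + δ α • gx + δ β • gy := by
      ext j; simp [h1, h2]; ring
    have h4 : α • s + δ α • gx + δ β • gy ∈ U := h3 ▸ Submodule.mem_sup_left (hdz δ)
    have h5 : α • s ∈ U := by
      have := U.sub_mem h4 (U.add_mem (U.smul_mem (δ α) hgxU) (U.smul_mem (δ β) hgyU))
      convert this using 1
      abel
    exact (Submodule.smul_mem_iff _ hα).1 h5
  have hSyU : Sy ≤ U := by
    intro s hs
    obtain ⟨δ, -, h1, h2⟩ := hsy s hs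
    have h3 : (fun j => δ ((α • gx + β • gy) j)) = β • s + δ α • gx + δ β • gy := by
      ext j; simp [h1, h2]; ring
    have h4 : β • s + δ α • gx + δ β • gy ∈ U := h3 ▸ Submodule.mem_sup_left (hdz δ)
    have h5 : β • s ∈ U := by
      have := U.sub_mem h4 (U.add_mem (U.smul_mem (δ α) hgxU) (U.smul_mem (δ β) hgyU))
      convert this using 1
      abel
    exact (Submodule.smul_mem_iff _ hβ).1 h5
  have e1 : Sx ⊔ Submodule.span F {gy} = U :=
    Submodule.eq_of_le_of_finrank_le (sup_le hSxU ((Submodule.span_singleton_le_iff_mem _ _).2 hgyU))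
      (by rw [finrank_sup_span Sx hyx]; omega)
  have e2 : Sy ⊔ Submodule.span F {gx} = U :=
    Submodule.eq_of_le_of_finrank_le (sup_le hSyU ((Submodule.span_singleton_le_iff_mem _ _).2 hgxU))
      (by rw [finrank_sup_span Sy hxy]; omega)
  refine hglue U hgxU hU4 (fun δ hδ u hu => ?_) (fun δ hδ u hu => ?_)
  · exact derivation_sup_span_mem δ Sx U gy (fun u hu => hSxU (hstx δ hδ u hu)) hgyU
      (hSyU (hdy δ)) u (e1 ▸ hu)
  · exact derivation_sup_span_mem δ Sy U gx (fun u hu => hSyU (hsty δ hδ u hu)) hgxU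
      (hSxU (hdx δ)) u (e2 ▸ hu)

end TwoPoints

section Trisecant

variable {k : Type} [Field k] [IsAlgClosed k] [CharZero k] {M N : ℕ}
  {X : Set (Pr k M)} {φ : Pr k M → Pr k N}

lemma not_gen_iff {P : (Fin (M + 1) → k) → Prop} :
    ¬ Gen X P ↔ ∀ g ∉ Van X, ∃ v ∈ {v | v ∈ cone X ∧ ¬ P v}, eval v g ≠ 0 := by
  simp only [Gen, not_exists, not_and, mem_setOf_eq]
  refine forall₂_congr fun g _ => ?_
  push Not
  exact ⟨fun ⟨v, h1, h2, h3⟩ => ⟨v, ⟨h1, h3⟩, h2⟩, fun ⟨v, ⟨h1, h3⟩, h2⟩ => ⟨v, h1, h2, h3⟩⟩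

/-- Through a general point of the image there pass only few trisecant lines. -/
lemma MapChart.gen_no_trisecant (C : MapChart X φ) (hN : 4 ≤ N) (hX : IsVariety X) (hΔ : C.Δ ∉ Van X)
    (hφ : IsMorphismOn X φ) (hnd : Nondegenerate (φ '' X)) :
    Gen X fun x => Gen X fun y => ∀ z ∈ cone X, eval z C.Δ ≠ 0 → ∀ α β : k, α ≠ 0 → β ≠ 0 →
      ¬ ∀ j, eval z (C.Φ j) = α * eval x (C.Φ j) + β * eval y (C.Φ j) := by
  by_contra hcon
  rw [not_gen_iff] at hcon
  have hp := Van_isPrime hX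
  have hpA : (AVan (cone X)).IsPrime := hp
  have hpp := AVan_vprod_isPrime hpA hpA
  let V := Fin (M + 1) → k
  let T := {t : (V × V × V) × k × k // t.1.1 ∈ cone X ∧ t.1.2.1 ∈ cone X ∧ t.1.2.2 ∈ cone X ∧
    eval t.1.2.2 C.Δ ≠ 0 ∧ t.2.1 ≠ 0 ∧ t.2.2 ≠ 0 ∧
    ∀ j, eval t.1.2.2 (C.Φ j) = t.2.1 * eval t.1.1 (C.Φ j) + t.2.2 * eval t.1.2.1 (C.Φ j)}
  obtain ⟨F, _, _, ι, hι⟩ := exists_generic (T := T) (fun t => Sum.elim t.1.1.1 t.1.1.2.1)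
    (AVan (vprod (cone X) (cone X))) (by
      intro g hg
      obtain ⟨x, hx, y, ⟨hy, hy2⟩, hne⟩ := exists_eval_ne_zero hpA _ hcon _ (by
        intro x hx g hg
        have := hx.2
        rw [not_gen_iff] at this
        exact this g hg) hg (fun v hv => hv.1)
      push Not at hy2
      obtain ⟨z, hz, hzΔ, α, β, hα, hβ, h⟩ := hy2
      exact ⟨⟨((x, y, z), α, β), hx.1, hy, hz, hzΔ, hα, hβ, h⟩, hne⟩)
  set x : Fin (M + 1) → F := fun j => ι fun t => t.1.1.1 j with hx
  set y : Fin (M + 1) → F := fun j => ι fun t => t.1.1.2.1 j with hy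
  let z : Fin (M + 1) → F := fun j => ι fun t => t.1.1.2.2 j
  have hι' : ∀ g, aeval (Sum.elim x y) g = 0 → g ∈ AVan (vprod (cone X) (cone X)) := by
    intro g hg
    by_contra hne
    apply hι g hne
    rw [← hg]
    congr 2
    funext j; rcases j with j | j <;> rfl
  have hunit : ∀ f : T → k, (∀ t, f t ≠ 0) → ι f ≠ 0 := by
    intro f hf h0
    have : ι f * ι (fun t => (f t)⁻¹) = 1 := by
      rw [← map_mul, ← map_one ι]
      congr 1; ext t; exact mul_inv_cancel₀ (hf t)
    rw [h0, zero_mul] at this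
    exact zero_ne_one this
  have hVx : ∀ f ∈ Van X, aeval x f = 0 := fun f hf => by
    rw [hx, ← algHom_eval ι (fun t : T => t.1.1.1), ← map_zero ι]
    congr 1; ext t; exact hf _ t.2.1
  have hVy : ∀ f ∈ Van X, aeval y f = 0 := fun f hf => by
    rw [hy, ← algHom_eval ι (fun t : T => t.1.1.2.1), ← map_zero ι]
    congr 1; ext t; exact hf _ t.2.2.1
  have hVz : ∀ f ∈ Van X, aeval z f = 0 := fun f hf => by
    rw [← algHom_eval ι (fun t : T => t.1.1.2.2), ← map_zero ι]
    congr 1; ext t; exact hf _ t.2.2.2.1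
  have hzΔ : aeval z C.Δ ≠ 0 := by
    rw [← algHom_eval ι (fun t : T => t.1.1.2.2)]
    exact hunit _ fun t => t.2.2.2.2.1
  obtain ⟨v0, hv0⟩ : (cone X).Nonempty := by
    obtain ⟨p, hp⟩ := hX.2.1
    exact ⟨_, rep_mem_cone hp⟩
  have hgx : ∀ f, aeval x f = 0 → f ∈ Van X := by
    intro f hf v hv
    have := hι' (rename Sum.inl f) (by rw [aeval_rename]; exact hf) _ ⟨v, hv, v0, hv0, rfl⟩
    rw [eval_rename] at this; exact this
  have hgy : ∀ f, aeval y f = 0 → f ∈ Van X := by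
    intro f hf v hv
    have := hι' (rename Sum.inr f) (by rw [aeval_rename]; exact hf) _ ⟨v0, hv0, v, hv, rfl⟩
    rw [eval_rename] at this; exact this
  have hxΔ : aeval x C.Δ ≠ 0 := fun h => hΔ (hgx _ h)
  have hyΔ : aeval y C.Δ ≠ 0 := fun h => hΔ (hgy _ h)
  have hrel : (fun j => aeval z (C.Φ j)) =
      ι (fun t : T => t.1.2.1) • (fun j => aeval x (C.Φ j)) +
      ι (fun t : T => t.1.2.2) • (fun j => aeval y (C.Φ j)) := by
    ext j
    simp only [Pi.add_apply, Pi.smul_apply, smul_eq_mul]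
    rw [hx, hy, ← algHom_eval ι (fun t : T => t.1.1.2.2), ← algHom_eval ι (fun t : T => t.1.1.2.1),
      ← algHom_eval ι (fun t : T => t.1.1.1), ← map_mul, ← map_mul, ← map_add]
    congr 1; ext t; exact t.2.2.2.2.2.2.2 j
  refine no_trisecant {δ | ∀ j, δ (x j) = 0} {δ | ∀ j, δ (y j) = 0}
    (Sp (Van X) C.Φ x) (Sp (Van X) C.Φ y) (Sp (Van X) C.Φ z) (fun j => aeval x (C.Φ j))
    (fun j => aeval y (C.Φ j)) (ι fun t : T => t.1.2.1) (ι fun t : T => t.1.2.2)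
    (hunit _ fun t => t.2.2.2.2.2.1) (hunit _ fun t => t.2.2.2.2.2.2.1) (by simp; omega)
    (C.finrank_Sp hVx hxΔ) (C.finrank_Sp hVy hyΔ) (C.finrank_Sp hVz hzΔ)
    (C.eval_mem_Sp hVx hxΔ) (C.eval_mem_Sp hVy hyΔ) (hrel ▸ C.eval_mem_Sp hVz hzΔ)
    (derivation_mem_Sp hVx) (derivation_mem_Sp hVy) (hrel ▸ derivation_mem_Sp hVz)
    ?_ ?_ (fun δ hδ u hu => Sp_stable δ hδ hu) (fun δ hδ u hu => Sp_stable δ hδ hu) ?_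
    (fun U hgU hU => C.eq_top_of_stable hp hΔ hφ hnd hgx U hU hgU)
  · rintro _ ⟨c, hc, rfl⟩
    obtain ⟨δ, h1, h2⟩ := exists_derivation_left x y hVy hι' c hc
    refine ⟨δ, h2, fun j => ?_, fun j => ?_⟩
    · rw [derivation_aeval, dmap_apply]; simp only [h1]
    · rw [derivation_aeval]; simp [h2, dd]
  · rintro _ ⟨c, hc, rfl⟩
    obtain ⟨δ, h1, h2⟩ := exists_derivation_right x y hVx hι' c hc
    refine ⟨δ, h1, fun j => ?_, fun j => ?_⟩
    · rw [derivation_aeval, dmap_apply]; simp only [h2]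
    · rw [derivation_aeval]; simp [h1, dd]
  · intro δ
    obtain ⟨δ'', h1, h2⟩ := exists_derivation_right x y hVx hι' _ (derivation_mem_Tg hVy δ)
    exact ⟨δ - δ'', fun j => by simp [h2], δ'', h1, by simp⟩

end Trisecant

section ClosedImage

variable {k : Type} [Field k] {M N : ℕ} {X : Set (Pr k M)} {φ : Pr k M → Pr k N}

lemma isAlgSet_of_forall_exists {Z : Set (Pr k N)}
    (h : ∀ (y : Fin (N + 1) → k) (hy : y ≠ 0), Projectivization.mk k y hy ∉ Z →
      ∃ f, (∃ d, f.IsHomogeneous d) ∧ (∀ p ∈ Z, Vanishes f p) ∧ eval y f ≠ 0) : IsAlgSet Z := by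
  refine ⟨{f | (∃ d, f.IsHomogeneous d) ∧ ∀ p ∈ Z, Vanishes f p}, fun f hf => hf.1, ?_⟩
  ext p
  refine ⟨fun hp f hf => hf.2 p hp, fun hp => ?_⟩
  by_contra hpZ
  obtain ⟨f, hf1, hf2, hf3⟩ := h p.rep p.rep_nonzero (by rwa [p.mk_rep])
  exact hf3 (hp f ⟨hf1, hf2⟩ _ _ p.mk_rep)

lemma prod_pow_mem_ideal_pow {R σ : Type} [CommRing R] (I : Ideal R) (s : Finset σ) (x : σ → R)
    (hx : ∀ i, x i ∈ I) (m : σ → ℕ) : ∏ i ∈ s, x i ^ m i ∈ I ^ (∑ i ∈ s, m i) := by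
  classical
  induction s using Finset.induction_on with
  | empty => simp
  | insert i s hi ih =>
    rw [Finset.prod_insert hi, Finset.sum_insert hi, pow_add]
    exact Ideal.mul_mem_mul (Ideal.pow_mem_pow (hx i) _) ih

lemma eval_homogeneousComponent_eq_sum {σ : Type} [Fintype σ] [DecidableEq σ] (D : ℕ)
    (f : MvPolynomial σ k) (v : σ → k) :
    eval v (homogeneousComponent D f) =
      ∑ b ∈ Finset.finsuppAntidiag (Finset.univ : Finset σ) D, coeff b f * ∏ i, v i ^ b i := by
  have hdeg : ∀ b : σ →₀ ℕ, b.degree = D ↔ b ∈ Finset.finsuppAntidiag (Finset.univ : Finset σ) D := by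
    intro b
    simp [Finsupp.degree_eq_sum]
  rw [homogeneousComponent_apply, map_sum, Finset.sum_filter]
  simp only [hdeg]
  rw [← Finset.sum_filter, Finset.filter_mem_eq_inter, Finset.inter_comm]
  refine (Finset.sum_congr rfl fun b _ => ?_).trans
    (Finset.sum_subset (Finset.inter_subset_left (s₂ := f.support)) fun b hb hb2 => ?_)
  · rw [eval_monomial, Finsupp.prod_fintype _ _ (fun i => pow_zero _)]
  · have : coeff b f = 0 := by
      by_contra hne
      exact hb2 (Finset.mem_inter.2 ⟨hb, mem_support_iff.2 hne⟩)
    rw [this, zero_mul]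

/-- The image of a projective set under a morphism is closed. -/
lemma isAlgSet_image [IsAlgClosed k] (hX : IsAlgSet X) (hφ : IsMorphismOn X φ) : IsAlgSet (φ '' X) := by
  classical
  apply isAlgSet_of_forall_exists
  intro y0 hy0 hnot
  let P : (Fin (M + 1) → k) → (Fin (N + 1) → k) → Prop := fun v y =>
    ∃ (hv : v ≠ 0) (hy : y ≠ 0), Projectivization.mk k v hv ∈ X ∧
      φ (Projectivization.mk k v hv) = Projectivization.mk k y hy
  let G : Set (MvPolynomial (Fin (M + 1)) k) :=
    {f | ∃ p ∈ X, ∃ Ψ, LocalRep X φ p Ψ ∧ ∃ i j, f = Ψ i * C (y0 j) - Ψ j * C (y0 i)}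
  let J : Ideal (MvPolynomial (Fin (M + 1)) k) := Van X ⊔ Ideal.span G
  have hJ : ∀ f ∈ J, ∃ Q : Fin (N + 1) → MvPolynomial (Fin (M + 1)) k, ∀ v y, P v y →
      eval v f = ∑ j, eval v (Q j) * (y0 j - y j) := by
    intro f hf
    have hle : J ≤ { carrier := {f | ∃ Q : Fin (N + 1) → MvPolynomial (Fin (M + 1)) k, ∀ v y, P v y →
                      eval v f = ∑ j, eval v (Q j) * (y0 j - y j)}
                     zero_mem' := ⟨0, by simp⟩
                     add_mem' := by
                      rintro a b ⟨Q, hQ⟩ ⟨R, hR⟩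
                      refine ⟨Q + R, fun v y h => ?_⟩
                      simp [hQ v y h, hR v y h, add_mul, Finset.sum_add_distrib]
                     smul_mem' := by
                      rintro c b ⟨Q, hQ⟩
                      refine ⟨fun j => c * Q j, fun v y h => ?_⟩
                      simp [hQ v y h, Finset.mul_sum, mul_assoc] : Ideal (MvPolynomial (Fin (M + 1)) k) } := by
      refine sup_le ?_ (Ideal.span_le.2 ?_)
      · intro f hf
        refine ⟨0, fun v y ⟨hv, _, hvX, _⟩ => ?_⟩
        simp [hf v ⟨hv, hvX⟩]
      · rintro _ ⟨p, hp, Ψ, hΨ, i, j, rfl⟩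
        refine ⟨fun l => (if l = j then Ψ i else 0) - (if l = i then Ψ j else 0),
          fun v y ⟨hv, hy, hvX, h⟩ => ?_⟩
        have hpar : eval v (Ψ i) * y j = eval v (Ψ j) * y i := by
          by_cases h2 : (fun j => eval v (Ψ j)) = 0
          · have h3 : ∀ j, eval v (Ψ j) = 0 := fun j => congrFun h2 j
            simp [h3]
          · exact mul_eq_mul_of_mk_eq ((hΨ.2.2 _ hvX v hv rfl h2).symm.trans h) i j
        simp only [map_sub, map_mul, eval_C, apply_ite (eval v), map_zero, sub_mul, ite_mul, zero_mul,
          Finset.sum_sub_distrib, Finset.sum_ite_eq', Finset.mem_univ, if_true]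
        linear_combination hpar
    exact hle hf
  have hrad : Ideal.span (Set.range (MvPolynomial.X : Fin (M + 1) → MvPolynomial (Fin (M + 1)) k)) ≤
      J.radical := by
    rw [Ideal.span_le]
    rintro _ ⟨i, rfl⟩
    rw [SetLike.mem_coe, ← vanishingIdeal_zeroLocus_eq_radical (K := k), mem_vanishingIdeal_iff]
    intro v hv
    rw [aeval_X]
    have hv0 : v = 0 := by
      by_contra hne
      have hvX := mem_of_Van hX hne fun f hf => hv f (Ideal.mem_sup_left hf)
      obtain ⟨Ψ, hΨ⟩ := hφ _ hvX
      have hΨv : (fun j => eval v (Ψ j)) ≠ 0 := by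
        obtain ⟨⟨d, hd⟩, h2, -⟩ := hΨ
        obtain ⟨t, ht⟩ := (Projectivization.mk_eq_mk_iff' k _ _ (Projectivization.rep_nonzero _) hne).1
          (Projectivization.mk_rep (Projectivization.mk k v hne))
        intro h0
        apply h2
        rw [← ht]
        ext j
        have := eval_mul_of_isHomogeneous (hd j) t v
        exact this.trans (by rw [show eval v (Ψ j) = 0 from congrFun h0 j]; simp)
      apply hnot
      refine ⟨_, hvX, ?_⟩
      rw [hΨ.2.2 _ hvX v hne rfl hΨv]
      obtain ⟨j, hj⟩ := Function.ne_iff.1 hy0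
      rw [Projectivization.mk_eq_mk_iff']
      refine ⟨eval v (Ψ j) / y0 j, ?_⟩
      ext i
      have := hv _ (Ideal.mem_sup_right (Ideal.subset_span ⟨_, hvX, Ψ, hΨ, i, j, rfl⟩))
      simp only [map_sub, map_mul, aeval_C, Algebra.algebraMap_self, RingHom.id_apply] at this
      change eval v (Ψ i) * y0 j - eval v (Ψ j) * y0 i = 0 at this
      change _ * _ = _
      rw [Pi.zero_apply] at hj
      field_simp
      linear_combination (-1 : k) * this
    rw [hv0]; rfl
  obtain ⟨D, hD⟩ := Ideal.exists_pow_le_of_le_radical_of_fg_radical hrad (IsNoetherian.noetherian _)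
  let B := Finset.finsuppAntidiag (Finset.univ : Finset (Fin (M + 1))) D
  let w : (Fin (M + 1) → k) → B → k := fun v b => ∏ i, v i ^ b.1 i
  have hmon : ∀ b : B, ∃ Q : Fin (N + 1) → MvPolynomial (Fin (M + 1)) k, ∀ v y, P v y →
      eval v (∏ i, MvPolynomial.X i ^ b.1 i) = ∑ j, eval v (Q j) * (y0 j - y j) := by
    intro b
    refine hJ _ (hD ?_)
    have h1 := prod_pow_mem_ideal_pow (Ideal.span (Set.range
      (MvPolynomial.X : Fin (M + 1) → MvPolynomial (Fin (M + 1)) k))) Finset.univ MvPolynomial.X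
      (fun i => Ideal.subset_span ⟨i, rfl⟩) b.1
    rwa [(Finset.mem_finsuppAntidiag.1 b.2).1] at h1
  choose Q hQ using hmon
  have hQw : ∀ v y, P v y → ∀ b : B, w v b = ∑ c : B, (∑ j, coeff c.1 (Q b j) * (y0 j - y j)) * w v c := by
    intro v y h b
    have h1 := eval_homogeneousComponent_eq_zero (v := v)
      (f := ∏ i, MvPolynomial.X i ^ b.1 i - ∑ j, MvPolynomial.C (y0 j - y j) * Q b j) (by
        intro t ht
        obtain ⟨hv, hy, hvX, h⟩ := h
        have h' : (fun j => t * v j) ≠ 0 := smul_ne_zero ht hv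
        have he : Projectivization.mk k (fun j => t * v j) h' = Projectivization.mk k v hv := by
          rw [Projectivization.mk_eq_mk_iff']; exact ⟨t, rfl⟩
        have := hQ b (fun j => t * v j) y ⟨h', hy, he ▸ hvX, he ▸ h⟩
        rw [map_sub, this, map_sum, sub_eq_zero]
        exact Finset.sum_congr rfl fun j _ => by rw [map_mul, eval_C, mul_comm]) D
    have h2 : homogeneousComponent D (∏ i, MvPolynomial.X i ^ b.1 i : MvPolynomial (Fin (M + 1)) k) =
        ∏ i, MvPolynomial.X i ^ b.1 i := by
      have h3 : (∏ i, MvPolynomial.X i ^ b.1 i : MvPolynomial (Fin (M + 1)) k).IsHomogeneous D := by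
        rw [← (Finset.mem_finsuppAntidiag.1 b.2).1]
        exact IsHomogeneous.prod _ _ _ fun i _ => isHomogeneous_X_pow i _
      rw [homogeneousComponent_of_mem h3, if_pos rfl]
    rw [map_sub, map_sub, sub_eq_zero, h2, map_sum, map_sum] at h1
    simp only [homogeneousComponent_C_mul, map_mul, eval_C, eval_homogeneousComponent_eq_sum] at h1
    have h4 : w v b = eval v (∏ i, MvPolynomial.X i ^ b.1 i) := by simp [w, map_prod]
    rw [h4, h1]
    simp only [Finset.mul_sum, Finset.sum_mul]
    rw [Finset.sum_comm, ← Finset.sum_coe_sort]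
    refine Finset.sum_congr rfl fun c _ => Finset.sum_congr rfl fun j _ => ?_
    simp only [w]; ring
  let m : Matrix B B (MvPolynomial (Fin (N + 1)) k) := Matrix.of fun b c =>
    ∑ j, MvPolynomial.C (coeff c.1 (Q b j)) * (MvPolynomial.C (y0 j) - MvPolynomial.X j)
  let h : MvPolynomial (Fin (N + 1)) k := (1 - m).det
  have heval : ∀ y, eval y h = (1 - m.map (eval y)).det := by
    intro y
    simp only [h]
    rw [RingHom.map_det, RingHom.mapMatrix_apply, Matrix.map_sub _ (fun a b => map_sub _ a b),
      Matrix.map_one _ (map_zero _) (map_one _)]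
  have hh0 : eval y0 h = 1 := by
    rw [heval]
    have : m.map (eval y0) = 0 := by ext b c; simp [m]
    rw [this, sub_zero, Matrix.det_one]
  have hhV : h ∈ Van (φ '' X) := by
    rintro y ⟨hy, q, hq, hqy⟩
    rw [heval]
    apply Matrix.exists_mulVec_eq_zero_iff.1
    refine ⟨w q.rep, ?_, ?_⟩
    · obtain ⟨i, hi⟩ := Function.ne_iff.1 q.rep_nonzero
      have hb : Finsupp.single i D ∈ B := by simp [B]
      intro h0
      have := congrFun h0 ⟨_, hb⟩
      simp only [w, Finsupp.single_apply, Pi.zero_apply, Finset.prod_eq_zero_iff] at this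
      obtain ⟨l, -, hl⟩ := this
      split_ifs at hl with hil
      · subst hil; exact hi (eq_zero_of_pow_eq_zero hl)
      · simp at hl
    · ext b
      rw [Matrix.sub_mulVec, Matrix.one_mulVec]
      have := hQw q.rep y ⟨q.rep_nonzero, hy, by rwa [q.mk_rep], by rw [q.mk_rep, hqy]⟩ b
      simp only [Pi.sub_apply, Pi.zero_apply, sub_eq_zero]
      rw [this]
      simp [Matrix.mulVec, dotProduct, m]
  have : ∃ d, eval y0 (homogeneousComponent d h) ≠ 0 := by
    by_contra! hcon
    have h1 := sum_homogeneousComponent h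
    rw [← h1, map_sum, Finset.sum_eq_zero fun d _ => hcon d] at hh0
    exact zero_ne_one hh0
  obtain ⟨d, hd⟩ := this
  exact ⟨_, ⟨d, homogeneousComponent_isHomogeneous d h⟩,
    (mem_Van_iff_of_isHomogeneous (homogeneousComponent_isHomogeneous d h)).1
      (homogeneousComponent_mem_Van hhV d), hd⟩

end ClosedImage

section Planes

variable {k : Type} [Field k] {F : Type} [Field F] [Algebra k F] {m : Type}

/-- Entrywise application of a derivation. -/
def dv (δ : Derivation k F F) (u : m → F) : m → F := fun j => δ (u j)

lemma dv_add (δ : Derivation k F F) (u w : m → F) : dv δ (u + w) = dv δ u + dv δ w := by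
  ext j; simp [dv]

lemma dv_sub (δ : Derivation k F F) (u w : m → F) : dv δ (u - w) = dv δ u - dv δ w := by
  ext j; simp [dv]

lemma dv_smul (δ : Derivation k F F) (c : F) (u : m → F) : dv δ (c • u) = c • dv δ u + δ c • u := by
  ext j; simp [dv]; ring

lemma add_dv (δ δ' : Derivation k F F) (u : m → F) : dv (δ + δ') u = dv δ u + dv δ' u := rfl

lemma sub_dv (δ δ' : Derivation k F F) (u : m → F) : dv (δ - δ') u = dv δ u - dv δ' u := by
  ext j; simp [dv]

lemma smul_dv (c : F) (δ : Derivation k F F) (u : m → F) : dv (c • δ) u = c • dv δ u := rfl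

lemma dv_dv (δ δ' : Derivation k F F) (u : m → F) : dv δ (dv δ' u) = dv δ' (dv δ u) + dv ⁅δ, δ'⁆ u := by
  ext j; simp [dv, Derivation.commutator_apply]

variable [Fintype m]

/-- The plane spanned by `f` and its derivative in the distinguished direction is stable. -/
lemma plane_stable (Dp : Submodule F (Derivation k F F)) (δ₀ : Derivation k F F)
    (S Sx : Submodule F (m → F)) (f g : m → F) (hm : 5 ≤ Fintype.card m)
    (hS3 : finrank F S = 3) (hSx3 : finrank F Sx = 3) (hfS : f ∈ S) (hdf : ∀ δ : Derivation k F F, dv δ f ∈ S)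
    (hDpS : ∀ η ∈ Dp, ∀ u ∈ S, dv η u ∈ S)
    (hDp : ∀ δ : Derivation k F F, dv δ f ∈ Submodule.span F {f} → δ ∈ Dp) (hgS : g ∈ S) (hgSx : g ∈ Sx)
    (hdg : ∀ δ : Derivation k F F, dv δ g ∈ Sx) (hSx : ∀ s ∈ Sx, ∃ δ : Derivation k F F, dv δ g = s)
    (hδ₀g : dv δ₀ g = 0) (hδ₀Sx : ∀ u ∈ Sx, dv δ₀ u ∈ Sx) (hδ₀ : δ₀ ∉ Dp)
    (htop : ∀ U : Submodule F (m → F), g ∈ U →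
      (∀ δ : Derivation k F F, ∀ u ∈ U, dv δ u ∈ U) → U = ⊤) :
    dv δ₀ (dv δ₀ f) ∈ Submodule.span F {f} ⊔ Submodule.span F {dv δ₀ f} ∧
      ∃ δ : Derivation k F F, dv δ f ∉ Submodule.span F {f} ⊔ Submodule.span F {dv δ₀ f} := by
  have hsmall : ∀ U : Submodule F (m → F), g ∈ U → finrank F U ≤ 4 →
      ¬ ∀ δ : Derivation k F F, ∀ u ∈ U, dv δ u ∈ U := by
    intro U hgU hU4 h
    rw [htop U hgU h, finrank_top, finrank_fintype_fun_eq_card] at hU4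
    omega
  set f₀ := dv δ₀ f with hf₀
  set P := Submodule.span F {f} ⊔ Submodule.span F {f₀} with hP
  have hfP : f ∈ P := Submodule.mem_sup_left (Submodule.mem_span_singleton_self f)
  have hf₀P : f₀ ∈ P := Submodule.mem_sup_right (Submodule.mem_span_singleton_self f₀)
  have memP : ∀ u, u ∈ P → ∃ a b : F, u = a • f + b • f₀ := by
    intro u hu
    obtain ⟨y, hy, z, hz, rfl⟩ := Submodule.mem_sup.1 hu
    obtain ⟨a, rfl⟩ := Submodule.mem_span_singleton.1 hy
    obtain ⟨b, rfl⟩ := Submodule.mem_span_singleton.1 hz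
    exact ⟨a, b, rfl⟩
  have hff₀ : f₀ ∉ Submodule.span F {f} := fun h => hδ₀ (hDp _ h)
  have hf_ne : f ≠ 0 := by
    intro h
    apply hff₀
    have : f₀ = 0 := by rw [hf₀, h]; ext j; simp [dv]
    rw [this]; exact Submodule.zero_mem _
  have hg_ne : g ≠ 0 := by
    intro h
    have hbot : ∀ δ : Derivation k F F, dv δ g = 0 := by intro δ; rw [h]; ext j; simp [dv]
    have : Sx = ⊥ := (Submodule.eq_bot_iff _).2 fun s hs => by
      obtain ⟨δ, rfl⟩ := hSx s hs; exact hbot δ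
    rw [this, finrank_bot] at hSx3
    omega
  have hP2 : finrank F P = 2 := by
    rw [hP, finrank_sup_span _ hff₀, finrank_span_singleton hf_ne]
  have hex : ∃ δ : Derivation k F F, dv δ f ∉ P := by
    by_contra! hcon
    have hdec : ∀ δ : Derivation k F F, ∃ b : F, δ - b • δ₀ ∈ Dp := by
      intro δ
      obtain ⟨a, b, h⟩ := memP _ (hcon δ)
      refine ⟨b, hDp _ ?_⟩
      rw [sub_dv, smul_dv, h, ← hf₀]
      exact Submodule.mem_span_singleton.2 ⟨a, by abel⟩
    have hle : Sx ≤ S := by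
      intro s hs
      obtain ⟨δ, rfl⟩ := hSx s hs
      obtain ⟨b, hb⟩ := hdec δ
      have := hDpS _ hb g hgS
      rwa [sub_dv, smul_dv, hδ₀g, smul_zero, sub_zero] at this
    have heq := Submodule.eq_of_le_of_finrank_eq hle (by rw [hS3, hSx3])
    refine hsmall S hgS (by omega) fun δ u hu => ?_
    obtain ⟨b, hb⟩ := hdec δ
    have h1 := S.add_mem (hDpS _ hb u hu) (S.smul_mem b (heq ▸ hδ₀Sx u (heq ▸ hu)))
    rwa [sub_dv, smul_dv, sub_add_cancel] at h1
  refine ⟨?_, hex⟩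
  have hPS : P ≤ S := sup_le ((Submodule.span_singleton_le_iff_mem _ _).2 hfS)
    ((Submodule.span_singleton_le_iff_mem _ _).2 (hdf δ₀))
  have hbasis : ∀ δ₁ : Derivation k F F, dv δ₁ f ∉ P → ∀ u ∈ S, ∃ a b c : F, u = a • f + b • f₀ + c • dv δ₁ f := by
    intro δ₁ h1 u hu
    have : P ⊔ Submodule.span F {dv δ₁ f} = S :=
      Submodule.eq_of_le_of_finrank_eq
        (sup_le hPS ((Submodule.span_singleton_le_iff_mem _ _).2 (hdf δ₁)))
        (by rw [finrank_sup_span _ h1, hP2, hS3])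
    rw [← this] at hu
    obtain ⟨y, hy, z, hz, rfl⟩ := Submodule.mem_sup.1 hu
    obtain ⟨c, rfl⟩ := Submodule.mem_span_singleton.1 hz
    obtain ⟨a, b, rfl⟩ := memP y hy
    exact ⟨a, b, c, rfl⟩
  obtain ⟨δ₂, hδ₂⟩ := hex
  obtain ⟨a, b, c, hg⟩ := hbasis δ₂ hδ₂ g hgS
  by_cases hc : c = 0
  · rw [hc, zero_smul, add_zero] at hg
    have h1 : a • f₀ + δ₀ a • f + (b • dv δ₀ f₀ + δ₀ b • f₀) = 0 := by
      rw [← hδ₀g, hg, dv_add, dv_smul, dv_smul]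
    by_cases hb : b = 0
    · exfalso
      rw [hb, map_zero, zero_smul, zero_smul, add_zero, add_zero] at h1
      by_cases ha : a = 0
      · apply hg_ne; rw [hg, ha, hb]; simp
      · apply hff₀
        rw [Submodule.mem_span_singleton]
        refine ⟨-(a⁻¹ * δ₀ a), ?_⟩
        have h2 : f₀ = a⁻¹ • (a • f₀ + δ₀ a • f) - (a⁻¹ * δ₀ a) • f := by
          rw [smul_add, smul_smul, smul_smul, inv_mul_cancel₀ ha, one_smul, add_sub_cancel_right]
        rw [h2, h1]; simp
    · rw [← Submodule.smul_mem_iff _ hb]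
      have : b • dv δ₀ f₀ = -(a • f₀ + δ₀ a • f + δ₀ b • f₀) := by
        rw [eq_neg_iff_add_eq_zero, ← h1]; abel
      rw [this]
      exact P.neg_mem (P.add_mem (P.add_mem (P.smul_mem _ hf₀P) (P.smul_mem _ hfP)) (P.smul_mem _ hf₀P))
  · obtain ⟨δ₁, hδ₁, hg⟩ : ∃ δ₁ : Derivation k F F, dv δ₁ f ∉ P ∧ g = a • f + dv δ₁ f := by
      refine ⟨b • δ₀ + c • δ₂, fun h => hδ₂ ?_, ?_⟩
      · rw [add_dv, smul_dv, smul_dv, ← hf₀] at h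
        rwa [P.add_mem_iff_right (P.smul_mem _ hf₀P), Submodule.smul_mem_iff _ hc] at h
      · rw [hg, add_dv, smul_dv, smul_dv, ← hf₀]; abel
    have hbas := hbasis δ₁ hδ₁
    set f₁ := dv δ₁ f with hf₁
    have hf₁S : f₁ ∈ S := hdf δ₁
    have hf₀S : f₀ ∈ S := hdf δ₀
    have hdec : ∀ δ : Derivation k F F, ∃ p q : F, ∃ η ∈ Dp, δ = p • δ₀ + q • δ₁ + η := by
      intro δ
      obtain ⟨r, p, q, h⟩ := hbas _ (hdf δ)
      refine ⟨p, q, δ - (p • δ₀ + q • δ₁), hDp _ ?_, by abel⟩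
      rw [sub_dv, add_dv, smul_dv, smul_dv, ← hf₀, ← hf₁, h]
      exact Submodule.mem_span_singleton.2 ⟨r, by abel⟩
    have hspan : ∀ (δ : Derivation k F F) (U : Submodule F (m → F)), S ≤ U → dv δ f₀ ∈ U →
        dv δ f₁ ∈ U → ∀ u ∈ S, dv δ u ∈ U := by
      intro δ U hSU h0 h1 u hu
      obtain ⟨p, q, r, rfl⟩ := hbas u hu
      simp only [dv_add, dv_smul]
      have h2 : dv δ f ∈ U := hSU (hdf δ)
      have := hSU hfS
      have := hSU hf₀S
      have := hSU hf₁S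
      refine U.add_mem (U.add_mem (U.add_mem ?_ ?_) (U.add_mem ?_ ?_)) (U.add_mem ?_ ?_) <;>
      exact U.smul_mem _ ‹_›
    have h01 : dv δ₀ f₁ ∈ S := by
      have h1 : dv δ₀ f₁ = -(a • f₀ + δ₀ a • f) := by
        rw [eq_neg_iff_add_eq_zero, ← hδ₀g, hg, dv_add, dv_smul]; abel
      rw [h1]
      exact S.neg_mem (S.add_mem (S.smul_mem _ hf₀S) (S.smul_mem _ hfS))
    have h10 : dv δ₁ f₀ ∈ S := by
      rw [hf₀, dv_dv]
      exact S.add_mem h01 (hdf _)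
    set ξ := dv δ₁ f₁ with hξdef
    have hδ₁g : ∀ U : Submodule F (m → F), S ≤ U → ξ ∈ U → dv δ₁ g ∈ U := by
      intro U hSU hξU
      rw [hg, dv_add, dv_smul]
      exact U.add_mem (U.add_mem (U.smul_mem _ (hSU hf₁S)) (U.smul_mem _ (hSU hfS))) hξU
    have hSxU : ∀ U : Submodule F (m → F), S ≤ U → ξ ∈ U → Sx ≤ U := by
      intro U hSU hξU s hs
      obtain ⟨δ, rfl⟩ := hSx s hs
      obtain ⟨p, q, η, hη, rfl⟩ := hdec δ
      simp only [add_dv, smul_dv, hδ₀g, smul_zero, zero_add]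
      exact U.add_mem (U.smul_mem _ (hδ₁g U hSU hξU)) (hSU (hDpS η hη g hgS))
    have hξ : ξ ∉ S := by
      intro hξ
      have heq := Submodule.eq_of_le_of_finrank_eq (hSxU S le_rfl hξ) (by rw [hS3, hSx3])
      refine hsmall S hgS (by omega) fun δ u hu => ?_
      obtain ⟨p, q, η, hη, rfl⟩ := hdec δ
      rw [add_dv, add_dv, smul_dv, smul_dv]
      exact S.add_mem (S.add_mem (S.smul_mem _ (heq ▸ hδ₀Sx u (heq ▸ hu)))
        (S.smul_mem _ (hspan δ₁ S le_rfl h10 hξ u hu))) (hDpS η hη u hu)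
    set U := S ⊔ Submodule.span F {ξ} with hU
    have hSU : S ≤ U := le_sup_left
    have hξU : ξ ∈ U := Submodule.mem_sup_right (Submodule.mem_span_singleton_self ξ)
    have hU4 : finrank F U = 4 := by rw [hU, finrank_sup_span _ hξ, hS3]
    have hSxU' := hSxU U hSU hξU
    have hfSx : f ∉ Sx := by
      intro hfSx
      have h0 : f₀ ∈ Sx := hδ₀Sx f hfSx
      have h1 : f₁ ∈ Sx := by
        have : f₁ = g - a • f := by rw [hg]; abel
        rw [this]; exact Sx.sub_mem hgSx (Sx.smul_mem _ hfSx)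
      have hle : S ≤ Sx := by
        intro u hu
        obtain ⟨p, q, r, rfl⟩ := hbas u hu
        exact Sx.add_mem (Sx.add_mem (Sx.smul_mem _ hfSx) (Sx.smul_mem _ h0)) (Sx.smul_mem _ h1)
      have heq := Submodule.eq_of_le_of_finrank_eq hle (by rw [hS3, hSx3])
      apply hξ
      have h2 := heq ▸ hdg δ₁
      rw [hg, dv_add, dv_smul] at h2
      exact (S.add_mem_iff_right (S.add_mem (S.smul_mem _ hf₁S) (S.smul_mem _ hfS))).1 h2
    have hA : (Sx ⊓ S) ⊔ Submodule.span F {f} = S := by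
      refine Submodule.eq_of_le_of_finrank_le (sup_le inf_le_right
        ((Submodule.span_singleton_le_iff_mem _ _).2 hfS)) ?_
      rw [finrank_sup_span _ fun h : f ∈ Sx ⊓ S => hfSx h.1]
      have h1 := Submodule.finrank_sup_add_finrank_inf_eq Sx S
      have h2 := Submodule.finrank_mono (sup_le hSxU' hSU)
      omega
    have h00U : dv δ₀ f₀ ∈ U := by
      have h1 := hf₀S
      rw [← hA] at h1
      obtain ⟨y, hy, z, hz, hyz⟩ := Submodule.mem_sup.1 h1
      obtain ⟨r, rfl⟩ := Submodule.mem_span_singleton.1 hz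
      have h2 := hSxU' (hδ₀Sx y hy.1)
      rw [← hyz, dv_add, dv_smul]
      exact U.add_mem h2 (U.add_mem (U.smul_mem _ (hSU hf₀S)) (U.smul_mem _ (hSU hfS)))
    obtain ⟨s, hs, z, hz, hsz⟩ := Submodule.mem_sup.1 h00U
    obtain ⟨r, rfl⟩ := Submodule.mem_span_singleton.1 hz
    have hall : ∀ (δ : Derivation k F F), ∀ u ∈ S, dv δ u ∈ U := by
      intro δ u hu
      obtain ⟨p, q, η, hη, rfl⟩ := hdec δ
      rw [add_dv, add_dv, smul_dv, smul_dv]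
      exact U.add_mem (U.add_mem (U.smul_mem _ (hspan δ₀ U hSU h00U (hSU h01) u hu))
        (U.smul_mem _ (hspan δ₁ U hSU (hSU h10) hξU u hu))) (hSU (hDpS η hη u hu))
    by_cases hr : r = 0
    · have h00 : dv δ₀ f₀ ∈ S := by rw [← hsz, hr, zero_smul, add_zero]; exact hs
      have h0S := hspan δ₀ S le_rfl h00 h01
      have h1 : dv δ₁ (dv δ₀ f₀) ∈ S := by
        rw [dv_dv]
        refine S.add_mem (h0S _ h10) ?_
        obtain ⟨p, q, η, hη, h⟩ := hdec ⁅δ₁, δ₀⁆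
        rw [h, add_dv, add_dv, smul_dv, smul_dv]
        exact S.add_mem (S.add_mem (S.smul_mem _ h00) (S.smul_mem _ h10)) (hDpS η hη _ hf₀S)
      obtain ⟨a', b', c', h⟩ := hbas _ h00
      have hc' : c' = 0 := by
        by_contra hne
        apply hξ
        rw [← Submodule.smul_mem_iff _ hne]
        rw [h] at h1
        simp only [dv_add, dv_smul] at h1
        have h2 : a' • f₁ + δ₁ a' • f + (b' • dv δ₁ f₀ + δ₁ b' • f₀) + δ₁ c' • f₁ ∈ S := by
          refine S.add_mem (S.add_mem (S.add_mem ?_ ?_) (S.add_mem ?_ ?_)) ?_ <;>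
          exact S.smul_mem _ ‹_›
        have h3 := S.sub_mem h1 h2
        convert h3 using 1
        abel
      rw [h, hc', zero_smul, add_zero]
      exact P.add_mem (P.smul_mem _ hfP) (P.smul_mem _ hf₀P)
    · exfalso
      have hξeq : ξ = r⁻¹ • (dv δ₀ f₀ - s) := by
        rw [← hsz, add_sub_cancel_left, smul_smul, inv_mul_cancel₀ hr, one_smul]
      have hSxS : Sx ⊔ S = U := by
        refine Submodule.eq_of_le_of_finrank_le (sup_le hSxU' hSU) ?_
        have h1 : finrank F S < finrank F ↥(Sx ⊔ S) := by
          apply Submodule.finrank_lt_finrank_of_lt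
          refine lt_of_le_of_ne le_sup_right fun h => hξ ?_
          have h2 : Sx ≤ S := by rw [h]; exact le_sup_left
          have h3 := h2 (hdg δ₁)
          rw [hg, dv_add, dv_smul] at h3
          exact (S.add_mem_iff_right (S.add_mem (S.smul_mem _ hf₁S) (S.smul_mem _ hfS))).1 h3
        omega
      have hU0 : ∀ u ∈ U, dv δ₀ u ∈ U := by
        intro u hu
        rw [← hSxS] at hu
        obtain ⟨y, hy, z, hz, rfl⟩ := Submodule.mem_sup.1 hu
        rw [dv_add]
        exact U.add_mem (hSxU' (hδ₀Sx y hy)) (hall δ₀ z hz)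
      have hUξ : ∀ δ : Derivation k F F, dv δ ξ ∈ U → ∀ u ∈ U, dv δ u ∈ U := by
        intro δ hδ u hu
        obtain ⟨y, hy, z, hz, rfl⟩ := Submodule.mem_sup.1 hu
        obtain ⟨t, rfl⟩ := Submodule.mem_span_singleton.1 hz
        rw [dv_add, dv_smul]
        exact U.add_mem (hall δ y hy) (U.add_mem (U.smul_mem _ hδ) (U.smul_mem _ hξU))
      have hU1 : ∀ u ∈ U, dv δ₁ u ∈ U := by
        refine hUξ δ₁ ?_
        rw [hξeq, dv_smul, dv_sub, dv_dv]
        exact U.add_mem (U.smul_mem _ (U.sub_mem (U.add_mem (hall _ _ h10) (hall _ _ hf₀S))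
          (hall _ _ hs))) (U.smul_mem _ (U.sub_mem h00U (hSU hs)))
      refine hsmall U (hSU hgS) hU4.le fun δ u hu => ?_
      obtain ⟨p, q, η, hη, rfl⟩ := hdec δ
      rw [add_dv, add_dv, smul_dv, smul_dv]
      refine U.add_mem (U.add_mem (U.smul_mem _ (hU0 u hu)) (U.smul_mem _ (hU1 u hu)))
        (hUξ η ?_ u hu)
      rw [hξdef, dv_dv]
      exact U.add_mem (hall _ _ (hDpS η hη _ hf₁S)) (hall _ _ hf₁S)

end Planes

section Lines

variable {k : Type} [Field k] {F : Type} [Field F] [Algebra k F]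

lemma leibniz_aeval {A σ : Type} [CommRing A] [Algebra k A] [Fintype σ] (Θ : Derivation k A A)
    (a : σ → A) (f : MvPolynomial σ k) :
    Θ (aeval a f) = ∑ j, aeval a (pderiv j f) * Θ (a j) := by
  classical
  induction f using MvPolynomial.induction_on with
  | C r => simp
  | add p q hp hq => simp [hp, hq, add_mul, Finset.sum_add_distrib]
  | mul_X p i hp =>
    simp only [map_mul, aeval_X, Derivation.leibniz, hp, smul_eq_mul, map_add, pderiv_X, add_mul,
      Finset.sum_add_distrib, Finset.mul_sum, Pi.single_apply]
    congr 1
    · simp [Finset.sum_ite_eq]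
    · exact Finset.sum_congr rfl fun j _ => by ring

lemma derivation_aeval_of_isHomogeneous {A σ : Type} [CommRing A] [Algebra k A] [Fintype σ]
    (Θ : Derivation k A A) (a : σ → A) (c : A) (ha : ∀ j, Θ (a j) = c * a j)
    {f : MvPolynomial σ k} {d : ℕ} (hf : f.IsHomogeneous d) :
    Θ (aeval a f) = d * c * aeval a f := by
  have h := congrArg (aeval a) hf.sum_X_mul_pderiv
  simp only [map_sum, map_mul, aeval_X, nsmul_eq_mul, map_natCast] at h
  rw [leibniz_aeval, mul_right_comm, ← h, Finset.sum_mul]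
  exact Finset.sum_congr rfl fun j _ => by rw [ha]; ring

/-- Coefficientwise application of a derivation to polynomials in one variable. -/
noncomputable def polyDer (δ : Derivation k F F) :
    Derivation k (Polynomial F) (Polynomial F) :=
  PolynomialModule.equivPolynomialSelf.toLinearMap.compDer δ.mapCoeffs

lemma polyDer_C (δ : Derivation k F F) (c : F) :
    polyDer δ (Polynomial.C c) = Polynomial.C (δ c) := by
  change PolynomialModule.equivPolynomialSelf (δ.mapCoeffs (Polynomial.C c)) = _
  rw [Derivation.mapCoeffs_C, PolynomialModule.equivPolynomialSelf_apply_eq,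
    PolynomialModule.equivPolynomial_single, Polynomial.monomial_zero_left]

lemma polyDer_X (δ : Derivation k F F) : polyDer δ Polynomial.X = 0 := by
  simp [polyDer]

lemma eq_zero_of_derivation_eq_mul [CharZero F] (Θ : Derivation k (Polynomial F) (Polynomial F))
    (T c : Polynomial F) (hΘ : Θ T = c * T) (hX : (Θ Polynomial.X).coeff 0 ≠ 0)
    (h0 : Polynomial.X ∣ T) : T = 0 := by
  by_contra hT
  obtain ⟨U, hU, hnd⟩ := Polynomial.exists_eq_pow_rootMultiplicity_mul_and_not_dvd T hT 0
  rw [Polynomial.C_0, sub_zero] at hU hnd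
  obtain ⟨r, hr⟩ : ∃ r, Polynomial.rootMultiplicity 0 T = r + 1 := by
    refine Nat.exists_eq_succ_of_ne_zero fun h => hnd ?_
    rw [h, pow_zero, one_mul] at hU
    rwa [← hU]
  rw [hr] at hU
  rw [hU, Derivation.leibniz, Derivation.leibniz_pow] at hΘ
  simp only [smul_eq_mul, nsmul_eq_mul, Nat.add_sub_cancel] at hΘ
  have h1 : Polynomial.X * (c * U - Θ U) = ((r + 1 : ℕ) : Polynomial F) * Θ Polynomial.X * U := by
    have hne : (Polynomial.X : Polynomial F) ^ r ≠ 0 := pow_ne_zero _ Polynomial.X_ne_zero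
    apply mul_left_cancel₀ hne
    linear_combination -hΘ
  have h2 := congrArg (fun p => Polynomial.coeff p 0) h1
  simp only [Polynomial.mul_coeff_zero, Polynomial.coeff_X_zero, zero_mul] at h2
  rw [Polynomial.X_dvd_iff] at hnd
  have h3 : ((r + 1 : ℕ) : Polynomial F).coeff 0 ≠ 0 := by
    rw [← Polynomial.C_eq_natCast, Polynomial.coeff_C_zero]
    exact_mod_cast Nat.succ_ne_zero r
  exact mul_ne_zero (mul_ne_zero h3 hX) hnd h2.symm

/-- A homogeneous equation satisfied at `f` is satisfied on the line through `f` and `e`, if the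
plane spanned by `f` and `e` is stable and `f` moves inside it. -/
lemma aeval_line_eq_zero [CharZero F] {m : Type} [Fintype m] (δ : Derivation k F F) (f e : m → F) (μ ν : F)
    (hf : dv δ f = e) (he : dv δ e = μ • f + ν • e) {h : MvPolynomial m k} {d : ℕ}
    (hh : h.IsHomogeneous d) (h0 : aeval f h = 0) (α β : F) :
    α ≠ 0 → aeval (fun j => α * f j + β * e j) h = 0 := by
  intro hα
  set w : m → Polynomial F := fun j => Polynomial.C (f j) + Polynomial.X * Polynomial.C (e j)
  have hev : ∀ b : F, (aeval w h).eval b = aeval (fun j => f j + b * e j) h := by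
    intro b
    have : ((Polynomial.aeval b).restrictScalars k).comp (aeval w : MvPolynomial m k →ₐ[k] _) =
        aeval (fun j => f j + b * e j) := by
      ext j; simp [w]; ring
    rw [← this]
    simp [Polynomial.aeval_def, Polynomial.eval₂_eq_eval_map]
  let Θ : Derivation k (Polynomial F) (Polynomial F) :=
    polyDer δ - (1 + Polynomial.X * Polynomial.C ν - Polynomial.X ^ 2 * Polynomial.C μ) •
      (Polynomial.derivative'.restrictScalars k)
  have hX : Θ Polynomial.X =
      -(1 + Polynomial.X * Polynomial.C ν - Polynomial.X ^ 2 * Polynomial.C μ) := by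
    simp [Θ, polyDer_X]
  have hC : ∀ c, Θ (Polynomial.C c) = Polynomial.C (δ c) := by
    intro c; simp [Θ, polyDer_C]
  have hw : ∀ j, Θ (w j) = (Polynomial.X * Polynomial.C μ) * w j := by
    intro j
    have h1 : δ (f j) = e j := congrFun hf j
    have h2 : δ (e j) = μ * f j + ν * e j := congrFun he j
    simp only [w, map_add, Derivation.leibniz, hX, hC, h1, h2, smul_eq_mul, map_mul]
    ring
  have hT : aeval w h = 0 := by
    refine eq_zero_of_derivation_eq_mul Θ _ _ (derivation_aeval_of_isHomogeneous Θ w _ hw hh) ?_ ?_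
    · simp [hX]
    · rw [Polynomial.X_dvd_iff, Polynomial.coeff_zero_eq_eval_zero, hev]
      simpa using h0
  have h1 := hev (β / α)
  rw [hT, Polynomial.eval_zero] at h1
  have h2 : (fun j => α * f j + β * e j) = fun j => α * (f j + β / α * e j) := by
    ext j; field_simp
  rw [h2, aeval_mul_of_isHomogeneous hh, ← h1, mul_zero]

lemma line_injective {N : ℕ} : Function.Injective fun W : Submodule k (Fin (N + 1) → k) =>
    {p : Pr k N | Projectivization.submodule p ≤ W} := by
  have key : ∀ W W' : Submodule k (Fin (N + 1) → k),
      {p : Pr k N | Projectivization.submodule p ≤ W} = {p | Projectivization.submodule p ≤ W'} →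
      W ≤ W' := by
    intro W W' h v hv
    by_cases hv0 : v = 0
    · rw [hv0]; exact W'.zero_mem
    · have h1 : Projectivization.mk k v hv0 ∈ {p : Pr k N | Projectivization.submodule p ≤ W} := by
        simp [Projectivization.submodule_mk, hv]
      rw [h] at h1
      simpa [Projectivization.submodule_mk] using h1
  intro W W' h
  exact le_antisymm (key _ _ h) (key _ _ h.symm)

/-- A vector over an extension field killed by all equations of a plane lies in its base change. -/
lemma mem_span_of_forall_functional {m : Type} [Fintype m] (W : Submodule k (m → k))
    (w : Fin 2 → m → k) (hw : W = Submodule.span k (range w)) (u : m → F)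
    (hu : ∀ c : m → k, (∀ v ∈ W, ∑ j, c j * v j = 0) → ∑ j, algebraMap k F (c j) * u j = 0) :
    u ∈ Submodule.span F (range fun i j => algebraMap k F (w i j)) := by
  classical
  obtain ⟨q, hq⟩ := W.subtype.exists_leftInverse_of_injective (by simp)
  have hqW : ∀ j, ∃ a : Fin 2 → k, ∑ i, a i • w i = (q (Pi.single j 1) : m → k) := by
    intro j
    have : (q (Pi.single j 1) : m → k) ∈ Submodule.span k (range w) := hw ▸ (q _).2
    exact (Submodule.mem_span_range_iff_exists_fun k).1 this
  choose a ha using hqW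
  have hexp : ∀ v : m → k, (q v : m → k) = ∑ j, v j • (q (Pi.single j 1) : m → k) := by
    intro v
    conv_lhs => rw [pi_eq_sum_univ' v]
    simp [Pi.single_apply]
  rw [Submodule.mem_span_range_iff_exists_fun]
  refine ⟨fun i => ∑ j, u j * algebraMap k F (a j i), ?_⟩
  ext l
  have h1 := hu (fun j => (Pi.single l 1 : m → k) j - (q (Pi.single j 1) : m → k) l) ?_
  · simp only [map_sub, sub_mul, Finset.sum_sub_distrib, sub_eq_zero] at h1
    have h2 : ∑ j, algebraMap k F ((Pi.single l 1 : m → k) j) * u j = u l := by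
      rw [Finset.sum_eq_single l] <;> simp +contextual [Pi.single_apply]
    rw [h2] at h1
    rw [h1]
    simp only [Finset.sum_apply, Pi.smul_apply, smul_eq_mul, Finset.sum_mul]
    rw [Finset.sum_comm]
    refine Finset.sum_congr rfl fun j _ => ?_
    rw [← ha j]
    simp only [Finset.sum_apply, Pi.smul_apply, smul_eq_mul, map_sum, map_mul, Finset.sum_mul]
    exact Finset.sum_congr rfl fun i _ => by ring
  · intro v hv
    have h3 : q v = ⟨v, hv⟩ := by simpa using LinearMap.congr_fun hq ⟨v, hv⟩
    have h4 := congrFun (hexp v) l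
    rw [h3] at h4
    simp only [Finset.sum_apply, Pi.smul_apply, smul_eq_mul] at h4
    simp only [sub_mul, Finset.sum_sub_distrib, sub_eq_zero]
    rw [Finset.sum_eq_single l]
    · simp only [Pi.single_eq_same, one_mul]
      rw [h4]
      exact Finset.sum_congr rfl fun i _ => by ring
    · intro j _ hj; simp [hj]
    · simp

lemma exists_minor_ne_zero {m : Type} {f e : m → F} (hf : f ≠ 0)
    (he : e ∉ Submodule.span F {f}) : ∃ i j, f i * e j - f j * e i ≠ 0 := by
  by_contra! hcon
  obtain ⟨l, hl⟩ := Function.ne_iff.1 hf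
  refine he (Submodule.mem_span_singleton.2 ⟨e l / f l, ?_⟩)
  have hl' : f l ≠ 0 := hl
  ext j
  have := hcon l j
  simp only [Pi.smul_apply, smul_eq_mul]
  field_simp
  linear_combination -this

variable [IsAlgClosed k] [CharZero k]

lemma derivation_mem_plane {N : ℕ} {Y : Set (Pr k N)} (hY : IsAlgSet Y) (hnr : ¬ RuledByLines Y)
    (f : Fin (N + 1) → F) (hf0 : f ≠ 0) (hfY : ∀ h ∈ Van Y, aeval f h = 0)
    (δ₀ : Derivation k F F) (he : dv δ₀ f ∉ Submodule.span F {f})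
    (hst : dv δ₀ (dv δ₀ f) ∈ Submodule.span F {f} ⊔ Submodule.span F {dv δ₀ f})
    (δ : Derivation k F F) : dv δ f ∈ Submodule.span F {f} ⊔ Submodule.span F {dv δ₀ f} := by
  classical
  have : CharZero F := charZero_of_injective_algebraMap (algebraMap k F).injective
  have hfin : {W : Submodule k (Fin (N + 1) → k) | finrank k W = 2 ∧
      {p : Pr k N | Projectivization.submodule p ≤ W} ⊆ Y}.Finite := by
    rw [RuledByLines, Set.not_infinite] at hnr
    exact (hnr.preimage (line_injective (k := k) (N := N)).injOn).subset
      fun W hW => ⟨⟨W, hW.1, rfl⟩, hW.2⟩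
  by_cases H : ∃ W ∈ {W : Submodule k (Fin (N + 1) → k) | finrank k W = 2 ∧
      {p : Pr k N | Projectivization.submodule p ≤ W} ⊆ Y},
      ∀ c : Fin (N + 1) → k, (∀ v ∈ W, ∑ j, c j * v j = 0) → ∑ j, algebraMap k F (c j) * f j = 0
  · obtain ⟨W, ⟨hW2, -⟩, hW⟩ := H
    by_contra hδ
    let b := Module.finBasisOfFinrankEq k W hW2
    have hspan : W = Submodule.span k (range fun i => (b i : Fin (N + 1) → k)) := by
      have h1 := congrArg (Submodule.map W.subtype) b.span_eq
      rw [Submodule.map_span, ← Set.range_comp] at h1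
      simpa [Function.comp_def] using h1.symm
    have hder : ∀ (δ : Derivation k F F) (u : Fin (N + 1) → F), (∀ c : Fin (N + 1) → k,
        (∀ v ∈ W, ∑ j, c j * v j = 0) → ∑ j, algebraMap k F (c j) * u j = 0) →
        ∀ c : Fin (N + 1) → k, (∀ v ∈ W, ∑ j, c j * v j = 0) →
          ∑ j, algebraMap k F (c j) * dv δ u j = 0 := by
      intro δ u hu c hc
      have := congrArg δ (hu c hc)
      simpa [dv, Derivation.leibniz, mul_comm] using this
    have h1 := mem_span_of_forall_functional W _ hspan f hW
    have h2 := mem_span_of_forall_functional W _ hspan _ (hder δ₀ f hW)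
    have h3 := mem_span_of_forall_functional W _ hspan _ (hder δ f hW)
    have h4 := Submodule.finrank_mono (sup_le (sup_le
      ((Submodule.span_singleton_le_iff_mem _ _).2 h1)
      ((Submodule.span_singleton_le_iff_mem _ _).2 h2))
      ((Submodule.span_singleton_le_iff_mem _ _).2 h3))
    have h5 := finrank_range_le_card (R := F)
      (fun (i : Fin 2) (j : Fin (N + 1)) => algebraMap k F ((b i : Fin (N + 1) → k) j))
    rw [finrank_sup_span _ hδ, finrank_sup_span _ he, finrank_span_singleton hf0] at h4
    rw [Set.finrank, Fintype.card_fin] at h5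
    omega
  · exfalso
    push Not at H
    choose! c hc1 hc2 using H
    obtain ⟨i₀, j₀, hij⟩ := exists_minor_ne_zero hf0 he
    set e := dv δ₀ f with he_def
    let a : Fin (N + 1) ⊕ Fin (N + 1) → F := Sum.elim f e
    let g : MvPolynomial (Fin (N + 1) ⊕ Fin (N + 1)) k :=
      (X (.inl i₀) * X (.inr j₀) - X (.inl j₀) * X (.inr i₀)) *
        ∏ W ∈ hfin.toFinset, ∑ j, MvPolynomial.C (c W j) * X (.inl j)
    have hg : aeval a g ≠ 0 := by
      simp only [g, map_mul, map_sub, aeval_X, map_prod, map_sum, aeval_C, a, Sum.elim_inl,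
        Sum.elim_inr]
      exact mul_ne_zero hij (Finset.prod_ne_zero_iff.2 fun W hW =>
        hc2 W (hfin.mem_toFinset.1 hW))
    obtain ⟨v, hv, hva⟩ := exists_specialization a g hg
    simp only [g, map_mul, map_sub, eval_X, map_prod, map_sum, eval_C] at hv
    have hv1 := left_ne_zero_of_mul hv
    have hv2 := Finset.prod_ne_zero_iff.1 (right_ne_zero_of_mul hv)
    set f₀ : Fin (N + 1) → k := fun j => v (.inl j)
    set e₀ : Fin (N + 1) → k := fun j => v (.inr j)
    have hf₀ : f₀ ≠ 0 := by
      intro h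
      have h1 : ∀ j, v (.inl j) = 0 := fun j => congrFun h j
      simp [h1] at hv1
    have he₀ : e₀ ∉ Submodule.span k {f₀} := by
      intro h
      obtain ⟨t, ht⟩ := Submodule.mem_span_singleton.1 h
      have h1 : ∀ j, v (.inr j) = t * v (.inl j) := fun j => (congrFun ht j).symm
      apply hv1
      rw [h1, h1]; ring
    let W := Submodule.span k {f₀} ⊔ Submodule.span k {e₀}
    have hW2 : finrank k W = 2 := by
      rw [finrank_sup_span _ he₀, finrank_span_singleton hf₀]
    obtain ⟨μ, ν, hμν⟩ : ∃ μ ν : F, dv δ₀ e = μ • f + ν • e := by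
      obtain ⟨y, hy, z, hz, h⟩ := Submodule.mem_sup.1 hst
      obtain ⟨a, rfl⟩ := Submodule.mem_span_singleton.1 hy
      obtain ⟨b, rfl⟩ := Submodule.mem_span_singleton.1 hz
      exact ⟨a, b, h.symm⟩
    have hline : ∀ h ∈ Van Y, ∀ d, h.IsHomogeneous d → ∀ α β : k,
        eval (fun j => α * f₀ j + β * e₀ j) h = 0 := by
      intro h hh d hd
      have hne : ∀ α β : k, α ≠ 0 → eval (fun j => α * f₀ j + β * e₀ j) h = 0 := by
        intro α β hα
        let G : MvPolynomial (Fin (N + 1) ⊕ Fin (N + 1)) k :=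
          aeval (fun j => MvPolynomial.C α * X (.inl j) + MvPolynomial.C β * X (.inr j)) h
        have h1 : aeval a G = 0 := by
          have h2 := aeval_line_eq_zero δ₀ f e μ ν he_def.symm hμν hd (hfY h hh)
            (algebraMap k F α) (algebraMap k F β) ((map_ne_zero _).2 hα)
          rw [← h2, ← AlgHom.comp_apply]
          congr 1
          ext j; simp [a]
        have h3 := hva G h1
        rw [← h3, ← coe_aeval_eq_eval, ← coe_aeval_eq_eval, RingHom.coe_coe, RingHom.coe_coe,
          ← AlgHom.comp_apply]
        congr 1
        ext j; simp [f₀, e₀]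
      intro α β
      by_cases hα : α = 0
      · let T : Polynomial k := aeval (fun j => Polynomial.X * Polynomial.C (f₀ j) +
          Polynomial.C (β * e₀ j)) h
        have hT : ∀ t, T.eval t = eval (fun j => t * f₀ j + β * e₀ j) h := by
          intro t
          have : (Polynomial.aeval t).comp (aeval (fun j => Polynomial.X * Polynomial.C (f₀ j) +
              Polynomial.C (β * e₀ j)) : MvPolynomial (Fin (N + 1)) k →ₐ[k] Polynomial k) =
              aeval (fun j => t * f₀ j + β * e₀ j) := by
            ext j; simp; ring
          rw [← coe_aeval_eq_eval, RingHom.coe_coe, ← this]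
          rw [AlgHom.comp_apply, ← Polynomial.coe_aeval_eq_eval]
        have h0 : T * Polynomial.X = 0 := by
          apply Polynomial.funext
          intro t
          by_cases ht : t = 0
          · simp [ht]
          · simp [hT, hne t β ht]
        have h1 : T = 0 := (mul_eq_zero.1 h0).resolve_right Polynomial.X_ne_zero
        rw [hα, ← hT, h1, Polynomial.eval_zero]
      · exact hne α β hα
    have hWY : {p : Pr k N | Projectivization.submodule p ≤ W} ⊆ Y := by
      intro p hp
      have h1 : p.rep ∈ W := by
        apply hp
        rw [Projectivization.submodule_eq]
        exact Submodule.mem_span_singleton_self _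
      obtain ⟨y, hy, z, hz, hyz⟩ := Submodule.mem_sup.1 h1
      obtain ⟨α, rfl⟩ := Submodule.mem_span_singleton.1 hy
      obtain ⟨β, rfl⟩ := Submodule.mem_span_singleton.1 hz
      rw [← p.mk_rep]
      refine mem_of_Van hY _ fun h hh => ?_
      rw [← sum_homogeneousComponent h, map_sum]
      refine Finset.sum_eq_zero fun d _ => ?_
      rw [← hyz]
      exact hline _ (homogeneousComponent_mem_Van hh d) d (homogeneousComponent_isHomogeneous d h) α β
    apply hv2 W (hfin.mem_toFinset.2 ⟨hW2, hWY⟩)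
    exact hc1 W ⟨hW2, hWY⟩ f₀ (Submodule.mem_sup_left (Submodule.mem_span_singleton_self _))

end Lines

section Tangency

variable {k : Type} [Field k] [IsAlgClosed k] [CharZero k] {M N : ℕ}
  {X : Set (Pr k M)} {φ : Pr k M → Pr k N}

lemma AVan_univ {σ : Type} : AVan (univ : Set (σ → k)) = ⊥ := by
  rw [eq_bot_iff]
  intro f hf
  rw [Ideal.mem_bot]
  exact MvPolynomial.funext fun v => by rw [map_zero]; exact hf v trivial

lemma unit_of_forall_ne_zero {T F : Type} [Field F] [Algebra k F] (ι : (T → k) →ₐ[k] F) (f : T → k)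
    (hf : ∀ t, f t ≠ 0) : ι f ≠ 0 := by
  intro h0
  have : ι f * ι (fun t => (f t)⁻¹) = 1 := by
    rw [← map_mul, ← map_one ι]
    congr 1; ext t; exact mul_inv_cancel₀ (hf t)
  rw [h0, zero_mul] at this
  exact zero_ne_one this

/-- A general tangent plane contains few image points, in one affine coordinate of the source. -/
lemma MapChart.gen_finite_coord (C : MapChart X φ) (hN : 4 ≤ N) (hX : IsVariety X)
    (hΔ : C.Δ ∉ Van X) (hφ : IsMorphismOn X φ) (hnd : Nondegenerate (φ '' X))
    (hnr : ¬ RuledByLines (φ '' X)) (l m : Fin (M + 1)) :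
    Gen X fun x => {s | ∃ p ∈ cone X, eval p C.Δ ≠ 0 ∧ p l ≠ 0 ∧ s = p m / p l ∧
      (fun j => eval x (C.Φ j)) ∈ Sp (Van X) C.Φ p}.Finite := by
  by_contra hcon
  rw [not_gen_iff] at hcon
  have hp := Van_isPrime hX
  have hpA : (AVan (cone X)).IsPrime := hp
  have hpu : (AVan (univ : Set (Unit → k))).IsPrime := by
    rw [AVan_univ]; exact Ideal.isPrime_bot
  have hpp := AVan_vprod_isPrime hpA hpu
  let V := Fin (M + 1) → k
  let T := {t : (V × V) × (Fin 3 → k) // t.1.1 ∈ cone X ∧ t.1.2 ∈ cone X ∧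
    eval t.1.2 C.Δ ≠ 0 ∧ t.1.2 l ≠ 0 ∧
    ∀ j, eval t.1.1 (C.Φ j) = ∑ i, t.2 i * eval t.1.2 (C.D i (C.Φ j))}
  obtain ⟨F, _, _, ι, hι⟩ := exists_generic (T := T)
    (fun t => Sum.elim t.1.1.1 (fun _ : Unit => t.1.1.2 m / t.1.1.2 l))
    (AVan (vprod (cone X) univ)) (by
      intro g hg
      obtain ⟨x, hx, w, hw, hne⟩ := exists_eval_ne_zero hpA _ hcon
        (fun x => {w : Unit → k | w () ∈ {s | ∃ p ∈ cone X, eval p C.Δ ≠ 0 ∧ p l ≠ 0 ∧ s = p m / p l ∧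
      (fun j => eval x (C.Φ j)) ∈ Sp (Van X) C.Φ p}}) (by
        intro x hx g hg
        by_contra! h
        apply hg
        rw [AVan_univ, Ideal.mem_bot]
        refine MvPolynomial.funext_set (fun _ => _) (fun _ => hx.2) fun w hw => ?_
        rw [map_zero]
        exact h w (hw () trivial)) hg (fun v hv => hv.1)
      obtain ⟨p, hp, hpΔ, hpl, hws, hS⟩ := hw
      rw [C.Sp_eq_span (F := k) (fun f hf => hf p hp) hpΔ, Submodule.mem_span_range_iff_exists_fun] at hS
      obtain ⟨c, hc⟩ := hS
      refine ⟨⟨((x, p), c), hx.1, hp, hpΔ, hpl, fun j => ?_⟩, ?_⟩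
      · have := congrFun hc j
        simpa using this.symm
      · have : w = fun _ => p m / p l := by ext; exact hws
        rw [this] at hne; exact hne)
  set x : Fin (M + 1) → F := fun j => ι fun t => t.1.1.1 j with hx
  set p : Fin (M + 1) → F := fun j => ι fun t => t.1.1.2 j with hp_def
  set s : Unit → F := fun _ => ι fun t => t.1.1.2 m / t.1.1.2 l with hs
  have hι' : ∀ g, aeval (Sum.elim x s) g = 0 → g ∈ AVan (vprod (cone X) univ) := by
    intro g hg
    by_contra hne
    apply hι g hne
    rw [← hg]
    congr 2
    funext j; rcases j with j | j <;> rfl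
  have hVx : ∀ f ∈ Van X, aeval x f = 0 := fun f hf => by
    rw [hx, ← algHom_eval ι (fun t : T => t.1.1.1), ← map_zero ι]
    congr 1; ext t; exact hf _ t.2.1
  have hVp : ∀ f ∈ Van X, aeval p f = 0 := fun f hf => by
    rw [hp_def, ← algHom_eval ι (fun t : T => t.1.1.2), ← map_zero ι]
    congr 1; ext t; exact hf _ t.2.2.1
  have hpΔ : aeval p C.Δ ≠ 0 := by
    rw [hp_def, ← algHom_eval ι (fun t : T => t.1.1.2)]
    exact unit_of_forall_ne_zero ι _ fun t => t.2.2.2.1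
  have hpl : p l ≠ 0 := unit_of_forall_ne_zero ι _ fun t => t.2.2.2.2.1
  have hsp : s () = p m / p l := by
    rw [eq_div_iff hpl, hs, hp_def, ← map_mul]
    congr 1; ext t; exact div_mul_cancel₀ _ t.2.2.2.2.1
  have hgx : ∀ f, aeval x f = 0 → f ∈ Van X := by
    intro f hf v hv
    have := hι' (rename Sum.inl f) (by rw [aeval_rename]; exact hf) _ ⟨v, hv, 0, trivial, rfl⟩
    rw [eval_rename] at this; exact this
  have hxΔ : aeval x C.Δ ≠ 0 := fun h => hΔ (hgx _ h)
  have hgS : (fun j => aeval x (C.Φ j)) ∈ Sp (Van X) C.Φ p := by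
    rw [C.Sp_eq_span hVp hpΔ, Submodule.mem_span_range_iff_exists_fun]
    refine ⟨fun i => ι fun t => t.1.2 i, ?_⟩
    ext j
    simp only [Finset.sum_apply, Pi.smul_apply, smul_eq_mul]
    rw [hx, hp_def, ← algHom_eval ι (fun t : T => t.1.1.1)]
    simp_rw [← algHom_eval ι (fun t : T => t.1.1.2), ← map_mul, ← map_sum]
    congr 1; ext t
    simp only [Finset.sum_apply, Pi.mul_apply]
    exact (t.2.2.2.2.2 j).symm
  set p' : Fin (M + 1) → F := fun j => (p l)⁻¹ * p j with hp'
  have hSp' : Sp (Van X) C.Φ p' = Sp (Van X) C.Φ p := Sp_smul X C.hom p (inv_ne_zero hpl)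
  set f : Fin (N + 1) → F := fun j => aeval p (C.Φ j) with hf
  let Dp : Submodule F (Derivation k F F) :=
    { carrier := {δ | ∀ j, δ (p' j) = 0}
      zero_mem' := fun j => rfl
      add_mem' := fun ha hb j => by simp [ha j, hb j]
      smul_mem' := fun c δ h j => by simp [h j] }
  have hdeg : (C.deg : F) ≠ 0 := by
    have : CharZero F := charZero_of_injective_algebraMap (algebraMap k F).injective
    exact Nat.cast_ne_zero.2 (C.deg_ne_zero hpΔ)
  have hDp : ∀ δ : Derivation k F F, dv δ f ∈ Submodule.span F {f} → δ ∈ Dp := by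
    intro δ hδ
    obtain ⟨c, hc⟩ := Submodule.mem_span_singleton.1 hδ
    have h1 : dmap C.Φ p ((fun j => δ (p j)) - (c / C.deg) • p) = 0 := by
      rw [map_sub, map_smul, sub_eq_zero]
      ext j
      have := congrFun hc j
      rw [dmap_apply, Pi.smul_apply, dmap_apply, ← derivation_aeval, dd_self (C.hom j)]
      simp only [Pi.smul_apply, smul_eq_mul, dv, hf] at this ⊢
      rw [← this]; field_simp
    have h2 := C.dmap_injOn hpΔ (sub_mem (derivation_mem_Tg hVp δ)
      (Submodule.smul_mem _ _ (self_mem_Tg hVp))) h1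
    have h3 : ∀ j, δ (p j) = c / C.deg * p j := fun j => by
      have := congrFun h2 j
      simpa [sub_eq_zero] using this
    intro j
    rw [hp']
    simp only [Derivation.leibniz, smul_eq_mul, Derivation.leibniz_inv, h3]
    field_simp
    ring
  obtain ⟨δ₀, hδ₀x, hδ₀s⟩ := exists_derivation_right x s hVx hι' (fun _ => 1) (by
    intro f hf
    rw [AVan_univ, Ideal.mem_bot] at hf
    rw [hf]; simp [dd])
  have hδ₀ : δ₀ ∉ Dp := by
    intro h
    have h1 := hδ₀s ()
    rw [hsp, div_eq_inv_mul] at h1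
    exact zero_ne_one ((h m).symm.trans h1)
  obtain ⟨hst, δ, hδ⟩ := plane_stable Dp δ₀ (Sp (Van X) C.Φ p) (Sp (Van X) C.Φ x) f
    (fun j => aeval x (C.Φ j)) (by simp; omega) (C.finrank_Sp hVp hpΔ) (C.finrank_Sp hVx hxΔ)
    (C.eval_mem_Sp hVp hpΔ) (derivation_mem_Sp hVp)
    (fun η hη u hu => by rw [← hSp'] at hu ⊢; exact Sp_stable η hη hu) hDp hgS
    (C.eval_mem_Sp hVx hxΔ) (derivation_mem_Sp hVx) (by
      rintro _ ⟨c, hc, rfl⟩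
      obtain ⟨δ, h⟩ := exists_derivation x c fun f hf => hc f (hgx f hf)
      refine ⟨δ, ?_⟩
      ext j
      rw [dmap_apply, dv, derivation_aeval]; simp only [h])
    (by ext j; rw [dv, derivation_aeval]; simp [hδ₀x, dd])
    (fun u hu => Sp_stable δ₀ hδ₀x hu) hδ₀
    (fun U hgU hU => C.eq_top_of_stable hp hΔ hφ hnd hgx U hU hgU)
  refine hδ (derivation_mem_plane (isAlgSet_image hX.1 hφ) hnr f (C.ne F p hpΔ) ?_ δ₀
    (fun h => hδ₀ (hDp _ h)) hst δ)
  intro h hh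
  have h1 : aeval f h = aeval p (aeval C.Φ h) := by
    rw [← AlgHom.comp_apply]; congr 1; ext j; simp [hf]
  rw [h1, hp_def, ← algHom_eval ι (fun t : T => t.1.1.2), ← map_zero ι]
  congr 1; ext t
  have h2 : eval t.1.1.2 (aeval C.Φ h) = eval (fun j => eval t.1.1.2 (C.Φ j)) h := by
    rw [← coe_aeval_eq_eval, ← coe_aeval_eq_eval, RingHom.coe_coe, RingHom.coe_coe,
      ← AlgHom.comp_apply]
    congr 1
    ext j; simp
  rw [h2]
  have h3 := C.ne k t.1.1.2 t.2.2.2.1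
  obtain ⟨h4, h5⟩ := t.2.2.1
  exact hh _ ⟨h3, ⟨_, h5, C.rep _ h4 h5 h3⟩⟩

lemma Gen.mono {P Q : (Fin (M + 1) → k) → Prop} (hP : Gen X P) (h : ∀ v ∈ cone X, P v → Q v) :
    Gen X Q := by
  obtain ⟨g, hg, h1⟩ := hP
  exact ⟨g, hg, fun v hv hne => h v hv (h1 v hv hne)⟩

lemma Gen.forall {ι : Type} [Finite ι] (hp : (Van X).IsPrime) {P : ι → (Fin (M + 1) → k) → Prop}
    (h : ∀ i, Gen X (P i)) : Gen X fun v => ∀ i, P i v := by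
  cases nonempty_fintype ι
  choose g hg h using h
  refine ⟨∏ i, g i, fun hm => ?_, fun v hv hne i => ?_⟩
  · obtain ⟨i, -, hi⟩ := hp.prod_mem_iff.1 hm
    exact hg i hi
  · rw [map_prod, Finset.prod_ne_zero_iff] at hne
    exact h i v hv (hne i (Finset.mem_univ i))

/-- A general tangent plane contains few image points. -/
lemma MapChart.gen_finite (C : MapChart X φ) (hN : 4 ≤ N) (hX : IsVariety X)
    (hΔ : C.Δ ∉ Van X) (hφ : IsMorphismOn X φ) (hnd : Nondegenerate (φ '' X))
    (hnr : ¬ RuledByLines (φ '' X)) :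
    Gen X fun x => {p | p ∈ X ∧ eval p.rep C.Δ ≠ 0 ∧
      (fun j => eval x (C.Φ j)) ∈ Sp (Van X) C.Φ p.rep}.Finite := by
  have hp := Van_isPrime hX
  refine (Gen.forall hp fun l => Gen.forall hp fun m =>
    C.gen_finite_coord hN hX hΔ hφ hnd hnr l m).mono fun x hx hfin => ?_
  set S := {p : Pr k M | p ∈ X ∧ eval p.rep C.Δ ≠ 0 ∧
      (fun j => eval x (C.Φ j)) ∈ Sp (Van X) C.Φ p.rep} with hS
  have hsub : S ⊆ ⋃ l, {p ∈ S | p.rep l ≠ 0} := by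
    intro p hp
    obtain ⟨l, hl⟩ := Function.ne_iff.1 p.rep_nonzero
    exact mem_iUnion.2 ⟨l, hp, hl⟩
  refine (Set.finite_iUnion fun l => ?_).subset hsub
  refine Set.Finite.of_finite_image (f := fun (p : Pr k M) m => p.rep m / p.rep l)
    ((Set.Finite.pi' fun m => hfin l m).subset ?_) ?_
  · rintro _ ⟨p, ⟨⟨hpX, hpΔ, hps⟩, hpl⟩, rfl⟩ m
    exact ⟨p.rep, rep_mem_cone hpX, hpΔ, hpl, rfl, hps⟩
  · rintro p ⟨-, hpl⟩ q ⟨-, hql⟩ h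
    rw [← p.mk_rep, ← q.mk_rep, Projectivization.mk_eq_mk_iff']
    refine ⟨p.rep l / q.rep l, ?_⟩
    ext m
    have := congrFun h m
    simp only [Pi.smul_apply, smul_eq_mul] at this ⊢
    field_simp at this ⊢
    rw [← this]

lemma exists_finite_charts (hX : IsSmoothSurface X) :
    ∃ s : Finset (MapChart X φ), ∀ p ∈ X, ¬ RamifiedAt X φ p → ∃ C ∈ s, eval p.rep C.Δ ≠ 0 := by
  classical
  obtain ⟨t, hts, ht⟩ := (Submodule.fg_span_iff_fg_span_finset_subset
    (R := MvPolynomial (Fin (M + 1)) k) (range fun C : MapChart X φ => C.Δ)).1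
    (IsNoetherian.noetherian _)
  obtain ⟨s, -, hs⟩ := Finset.subset_set_image_iff.1 (by rwa [← image_univ] at hts)
  refine ⟨s, fun p hp hram => ?_⟩
  obtain ⟨C, hC⟩ := exists_mapChart hX hp hram
  by_contra! hcon
  have hle : Submodule.span (MvPolynomial (Fin (M + 1)) k) (t : Set (MvPolynomial (Fin (M + 1)) k)) ≤
      RingHom.ker (eval p.rep) := by
    rw [Submodule.span_le]
    intro f hf
    rw [← hs, Finset.coe_image] at hf
    obtain ⟨C', hC', rfl⟩ := hf
    exact hcon C' hC'
  rw [← ht] at hle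
  exact hC (hle (Submodule.subset_span ⟨C, rfl⟩))

/-- A finite family of charts which covers the unramified locus, and in which a general tangent
plane contains few image points. -/
lemma exists_charts_gen_finite (hN : 4 ≤ N) (hX : IsSmoothSurface X) (hφ : IsMorphismOn X φ)
    (hnd : Nondegenerate (φ '' X)) (hnr : ¬ RuledByLines (φ '' X)) :
    ∃ s : Finset (MapChart X φ), (∀ p ∈ X, ¬ RamifiedAt X φ p → ∃ C ∈ s, eval p.rep C.Δ ≠ 0) ∧
      Gen X fun x => ∀ C ∈ s, C.Δ ∉ Van X → eval x C.Δ ≠ 0 ∧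
        {p | p ∈ X ∧ eval p.rep C.Δ ≠ 0 ∧
          (fun j => eval x (C.Φ j)) ∈ Sp (Van X) C.Φ p.rep}.Finite := by
  have hp := Van_isPrime hX.1
  obtain ⟨s, hs⟩ := exists_finite_charts (φ := φ) hX
  refine ⟨s, hs, ?_⟩
  have : Gen X fun x => ∀ C : {C : MapChart X φ // C ∈ s}, C.1.Δ ∉ Van X → eval x C.1.Δ ≠ 0 ∧
        {p | p ∈ X ∧ eval p.rep C.1.Δ ≠ 0 ∧
          (fun j => eval x (C.1.Φ j)) ∈ Sp (Van X) C.1.Φ p.rep}.Finite := by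
    refine Gen.forall hp fun C => ?_
    by_cases hΔ : C.1.Δ ∈ Van X
    · exact ⟨1, (Ideal.ne_top_iff_one _).1 hp.ne_top, fun v _ _ h => absurd hΔ h⟩
    · exact (Gen.and hp ⟨C.1.Δ, hΔ, fun v _ h => h⟩
        (C.1.gen_finite hN hX.1 hΔ hφ hnd hnr)).mono fun v _ h _ => h
  exact this.mono fun v _ h C hC => h ⟨C, hC⟩

end Tangency

section TwoHoms

/-- An element outside a subfield is moved by some pair of embeddings which agree on the subfield. -/
lemma exists_adjoin_algHom_ne {K0 K : Type} [Field K0] [CharZero K0] [Field K] [Algebra K0 K] (u : K)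
    (hu : u ∉ (⊥ : IntermediateField K0 K)) :
    ∃ j : IntermediateField.adjoin K0 {u} →ₐ[K0] AlgebraicClosure K,
      j (IntermediateField.AdjoinSimple.gen K0 u) ≠ algebraMap K (AlgebraicClosure K) u := by
  classical
  by_cases h : IsIntegral K0 u
  · by_contra! hcon
    have hs : ((minpoly K0 u).aroots (AlgebraicClosure K)).toFinset.card = (minpoly K0 u).natDegree := by
      rw [Multiset.toFinset_card_of_nodup]
      · have h0 := Polynomial.splits_iff_card_roots.1
          (IsAlgClosed.splits ((minpoly K0 u).map (algebraMap K0 (AlgebraicClosure K))))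
        rwa [Polynomial.natDegree_map] at h0
      · exact Polynomial.nodup_aroots_iff_of_splits (minpoly.ne_zero h) (IsAlgClosed.splits _) |>.2
          (minpoly.irreducible h).separable
    have h1 : ((minpoly K0 u).aroots (AlgebraicClosure K)).toFinset ⊆
        {algebraMap K (AlgebraicClosure K) u} := by
      intro r hr
      rw [Multiset.mem_toFinset] at hr
      have := hcon ((IntermediateField.algHomAdjoinIntegralEquiv K0 h).symm ⟨r, hr⟩)
      rw [IntermediateField.algHomAdjoinIntegralEquiv_symm_apply_gen] at this
      simpa using this
    have h2 := Finset.card_le_card h1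
    rw [hs, Finset.card_singleton] at h2
    have h3 : (minpoly K0 u).natDegree = 1 := le_antisymm h2 (minpoly.natDegree_pos h)
    rw [minpoly.natDegree_eq_one_iff] at h3
    exact hu h3
  · have ht : Transcendental K0 u := fun h' => h h'.isIntegral
    have ht' : Transcendental K0 (u + 1) := by
      intro h'
      exact ht (by simpa using h'.sub (isAlgebraic_one (R := K0) (A := K)))
    let e1 := RatFunc.algEquivOfTranscendental u ht
    let e2 := RatFunc.algEquivOfTranscendental (u + 1) ht'
    refine ⟨((IsScalarTower.toAlgHom K0 K (AlgebraicClosure K)).comp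
      ((IntermediateField.val _).comp e2.toAlgHom)).comp e1.symm.toAlgHom, ?_⟩
    have h1 : e1.symm (IntermediateField.AdjoinSimple.gen K0 u) = RatFunc.X := by
      rw [AlgEquiv.symm_apply_eq]
      exact Subtype.ext (RatFunc.algEquivOfTranscendental_X u ht).symm
    simp [h1, e2]

open TensorProduct in
/-- Two embeddings of a field into a common one can be amalgamated. -/
lemma exists_amalgam {E K Ω₀ : Type} [Field E] [Field K] [Field Ω₀] [Algebra E K] [Algebra E Ω₀] :
    ∃ (Ω : Type) (_ : Field Ω) (i : Ω₀ →+* Ω) (l : K →+* Ω),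
      ∀ e : E, l (algebraMap E K e) = i (algebraMap E Ω₀ e) := by
  obtain ⟨m, hm⟩ := Ideal.exists_maximal (Ω₀ ⊗[E] K)
  letI : Field ((Ω₀ ⊗[E] K) ⧸ m) := Ideal.Quotient.field m
  let q : Ω₀ ⊗[E] K →+* (Ω₀ ⊗[E] K) ⧸ m := Ideal.Quotient.mk m
  refine ⟨_, inferInstance, q.comp (Algebra.TensorProduct.includeLeftRingHom),
    q.comp (Algebra.TensorProduct.includeRight (R := E) (A := Ω₀) (B := K)).toRingHom, fun e => ?_⟩
  change q (1 ⊗ₜ algebraMap E K e) = q (algebraMap E Ω₀ e ⊗ₜ 1)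
  rw [Algebra.TensorProduct.tmul_one_eq_one_tmul]

lemma exists_two_homs {k K : Type} [Field k] [CharZero k] [Field K] [Algebra k K]
    (K0 : IntermediateField k K) (u : K) (hu : u ∉ K0) :
    ∃ (Ω : Type) (_ : Field Ω) (_ : Algebra k Ω) (σ τ : K →ₐ[k] Ω),
      (∀ c ∈ K0, σ c = τ c) ∧ σ u ≠ τ u := by
  have : CharZero K0 := charZero_of_injective_algebraMap (algebraMap k K0).injective
  obtain ⟨j, hj⟩ := exists_adjoin_algHom_ne (K0 := K0) u (by
    rw [IntermediateField.mem_bot]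
    rintro ⟨y, rfl⟩
    exact hu y.2)
  obtain ⟨Ω, _, i, l, hil⟩ := @exists_amalgam (IntermediateField.adjoin K0 {u}) K (AlgebraicClosure K)
    _ _ _ _ j.toRingHom.toAlgebra
  have key : ∀ e : IntermediateField.adjoin K0 {u}, l e = i (j e) := hil
  let i₁ : K →+* Ω := i.comp (algebraMap K (AlgebraicClosure K))
  have hK0 : ∀ c : K0, i₁ (c : K) = l (c : K) := by
    intro c
    have h1 := key (algebraMap K0 _ c)
    rw [j.commutes] at h1
    exact h1.symm
  letI : Algebra k Ω := (i₁.comp (algebraMap k K)).toAlgebra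
  refine ⟨Ω, inferInstance, inferInstance, { i₁ with commutes' := fun _ => rfl },
    { l with commutes' := fun r => (hK0 (algebraMap k K0 r)).symm }, fun c hc => hK0 ⟨c, hc⟩, ?_⟩
  intro h
  exact hj (i.injective ((key (IntermediateField.AdjoinSimple.gen K0 u)).symm.trans h.symm))

end TwoHoms

section Inverse

variable {k : Type} [Field k] {M M' : ℕ}

/-- A homogeneous representation of `β` together with a hypersurface containing the fibre over `x`
outside of which it is valid. -/
structure OffChart (Xt : Set (Pr k M')) (β : Pr k M' → Pr k M) (x : Pr k M) where
  B : Fin (M + 1) → MvPolynomial (Fin (M' + 1)) k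
  E : MvPolynomial (Fin (M' + 1)) k
  e : ℕ
  e_ne : e ≠ 0
  hom : ∀ i, (B i).IsHomogeneous e
  E_notMem : E ∉ Van Xt
  rep : ∀ (v : Fin (M' + 1) → k) (hv : v ≠ 0), Projectivization.mk k v hv ∈ Xt →
    ∀ h : (fun i => eval v (B i)) ≠ 0,
      β (Projectivization.mk k v hv) = Projectivization.mk k (fun i => eval v (B i)) h
  ne : ∀ v, eval v E ≠ 0 → (fun i => eval v (B i)) ≠ 0
  off : ∀ (v : Fin (M' + 1) → k) (hv : v ≠ 0), Projectivization.mk k v hv ∈ Xt → eval v E ≠ 0 →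
    β (Projectivization.mk k v hv) ≠ x

variable {X : Set (Pr k M)} {Xt : Set (Pr k M')} {β : Pr k M' → Pr k M} {x : Pr k M}

lemma exists_mul_ne_of_mk_ne {n : Type} {u w : n → k} {hu : u ≠ 0} {hw : w ≠ 0}
    (h : Projectivization.mk k u hu ≠ Projectivization.mk k w hw) : ∃ i j, u i * w j ≠ u j * w i := by
  by_contra! hcon
  apply h
  rw [Projectivization.mk_eq_mk_iff']
  obtain ⟨j, hj⟩ := Function.ne_iff.1 hw
  have hj : w j ≠ 0 := hj
  refine ⟨u j / w j, ?_⟩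
  ext i
  simp only [Pi.smul_apply, smul_eq_mul]
  have := hcon i j
  field_simp
  linear_combination -this

lemma exists_offChart (hb : IsBlowupAt Xt X β x) : Nonempty (OffChart Xt β x) := by
  obtain ⟨hx, hXt, hd2, hβ, him, hinj, hE, hd1, -⟩ := hb
  obtain ⟨q0, hq0, hne⟩ : ∃ q ∈ Xt, β q ≠ x := by
    by_contra! hcon
    have : ExcFiber Xt β x = Xt := by
      ext q; exact ⟨fun h => h.1, fun h => ⟨h, hcon q h⟩⟩
    rw [this] at hd1
    have h := hd1.symm.trans hd2
    norm_cast at h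
  obtain ⟨B, ⟨e, hom⟩, hB0, hrep⟩ := hβ q0 hq0
  have h1 := hrep q0 hq0 q0.rep q0.rep_nonzero q0.mk_rep hB0
  have h2 : Projectivization.mk k _ hB0 ≠ Projectivization.mk k _ x.rep_nonzero := by
    rw [← h1, x.mk_rep]; exact hne
  obtain ⟨i, j, hij⟩ := exists_mul_ne_of_mk_ne h2
  have hev : ∀ v, eval v (B i * MvPolynomial.C (x.rep j) - B j * MvPolynomial.C (x.rep i)) =
      eval v (B i) * x.rep j - eval v (B j) * x.rep i := fun v => by simp
  refine ⟨⟨B, B i * MvPolynomial.C (x.rep j) - B j * MvPolynomial.C (x.rep i), e, ?_, hom, ?_,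
    fun v hv hvX h => hrep _ hvX v hv rfl h, ?_, ?_⟩⟩
  · rintro rfl
    have hc : ∀ l v w, eval v (B l) = eval w (B l) := by
      intro l v w
      rw [totalDegree_eq_zero_iff_eq_C.1 ((totalDegree_zero_iff_isHomogeneous _).2 (hom l))]
      simp
    rw [← him] at hx
    obtain ⟨q, hq, hqx⟩ := hx
    have h3 : (fun l => eval q.rep (B l)) = fun l => eval q0.rep (B l) := by
      ext l; exact hc l _ _
    have h4 := hrep q hq q.rep q.rep_nonzero q.mk_rep (by rw [h3]; exact hB0)
    apply hne
    rw [← hqx, h4, h1]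
    simp only [h3]
  · intro hm
    have := hm _ (rep_mem_cone hq0)
    rw [hev] at this
    exact hij (sub_eq_zero.1 this)
  · intro v hv h0
    apply hv
    have : ∀ l, eval v (B l) = 0 := fun l => congrFun h0 l
    rw [hev, this, this]; ring
  · intro v hv hvX hne2 hx2
    have h0 : (fun i => eval v (B i)) ≠ 0 := by
      intro h0
      apply hne2
      have : ∀ l, eval v (B l) = 0 := fun l => congrFun h0 l
      rw [hev, this, this]; ring
    have h3 := hrep _ hvX v hv rfl h0
    rw [hx2, ← x.mk_rep] at h3
    apply hne2
    rw [hev]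
    have := mul_eq_mul_of_mk_eq h3.symm i j
    linear_combination this

lemma eval_aeval_eq {σ τ : Type} (v : τ → k) (B : σ → MvPolynomial τ k) (f : MvPolynomial σ k) :
    eval v (aeval B f) = eval (fun i => eval v (B i)) f := by
  induction f using MvPolynomial.induction_on with
  | C a => simp
  | add p q hp hq => rw [map_add, map_add, map_add, hp, hq]
  | mul_X p i hp => rw [map_mul, map_mul, map_mul, hp]; simp

namespace OffChart

variable (C : OffChart Xt β x)

lemma mem_cone (him : β '' Xt = X) {v : Fin (M' + 1) → k} (hv : v ∈ cone Xt) (hE : eval v C.E ≠ 0) :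
    (fun i => eval v (C.B i)) ∈ cone X := by
  refine ⟨C.ne v hE, ?_⟩
  rw [← C.rep v hv.1 hv.2 (C.ne v hE), ← him]
  exact ⟨_, hv.2, rfl⟩

lemma comp_mem (hp : (Van Xt).IsPrime) (him : β '' Xt = X) {f : MvPolynomial (Fin (M + 1)) k}
    (hf : f ∈ Van X) : aeval C.B f ∈ Van Xt := by
  refine (hp.mem_or_mem (x := C.E) fun v hv => ?_).resolve_left C.E_notMem
  by_cases h1 : eval v C.E = 0
  · simp [h1]
  rw [map_mul, eval_aeval_eq, hf _ (C.mem_cone him hv h1), mul_zero]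

lemma mul_sub_mul_mem {F' : Fin (M + 1) → MvPolynomial (Fin (M' + 1)) k} {q : Pr k M'}
    (hp : (Van Xt).IsPrime) (hF : LocalRep Xt β q F') (i j : Fin (M + 1)) :
    F' i * C.B j - F' j * C.B i ∈ Van Xt := by
  refine (hp.mem_or_mem (x := C.E) fun v hv => ?_).resolve_left C.E_notMem
  by_cases h1 : eval v C.E = 0
  · simp [h1]
  by_cases h2 : (fun j => eval v (F' j)) = 0
  · have h3 : ∀ j, eval v (F' j) = 0 := fun j => congrFun h2 j
    simp [h3]
  · obtain ⟨hv0, hvX⟩ := hv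
    have := mul_eq_mul_of_mk_eq ((hF.2.2 _ hvX v hv0 rfl h2).symm.trans
      (C.rep v hv0 hvX (C.ne v h1))) i j
    simp [this]

lemma exists_B_notMem : ∃ i, C.B i ∉ Van Xt := by
  by_contra! hcon
  have hE := C.E_notMem
  simp only [mem_Van, not_forall] at hE
  obtain ⟨v, hv, hne⟩ := hE
  exact C.ne v hne (by ext j; exact hcon j v hv)

lemma mem_of_comp_mem [IsAlgClosed k] (hp : (Van Xt).IsPrime) (hβ : IsMorphismOn Xt β)
    (him : β '' Xt = X) {f : MvPolynomial (Fin (M + 1)) k} (hf : aeval C.B f ∈ Van Xt) : f ∈ Van X := by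
  have hinf : Infinite k := IsAlgClosed.instInfinite
  have hcomp : ∀ d, aeval C.B (homogeneousComponent d f) ∈ Van Xt := by
    intro d v hv
    rw [eval_aeval_eq]
    refine eval_homogeneousComponent_eq_zero (fun t ht => ?_) d
    obtain ⟨s, rfl⟩ := IsAlgClosed.exists_pow_nat_eq t (Nat.pos_of_ne_zero C.e_ne)
    have hs : s ≠ 0 := by rintro rfl; simp [C.e_ne] at ht
    have := hf _ (smul_mem_cone hv hs)
    rw [eval_aeval_eq] at this
    simpa only [eval_mul_of_isHomogeneous (C.hom _)] using this
  rw [← sum_homogeneousComponent f]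
  refine Ideal.sum_mem _ fun d _ => ?_
  rw [mem_Van_iff_of_isHomogeneous (homogeneousComponent_isHomogeneous d f)]
  intro p hpX
  rw [← him] at hpX
  obtain ⟨q, hq, rfl⟩ := hpX
  obtain ⟨F', ⟨d', hF'⟩, h0, hrep⟩ := hβ q hq
  have hrel := C.mul_sub_mul_mem hp (F' := F') (q := q) ⟨⟨d', hF'⟩, h0, hrep⟩
  rw [hrep q hq q.rep q.rep_nonzero q.mk_rep h0,
    vanishes_iff (homogeneousComponent_isHomogeneous d f)]
  obtain ⟨i, hi⟩ := C.exists_B_notMem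
  have h1 : (C.B i) ^ d * aeval F' (homogeneousComponent d f) ∈ Van Xt := by
    intro v hv
    rw [map_mul, map_pow, eval_aeval_eq,
      ← eval_mul_of_isHomogeneous (homogeneousComponent_isHomogeneous d f)]
    have h2 : (fun j => eval v (C.B i) * eval v (F' j)) =
        fun j => eval v (F' i) * eval v (C.B j) := by
      ext j
      have := hrel i j v hv
      simp only [map_sub, map_mul] at this
      linear_combination -this
    rw [h2, eval_mul_of_isHomogeneous (homogeneousComponent_isHomogeneous d f), ← eval_aeval_eq,
      hcomp d v hv, mul_zero]
  have h2 := (hp.mem_or_mem h1).resolve_left fun h => hi (hp.mem_of_pow_mem _ h)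
  rw [← eval_aeval_eq]
  exact h2 _ (rep_mem_cone hq)

end OffChart

end Inverse

section Inverse

variable {k : Type} [Field k] [IsAlgClosed k] {M M' : ℕ}
variable {X : Set (Pr k M)} {Xt : Set (Pr k M')} {β : Pr k M' → Pr k M} {x : Pr k M}

namespace OffChart

variable (C : OffChart Xt β x)

lemma div_mem_adjoin [CharZero k] (hb : IsBlowupAt Xt X β x) {F : Type} [Field F] [Algebra k F]
    {a : Fin (M' + 1) → F} (ha : ∀ f, aeval a f = 0 ↔ f ∈ Van Xt) {j0 : Fin (M' + 1)} (hj0 : a j0 ≠ 0)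
    (j : Fin (M' + 1)) :
    a j / a j0 ∈ IntermediateField.adjoin k (Set.range fun i => aeval a (C.B i)) := by
  by_contra hcon
  obtain ⟨Ω, _, _, σ, τ, hst, hne⟩ := exists_two_homs _ _ hcon
  have hl : ∀ f : MvPolynomial (Fin (M' + 1)) k, aeval (Sum.elim (fun i => σ (a i)) (fun i => τ (a i))) (rename Sum.inl f) =
      σ (aeval a f) := fun f => by
    rw [aeval_rename, Sum.elim_comp_inl, comp_aeval_apply]
  have hr : ∀ f : MvPolynomial (Fin (M' + 1)) k, aeval (Sum.elim (fun i => σ (a i)) (fun i => τ (a i))) (rename Sum.inr f) =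
      τ (aeval a f) := fun f => by
    rw [aeval_rename, Sum.elim_comp_inr, comp_aeval_apply]
  have hEa : aeval a C.E ≠ 0 := fun h => C.E_notMem ((ha _).1 h)
  obtain ⟨v, hv, hspec⟩ := exists_specialization
    (Sum.elim (fun i => σ (a i)) (fun i => τ (a i)))
    (rename Sum.inl C.E * rename Sum.inr C.E *
      (MvPolynomial.X (Sum.inl j) * MvPolynomial.X (Sum.inr j0) -
        MvPolynomial.X (Sum.inl j0) * MvPolynomial.X (Sum.inr j))) (by
    rw [map_mul, map_mul, hl, hr]
    refine mul_ne_zero (mul_ne_zero ?_ ?_) ?_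
    · simpa using hEa
    · simpa using hEa
    · simp only [map_sub, map_mul, aeval_X, Sum.elim_inl, Sum.elim_inr]
      intro h0
      apply hne
      rw [map_div₀, map_div₀, div_eq_div_iff (by simpa using hj0) (by simpa using hj0)]
      linear_combination h0)
  simp only [map_mul, map_sub, eval_X, eval_rename] at hv
  have hv1 : eval (v ∘ Sum.inl) C.E ≠ 0 := left_ne_zero_of_mul (left_ne_zero_of_mul hv)
  have hv2 : eval (v ∘ Sum.inr) C.E ≠ 0 := right_ne_zero_of_mul (left_ne_zero_of_mul hv)
  have hv3 := right_ne_zero_of_mul hv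
  have h1 : v ∘ Sum.inl ≠ 0 := by
    intro h0
    have : ∀ i, v (Sum.inl i) = 0 := fun i => congrFun h0 i
    simp [this] at hv3
  have h2 : v ∘ Sum.inr ≠ 0 := by
    intro h0
    have : ∀ i, v (Sum.inr i) = 0 := fun i => congrFun h0 i
    simp [this] at hv3
  have m1 : Projectivization.mk k _ h1 ∈ Xt := mem_of_Van hb.2.1.1 h1 fun f hf => by
    have := hspec (rename Sum.inl f) (by rw [hl, (ha f).2 hf, map_zero])
    rwa [eval_rename] at this
  have m2 : Projectivization.mk k _ h2 ∈ Xt := mem_of_Van hb.2.1.1 h2 fun f hf => by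
    have := hspec (rename Sum.inr f) (by rw [hr, (ha f).2 hf, map_zero])
    rwa [eval_rename] at this
  have hB : (fun i => eval (v ∘ Sum.inl) (C.B i)) = fun i => eval (v ∘ Sum.inr) (C.B i) := by
    ext i
    have := hspec (rename Sum.inl (C.B i) - rename Sum.inr (C.B i)) (by
      rw [map_sub, hl, hr, sub_eq_zero]
      exact hst _ (IntermediateField.subset_adjoin _ _ ⟨i, rfl⟩))
    rw [map_sub, eval_rename, eval_rename] at this
    exact sub_eq_zero.1 this
  have hβ : β (Projectivization.mk k _ h1) = β (Projectivization.mk k _ h2) := by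
    rw [C.rep _ h1 m1 (C.ne _ hv1), C.rep _ h2 m2 (C.ne _ hv2)]
    simp only [hB]
  have heq := hb.2.2.2.2.2.1 ⟨m1, C.off _ h1 m1 hv1⟩ ⟨m2, C.off _ h2 m2 hv2⟩ hβ
  have := mul_eq_mul_of_mk_eq heq j j0
  simp only [Function.comp_apply] at this
  exact hv3 (sub_eq_zero.2 this)

end OffChart

/-- A generic point of a projective variety. -/
lemma exists_generic_point {X : Set (Pr k M)} (hp : (Van X).IsPrime) :
    ∃ (F : Type) (_ : Field F) (_ : Algebra k F) (a : Fin (M + 1) → F),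
      ∀ f, aeval a f = 0 ↔ f ∈ Van X := by
  let A := MvPolynomial (Fin (M + 1)) k ⧸ Van X
  let e : MvPolynomial (Fin (M + 1)) k →ₐ[k] FractionRing A :=
    (Algebra.algHom k A (FractionRing A)).comp (Ideal.Quotient.mkₐ k (Van X))
  refine ⟨FractionRing A, inferInstance, inferInstance, fun j => e (MvPolynomial.X j), fun f => ?_⟩
  have : aeval (fun j => e (MvPolynomial.X j)) = e := by ext j; simp
  rw [this, ← Ideal.Quotient.eq_zero_iff_mem]
  exact (map_eq_zero_iff _ (IsFractionRing.injective A (FractionRing A)))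

/-- A rational inverse of the blow-up. -/
lemma exists_blowup_inverse [CharZero k] (hX : IsVariety X) (hb : IsBlowupAt Xt X β x) :
    ∃ G : Fin (M' + 1) → MvPolynomial (Fin (M + 1)) k, (∃ j, G j ∉ Van X) ∧
      (∀ f ∈ Van Xt, aeval G f ∈ Van X) ∧
      ∀ (n : ℕ) (Ψ : Fin (n + 1) → MvPolynomial (Fin (M' + 1)) k)
        (Θ : Fin (n + 1) → MvPolynomial (Fin (M + 1)) k) (d : ℕ), (∀ i, (Ψ i).IsHomogeneous d) →
        (∀ (q : Fin (M' + 1) → k) (v : Fin (M + 1) → k) (hq : q ≠ 0) (hv : v ≠ 0),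
          Projectivization.mk k q hq ∈ Xt →
          β (Projectivization.mk k q hq) = Projectivization.mk k v hv →
          Projectivization.mk k v hv ≠ x →
          ∀ i j, eval q (Ψ i) * eval v (Θ j) = eval q (Ψ j) * eval v (Θ i)) →
        ∀ i j, aeval G (Ψ i) * Θ j - aeval G (Ψ j) * Θ i ∈ Van X := by
  have hinf : Infinite k := IsAlgClosed.instInfinite
  obtain ⟨C⟩ := exists_offChart hb
  have hpt := Van_isPrime hb.2.1
  obtain ⟨F, _, _, a, ha⟩ := exists_generic_point hpt
  let b : Fin (M + 1) → F := fun i => aeval a (C.B i)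
  have hab : ∀ f, aeval b f = aeval a (aeval C.B f) := fun f => (comp_aeval_apply C.B (aeval a) f).symm
  have hbX : ∀ f, aeval b f = 0 ↔ f ∈ Van X := fun f => by
    rw [hab, ha]
    exact ⟨C.mem_of_comp_mem hpt hb.2.2.2.1 hb.2.2.2.2.1, C.comp_mem hpt hb.2.2.2.2.1⟩
  obtain ⟨j0, hj0⟩ : ∃ j, a j ≠ 0 := by
    by_contra! hcon
    obtain ⟨q, hq⟩ := hb.2.1.2.1
    refine q.rep_nonzero (funext fun j => ?_)
    have := (ha (MvPolynomial.X j)).1 (by simp [hcon]) _ (rep_mem_cone hq)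
    simpa using this
  have hrs : ∀ j, ∃ r s : MvPolynomial (Fin (M + 1)) k, aeval b s ≠ 0 ∧
      a j * aeval b s = a j0 * aeval b r := by
    intro j
    obtain ⟨r, s, h⟩ := (IntermediateField.mem_adjoin_range_iff k _ _).1
      (C.div_mem_adjoin hb ha hj0 j)
    by_cases hs : aeval b s = 0
    · refine ⟨0, 1, by simp, ?_⟩
      have h0 : a j / a j0 = 0 := h.trans (by
        change _ / aeval b s = _
        rw [hs, div_zero])
      simpa [hj0] using h0
    · refine ⟨r, s, hs, ?_⟩
      have h0 : a j / a j0 = aeval b r / aeval b s := h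
      rw [div_eq_div_iff hj0 hs] at h0
      linear_combination h0
  choose r s hs hrs using hrs
  obtain ⟨c, hc, hG⟩ : ∃ c : F, c ≠ 0 ∧
      ∀ j, aeval b (r j * ∏ l ∈ Finset.univ.erase j, s l) = c * a j := by
    refine ⟨(∏ l, aeval b (s l)) / a j0, div_ne_zero (Finset.prod_ne_zero_iff.2 fun l _ => hs l) hj0,
      fun j => ?_⟩
    rw [map_mul, map_prod, ← Finset.mul_prod_erase Finset.univ (fun l => aeval b (s l))
      (Finset.mem_univ j), div_mul_eq_mul_div, eq_div_iff hj0]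
    linear_combination -(∏ l ∈ Finset.univ.erase j, aeval b (s l)) * hrs j
  set G : Fin (M' + 1) → MvPolynomial (Fin (M + 1)) k :=
    fun j => r j * ∏ l ∈ Finset.univ.erase j, s l
  have hGf : ∀ f, aeval b (aeval G f) = aeval (fun j => c * a j) f := fun f => by
    rw [comp_aeval_apply]
    congr 2
    ext j
    exact hG j
  refine ⟨G, ⟨j0, fun h => mul_ne_zero hc hj0 ((hG j0).symm.trans ((hbX _).2 h))⟩, fun f hf => ?_,
    fun n Ψ Θ d hΨ hrel i j => ?_⟩
  · rw [← hbX, hGf, ← sum_homogeneousComponent f, map_sum]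
    refine Finset.sum_eq_zero fun d _ => ?_
    rw [aeval_mul_of_isHomogeneous (homogeneousComponent_isHomogeneous d f),
      (ha _).2 (homogeneousComponent_mem_Van hf d), mul_zero]
  · have h1 : Ψ i * aeval C.B (Θ j) - Ψ j * aeval C.B (Θ i) ∈ Van Xt := by
      refine (hpt.mem_or_mem (x := C.E) fun v hv => ?_).resolve_left C.E_notMem
      by_cases h1 : eval v C.E = 0
      · simp [h1]
      obtain ⟨hv0, hvX⟩ := hv
      have hβ := C.rep v hv0 hvX (C.ne v h1)
      have := hrel v _ hv0 (C.ne v h1) hvX hβ (by rw [← hβ]; exact C.off v hv0 hvX h1) i j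
      rw [map_mul, map_sub, map_mul, map_mul, eval_aeval_eq, eval_aeval_eq, this, sub_self, mul_zero]
    rw [← ha, map_sub, map_mul, map_mul, ← hab, ← hab] at h1
    rw [← hbX, map_sub, map_mul, map_mul, hGf, hGf, aeval_mul_of_isHomogeneous (hΨ i),
      aeval_mul_of_isHomogeneous (hΨ j)]
    linear_combination c ^ d * h1

end Inverse

section Exp

variable {k : Type} [Field k] [CharZero k] {A : Type} [CommRing A] [Algebra k A]

/-- The formal flow of a derivation. -/
noncomputable def flow (E : Derivation k A A) (f : A) : PowerSeries A :=
  PowerSeries.mk fun m => (m.factorial : k)⁻¹ • E^[m] f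

lemma coeff_flow (E : Derivation k A A) (f : A) (m : ℕ) :
    PowerSeries.coeff m (flow E f) = (m.factorial : k)⁻¹ • E^[m] f := PowerSeries.coeff_mk _ _

lemma iterate_derivation_add (E : Derivation k A A) (f g : A) (m : ℕ) :
    E^[m] (f + g) = E^[m] f + E^[m] g := by
  induction m generalizing f g with
  | zero => rfl
  | succ m ih => simp [Function.iterate_succ, ih]

lemma flow_add (E : Derivation k A A) (f g : A) : flow E (f + g) = flow E f + flow E g := by
  ext m; simp [coeff_flow, iterate_derivation_add]

lemma coeff_succ_mul_eq (h : PowerSeries A) (m : ℕ) :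
    PowerSeries.coeff (m + 1) h = ((m : k) + 1)⁻¹ • PowerSeries.coeff m (PowerSeries.derivative A h) := by
  have hm : (m : k) + 1 ≠ 0 := by exact_mod_cast Nat.succ_ne_zero m
  rw [PowerSeries.coeff_derivative]
  have : PowerSeries.coeff (m + 1) h * ((m : A) + 1) = ((m : k) + 1) • PowerSeries.coeff (m + 1) h := by
    rw [Algebra.smul_def]; simp [mul_comm]
  rw [this, smul_smul, inv_mul_cancel₀ hm, one_smul]

lemma derivative_flow (E : Derivation k A A) (f : A) :
    PowerSeries.derivative A (flow E f) = flow E (E f) := by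
  ext m
  have hm : (m : k) + 1 ≠ 0 := by exact_mod_cast Nat.succ_ne_zero m
  rw [PowerSeries.coeff_derivative, coeff_flow, coeff_flow, Function.iterate_succ_apply,
    Nat.factorial_succ, mul_comm, ← smul_eq_mul, smul_comm]
  have : ((m : A) + 1) • E^[m] (E f) = ((m : k) + 1) • E^[m] (E f) := by
    rw [Algebra.smul_def ((m : k) + 1), smul_eq_mul]; simp
  rw [this, smul_smul]
  congr 1
  push_cast
  field_simp

lemma flow_mul (E : Derivation k A A) (f g : A) : flow E (f * g) = flow E f * flow E g := by
  ext m
  induction m generalizing f g with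
  | zero => simp [coeff_flow, PowerSeries.coeff_mul]
  | succ m ih =>
    rw [coeff_succ_mul_eq (k := k), coeff_succ_mul_eq (k := k) (flow E f * flow E g), derivative_flow,
      Derivation.leibniz, Derivation.leibniz, derivative_flow, derivative_flow, flow_add]
    simp only [smul_eq_mul, map_add, ih]

lemma flow_algebraMap (E : Derivation k A A) (c : k) :
    flow E (algebraMap k A c) = algebraMap k (PowerSeries A) c := by
  ext m
  cases m with
  | zero => simp [coeff_flow, PowerSeries.algebraMap_apply]
  | succ m =>
    have h0 : ∀ n, E^[n] (0 : A) = 0 := fun n => by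
      induction n with
      | zero => rfl
      | succ n ih => simp [Function.iterate_succ, ih]
    simp [coeff_flow, PowerSeries.algebraMap_apply, Function.iterate_succ, h0, PowerSeries.coeff_C]

/-- The formal flow as a homomorphism. -/
noncomputable def flowHom (E : Derivation k A A) : A →ₐ[k] PowerSeries A where
  toFun := flow E
  map_one' := by simpa using flow_algebraMap E (1 : k)
  map_mul' := flow_mul E
  map_zero' := by simpa using flow_algebraMap E (0 : k)
  map_add' := flow_add E
  commutes' := flow_algebraMap E

end Exp

section Arc

variable {k : Type} [Field k] [CharZero k] {σ : Type}

/-- The family of formal arcs through `v` along the constant combinations of three vector fields. -/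
lemma exists_arc (D : Fin 3 → Derivation k (MvPolynomial σ k) (MvPolynomial σ k)) (v : σ → k) :
    ∃ P : MvPolynomial σ k →ₐ[k] PowerSeries (MvPolynomial (Fin 3) k), ∀ f m a,
      eval a (PowerSeries.coeff m (P f)) =
        (m.factorial : k)⁻¹ * eval v ((∑ i, a i • D i : Derivation k _ _)^[m] f) := by
  let E : Derivation k (MvPolynomial (σ ⊕ Fin 3) k) (MvPolynomial (σ ⊕ Fin 3) k) := mkDerivation k
    (Sum.elim (fun j => ∑ i, MvPolynomial.X (Sum.inr i) * rename Sum.inl (D i (MvPolynomial.X j)))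
      (fun _ => 0))
  let ev : MvPolynomial (σ ⊕ Fin 3) k →ₐ[k] MvPolynomial (Fin 3) k :=
    aeval (Sum.elim (fun j => MvPolynomial.C (v j)) MvPolynomial.X)
  refine ⟨(PowerSeries.mapAlgHom ev).comp ((flowHom E).comp (rename Sum.inl)), fun f m a => ?_⟩
  let ρ : MvPolynomial (σ ⊕ Fin 3) k →ₐ[k] MvPolynomial σ k :=
    aeval (Sum.elim MvPolynomial.X (fun i => MvPolynomial.C (a i)))
  have h4 : ∀ f, ρ (rename Sum.inl f) = f := by
    intro f
    rw [aeval_rename, Sum.elim_comp_inl, aeval_X_left_apply]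
  have h1 : ∀ h : MvPolynomial (σ ⊕ Fin 3) k, eval a (ev h) = eval v (ρ h) := by
    intro h
    induction h using MvPolynomial.induction_on with
    | C r => simp [ev, ρ]
    | add p q hp hq => simp only [map_add, hp, hq]
    | mul_X p i hp => rw [map_mul, map_mul, map_mul, map_mul, hp]; congr 1; rcases i with i | i <;> simp [ev, ρ]
  have h2 : ∀ h : MvPolynomial (σ ⊕ Fin 3) k, ρ (E h) = (∑ i, a i • D i : Derivation k _ _) (ρ h) := by
    intro h
    induction h using MvPolynomial.induction_on with
    | C r => simp [E, ρ]
    | add p q hp hq => simp only [map_add, hp, hq]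
    | mul_X p i hp =>
      rw [Derivation.leibniz, map_add, smul_eq_mul, smul_eq_mul, map_mul, map_mul, map_mul, hp,
        Derivation.leibniz, smul_eq_mul, smul_eq_mul]
      congr 2
      rcases i with i | i
      · have hX : ρ (MvPolynomial.X (Sum.inl i)) = MvPolynomial.X i := by simp [ρ]
        have hX2 : ∀ i, ρ (MvPolynomial.X (Sum.inr i)) = MvPolynomial.C (a i) := by simp [ρ]
        rw [mkDerivation_X, hX, Sum.elim_inl, map_sum]
        simp only [map_mul, hX2, h4]
        simp [MvPolynomial.smul_eq_C_mul, Fin.sum_univ_three]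
      · simp [E, ρ, mkDerivation_X]
  have h3 : ∀ m (h : MvPolynomial (σ ⊕ Fin 3) k), ρ (E^[m] h) = (∑ i, a i • D i : Derivation k _ _)^[m] (ρ h) := by
    intro m
    induction m with
    | zero => intro h; rfl
    | succ m ih => intro h; rw [Function.iterate_succ_apply, ih, h2, Function.iterate_succ_apply]
  change eval a (PowerSeries.coeff m (PowerSeries.map ev.toRingHom (flow E (rename Sum.inl f)))) = _
  rw [PowerSeries.coeff_map, coeff_flow]
  change eval a (ev _) = _
  rw [map_smul, smul_eval, h1, h3, h4]

end Arc

section Krull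

variable {k : Type} [Field k] {A : Type} [CommRing A] [Algebra k A]

lemma coeff_of_mem_pow (P : A →ₐ[k] PowerSeries (MvPolynomial (Fin 3) k)) (z : Fin 3 → A) (n : Ideal A)
    (h0 : ∀ f, aeval z (PowerSeries.coeff 0 (P f)) - f ∈ n)
    (h0' : ∀ g ∈ n, PowerSeries.coeff 0 (P g) = 0)
    (h1 : ∀ g ∈ n, aeval z (PowerSeries.coeff 1 (P g)) - g ∈ n ^ 2) (r : ℕ) (h : A) (hh : h ∈ n ^ r) :
    (∀ m < r, PowerSeries.coeff m (P h) = 0) ∧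
      aeval z (PowerSeries.coeff r (P h)) - h ∈ n ^ (r + 1) := by
  induction r generalizing h with
  | zero => exact ⟨fun m hm => absurd hm (Nat.not_lt_zero m), by simpa using h0 h⟩
  | succ r ih =>
    rw [pow_succ'] at hh
    refine Submodule.mul_induction_on hh (fun g hg h hh => ?_) (fun f g hf hg => ?_)
    · obtain ⟨ih1, ih2⟩ := ih h hh
      have hc : ∀ m ≤ r, PowerSeries.coeff m (P g * P h) = 0 := by
        intro m hm
        rw [PowerSeries.coeff_mul]
        refine Finset.sum_eq_zero fun p hp => ?_
        rw [Finset.HasAntidiagonal.mem_antidiagonal] at hp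
        rcases Nat.eq_zero_or_pos p.1 with h | h
        · rw [h, h0' g hg, zero_mul]
        · rw [ih1 p.2 (by omega), mul_zero]
      have hr : PowerSeries.coeff (r + 1) (P g * P h) =
          PowerSeries.coeff 1 (P g) * PowerSeries.coeff r (P h) := by
        rw [PowerSeries.coeff_mul, Finset.sum_eq_single (1, r)]
        · intro p hp hne
          rw [Finset.HasAntidiagonal.mem_antidiagonal] at hp
          rcases Nat.eq_zero_or_pos p.1 with h | h
          · rw [h, h0' g hg, zero_mul]
          · rw [ih1 p.2, mul_zero]
            have : p.1 ≠ 1 := fun h' => hne (Prod.ext h' (by change p.2 = r; omega))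
            omega
        · intro h
          exact absurd (Finset.HasAntidiagonal.mem_antidiagonal.2 (by simp [add_comm])) h
      refine ⟨fun m hm => by rw [map_mul]; exact hc m (by omega), ?_⟩
      rw [map_mul, hr, map_mul]
      set u := aeval z (PowerSeries.coeff 1 (P g))
      set w := aeval z (PowerSeries.coeff r (P h))
      have e1 : u * w - g * h = (u - g) * (w - h) + (u - g) * h + g * (w - h) := by ring
      rw [e1]
      have a1 := h1 g hg
      refine Ideal.add_mem _ (Ideal.add_mem _ ?_ ?_) ?_
      · have := Ideal.mul_mem_mul a1 ih2
        rw [← pow_add] at this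
        exact Ideal.pow_le_pow_right (by omega) this
      · have := Ideal.mul_mem_mul a1 hh
        rw [← pow_add] at this
        exact Ideal.pow_le_pow_right (by omega) this
      · have := Ideal.mul_mem_mul hg ih2
        rwa [← pow_succ'] at this
    · refine ⟨fun m hm => by rw [map_add, map_add, hf.1 m hm, hg.1 m hm, add_zero], ?_⟩
      rw [map_add, map_add, map_add, add_sub_add_comm]
      exact Ideal.add_mem _ hf.2 hg.2

/-- A homomorphism to a power series ring which restricts to coordinates to first order is injective. -/
lemma injective_of_coeff [IsDomain A] [IsNoetherianRing A]
    (P : A →ₐ[k] PowerSeries (MvPolynomial (Fin 3) k)) (z : Fin 3 → A) (n : Ideal A) (hn : n ≠ ⊤)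
    (h0 : ∀ f, aeval z (PowerSeries.coeff 0 (P f)) - f ∈ n)
    (h0' : ∀ g ∈ n, PowerSeries.coeff 0 (P g) = 0)
    (h1 : ∀ g ∈ n, aeval z (PowerSeries.coeff 1 (P g)) - g ∈ n ^ 2) : Function.Injective P := by
  rw [injective_iff_map_eq_zero]
  intro g hg
  have : ∀ r, g ∈ n ^ r := by
    intro r
    induction r with
    | zero => simp
    | succ r ih =>
      have := (coeff_of_mem_pow P z n h0 h0' h1 r g ih).2
      rw [hg, map_zero, map_zero, zero_sub] at this
      simpa using this
  have h2 := Ideal.iInf_pow_eq_bot_of_isDomain n hn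
  rw [← Submodule.mem_bot A, ← h2, Submodule.mem_iInf]
  exact this

end Krull

section Taylor

variable {k : Type} [Field k] {σ : Type} [Fintype σ]

/-- The first order Taylor expansion. -/
lemma sub_taylor_mem (v : σ → k) (f : MvPolynomial σ k) :
    f - MvPolynomial.C (eval v f) - ∑ j, MvPolynomial.C (eval v (pderiv j f)) *
      (MvPolynomial.X j - MvPolynomial.C (v j)) ∈ (RingHom.ker (eval v)) ^ 2 := by
  classical
  set n := RingHom.ker (eval v)
  have hX : ∀ i, MvPolynomial.X i - MvPolynomial.C (v i) ∈ n := fun i => by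
    rw [RingHom.mem_ker]; simp
  induction f using MvPolynomial.induction_on with
  | C r => simp
  | add p q hp hq =>
    have := Ideal.add_mem _ hp hq
    convert this using 1
    simp only [map_add, add_mul, Finset.sum_add_distrib]
    ring
  | mul_X p i hp =>
    have e1 : ∑ j, MvPolynomial.C (eval v (pderiv j (p * MvPolynomial.X i))) *
        (MvPolynomial.X j - MvPolynomial.C (v j)) = MvPolynomial.C (v i) *
        (∑ j, MvPolynomial.C (eval v (pderiv j p)) * (MvPolynomial.X j - MvPolynomial.C (v j))) +
        MvPolynomial.C (eval v p) * (MvPolynomial.X i - MvPolynomial.C (v i)) := by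
      have : ∀ j, MvPolynomial.C (eval v (pderiv j (p * MvPolynomial.X i))) *
        (MvPolynomial.X j - MvPolynomial.C (v j)) = MvPolynomial.C (v i) *
        (MvPolynomial.C (eval v (pderiv j p)) * (MvPolynomial.X j - MvPolynomial.C (v j))) +
        if j = i then MvPolynomial.C (eval v p) * (MvPolynomial.X j - MvPolynomial.C (v j)) else 0 := by
        intro j
        rw [Derivation.leibniz, pderiv_X]
        by_cases h : j = i
        · subst h; simp; ring
        · simp [h, Pi.single_apply, Ne.symm h]; ring
      simp only [this, Finset.sum_add_distrib, Finset.mul_sum, Finset.sum_ite_eq', Finset.mem_univ,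
        if_true]
    rw [e1]
    have e2 : p * MvPolynomial.X i - MvPolynomial.C (eval v (p * MvPolynomial.X i)) -
      (MvPolynomial.C (v i) * (∑ j, MvPolynomial.C (eval v (pderiv j p)) *
          (MvPolynomial.X j - MvPolynomial.C (v j))) +
        MvPolynomial.C (eval v p) * (MvPolynomial.X i - MvPolynomial.C (v i))) =
      MvPolynomial.C (v i) * (p - MvPolynomial.C (eval v p) - ∑ j, MvPolynomial.C (eval v (pderiv j p)) *
      (MvPolynomial.X j - MvPolynomial.C (v j))) +
        (p - MvPolynomial.C (eval v p)) * (MvPolynomial.X i - MvPolynomial.C (v i)) := by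
      rw [map_mul, eval_X, map_mul]; ring
    rw [e2]
    refine Ideal.add_mem _ (Ideal.mul_mem_left _ _ hp) ?_
    rw [pow_two]
    refine Ideal.mul_mem_mul ?_ (hX i)
    rw [RingHom.mem_ker]; simp

end Taylor

section Arc

variable {k : Type} [Field k] [CharZero k] {σ : Type} [Fintype σ]
  {I : Ideal (MvPolynomial σ k)} {v : σ → k}

lemma sum_smul_derivation_apply (D : Fin 3 → Derivation k (MvPolynomial σ k) (MvPolynomial σ k))
    (a : Fin 3 → k) (f : MvPolynomial σ k) :
    (∑ i, a i • D i : Derivation k _ _) f = ∑ i, a i • D i f := by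
  simp only [Fin.sum_univ_three, Derivation.add_apply, Derivation.smul_apply]

lemma exists_mem_pderiv_eq (g : MvPolynomial σ k)
    (h : ∀ c ∈ Tg I v, dd v c g = 0) : ∃ f ∈ I, ∀ j, eval v (pderiv j f) = eval v (pderiv j g) := by
  classical
  let gr : MvPolynomial σ k →ₗ[k] (σ → k) :=
    LinearMap.pi fun j => (aeval v).toLinearMap.comp (pderiv j).toLinearMap
  have hgr : ∀ f j, gr f j = eval v (pderiv j f) := fun f j => rfl
  by_contra! hne
  have hu : gr g ∉ (I.restrictScalars k).map gr := by
    rintro ⟨f, hf, hfg⟩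
    obtain ⟨j, hj⟩ := hne f hf
    exact hj (by rw [← hgr, hfg, hgr])
  obtain ⟨ℓ, hℓ, hker⟩ := Submodule.exists_le_ker_of_notMem hu
  have hdd : ∀ f, ℓ (gr f) = dd v (fun j => ℓ (Pi.single j 1)) f := by
    intro f
    conv_lhs => rw [pi_eq_sum_univ' (gr f)]
    rw [map_sum]
    refine Finset.sum_congr rfl fun j _ => ?_
    rw [map_smul, hgr]
    rfl
  refine hℓ ?_
  rw [hdd]
  refine h _ fun f hf => ?_
  rw [← hdd]
  exact hker (Submodule.mem_map_of_mem hf)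

lemma arc_eq_zero_of_mem (D : Fin 3 → Derivation k (MvPolynomial σ k) (MvPolynomial σ k))
    (P : MvPolynomial σ k →ₐ[k] PowerSeries (MvPolynomial (Fin 3) k))
    (hP : ∀ f m a, eval a (PowerSeries.coeff m (P f)) =
      (m.factorial : k)⁻¹ * eval v ((∑ i, a i • D i : Derivation k _ _)^[m] f))
    (hD : ∀ i, ∀ f ∈ I, D i f ∈ I) (hv : ∀ f ∈ I, eval v f = 0) {f : MvPolynomial σ k} (hf : f ∈ I) :
    P f = 0 := by
  ext1 m
  refine MvPolynomial.funext fun a => ?_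
  have : ∀ m, ∀ f ∈ I, (∑ i, a i • D i : Derivation k _ _)^[m] f ∈ I := by
    intro m
    induction m with
    | zero => exact fun f hf => hf
    | succ m ih =>
      intro f hf
      rw [Function.iterate_succ_apply]
      refine ih _ ?_
      rw [sum_smul_derivation_apply]
      refine Ideal.sum_mem _ fun i _ => ?_
      rw [smul_eq_C_mul]
      exact Ideal.mul_mem_left _ _ (hD i f hf)
  rw [hP, hv _ (this m f hf), mul_zero, map_zero, map_zero]

/-- Regular functions are determined by their expansions along the arcs. -/
lemma mem_of_arc_eq_zero (hI : I.IsPrime)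
    (D : Fin 3 → Derivation k (MvPolynomial σ k) (MvPolynomial σ k))
    (P : MvPolynomial σ k →ₐ[k] PowerSeries (MvPolynomial (Fin 3) k))
    (hP : ∀ f m a, eval a (PowerSeries.coeff m (P f)) =
      (m.factorial : k)⁻¹ * eval v ((∑ i, a i • D i : Derivation k _ _)^[m] f))
    (hD : ∀ i, ∀ f ∈ I, D i f ∈ I) (hv : ∀ f ∈ I, eval v f = 0)
    (hli : LinearIndependent k fun i j => eval v (D i (MvPolynomial.X j)))
    (htan : ∀ c ∈ Tg I v, ∃ t : Fin 3 → k, c = ∑ i, t i • fun j => eval v (D i (MvPolynomial.X j)))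
    {f : MvPolynomial σ k} (hf : P f = 0) : f ∈ I := by
  classical
  set w : Fin 3 → σ → k := fun i j => eval v (D i (MvPolynomial.X j)) with hw
  obtain ⟨ℓ, hℓ⟩ := LinearMap.exists_leftInverse_of_injective (Fintype.linearCombination k w)
    (LinearMap.ker_eq_bot.2 (hli.fintypeLinearCombination_injective))
  have hℓw : ∀ i, ℓ (w i) = Pi.single i 1 := by
    intro i
    have := LinearMap.congr_fun hℓ (Pi.single i 1)
    rwa [LinearMap.comp_apply, Fintype.linearCombination_apply_single, one_smul] at this
  let zp : Fin 3 → MvPolynomial σ k := fun l => ∑ j, MvPolynomial.C (ℓ (Pi.single j 1) l) *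
    (MvPolynomial.X j - MvPolynomial.C (v j))
  have hzp0 : ∀ l, eval v (zp l) = 0 := fun l => by simp [zp]
  have hDv : ∀ i f, eval v (D i f) = dd v (w i) f := fun i f => by
    have := dd_eq_derivation v (D i) f
    exact this
  have hzp1 : ∀ i l, dd v (w i) (zp l) = if i = l then 1 else 0 := by
    intro i l
    have h1 : ∀ j, pderiv j (zp l) = MvPolynomial.C (ℓ (Pi.single j 1) l) := by
      intro j
      simp only [zp, map_sum, Derivation.leibniz, map_sub, pderiv_X, pderiv_C, smul_zero, add_zero,
        sub_zero, smul_eq_mul, Pi.single_apply, mul_ite, mul_one, mul_zero]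
      simp
    have h2 : ℓ (w i) l = ∑ j, w i j * ℓ (Pi.single j 1) l := by
      conv_lhs => rw [pi_eq_sum_univ' (w i)]
      rw [map_sum, Finset.sum_apply]
      refine Finset.sum_congr rfl fun j _ => ?_
      rw [map_smul]; rfl
    rw [hℓw] at h2
    simp only [dd, h1, aeval_C, Algebra.algebraMap_self, RingHom.id_apply]
    rw [Finset.sum_congr rfl fun j _ => mul_comm _ _, ← h2, Pi.single_apply]
    simp [eq_comm]
  have hc0 : ∀ f, PowerSeries.coeff 0 (P f) = MvPolynomial.C (eval v f) := by
    intro f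
    refine MvPolynomial.funext fun a => ?_
    rw [hP]; simp
  have hc1 : ∀ f, PowerSeries.coeff 1 (P f) = ∑ i, MvPolynomial.X i * MvPolynomial.C (eval v (D i f)) := by
    intro f
    refine MvPolynomial.funext fun a => ?_
    rw [hP]
    simp [sum_smul_derivation_apply, smul_eq_C_mul]
  let π := Ideal.Quotient.mkₐ k I
  let Pb : MvPolynomial σ k ⧸ I →ₐ[k] PowerSeries (MvPolynomial (Fin 3) k) :=
    Ideal.Quotient.liftₐ I P fun f hf => arc_eq_zero_of_mem D P hP hD hv hf
  have hPb : ∀ f, Pb (π f) = P f := fun f => rfl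
  let n : Ideal (MvPolynomial σ k ⧸ I) := (RingHom.ker (eval v)).map (Ideal.Quotient.mk I)
  have hIn : I ≤ RingHom.ker (eval v) := fun f hf => hv f hf
  have hsurj : Function.Surjective π := Ideal.Quotient.mk_surjective
  have hmem : ∀ g, π g ∈ n ↔ eval v g = 0 := by
    intro g
    constructor
    · intro h
      obtain ⟨f, hf, hfg⟩ := (Ideal.mem_map_iff_of_surjective _ Ideal.Quotient.mk_surjective).1 h
      have h2 := hv _ (Ideal.Quotient.eq.1 hfg)
      rw [map_sub, (RingHom.mem_ker).1 hf, zero_sub, neg_eq_zero] at h2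
      exact h2
    · exact fun h => Ideal.mem_map_of_mem _ ((RingHom.mem_ker).2 h)
  have hn : n ≠ ⊤ := by
    intro h
    have : π 1 ∈ n := by rw [h]; trivial
    rw [hmem, map_one] at this
    exact one_ne_zero this
  haveI := hI
  have hinj := injective_of_coeff Pb (fun l => π (zp l)) n hn ?_ ?_ ?_
  · have h3 : Pb (π f) = 0 := hf
    have h4 := (injective_iff_map_eq_zero Pb).1 hinj _ h3
    exact Ideal.Quotient.eq_zero_iff_mem.1 h4
  · intro g
    obtain ⟨g, rfl⟩ := hsurj g
    rw [hPb, hc0, aeval_C]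
    have : algebraMap k _ (eval v g) - π g = π (MvPolynomial.C (eval v g) - g) := by
      rw [map_sub]; rfl
    rw [this, hmem]; simp
  · intro g hg
    obtain ⟨g, rfl⟩ := hsurj g
    rw [hPb, hc0, (hmem g).1 hg, map_zero]
  · intro g hg
    obtain ⟨g, rfl⟩ := hsurj g
    rw [hmem] at hg
    rw [hPb, hc1]
    set g' := g - ∑ i, MvPolynomial.C (eval v (D i g)) * zp i with hg'
    have e1 : aeval (fun l => π (zp l)) (∑ i, MvPolynomial.X i * MvPolynomial.C (eval v (D i g))) - π g =
        - π g' := by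
      rw [hg', map_sub, map_sum, map_sum, neg_sub]
      congr 1
      refine Finset.sum_congr rfl fun i _ => ?_
      rw [map_mul, map_mul, aeval_X, aeval_C, mul_comm]
      rfl
    have hg0 : eval v g' = 0 := by
      rw [hg', map_sub, hg, map_sum]
      simp [hzp0]
    have hgD : ∀ i, dd v (w i) g' = 0 := by
      intro i
      have hsub : ∀ a b : MvPolynomial σ k, dd v (w i) (a - b) = dd (k := k) v (w i) a - dd v (w i) b := by
        intro a b
        simp only [dd, map_sub, sub_mul, Finset.sum_sub_distrib]
      have hsum : dd v (w i) (∑ i', MvPolynomial.C (eval v (D i' g)) * zp i') =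
          ∑ i', dd v (w i) (MvPolynomial.C (eval v (D i' g)) * zp i') := by
        simp only [dd, map_sum, Finset.sum_mul]
        rw [Finset.sum_comm]
      rw [hg', hsub, hsum]
      have : ∀ i', dd v (w i) (MvPolynomial.C (eval v (D i' g)) * zp i') =
          if i = i' then eval v (D i' g) else 0 := by
        intro i'
        rw [dd_mul, hzp1, dd_C]; simp
      simp only [this]
      rw [Finset.sum_ite_eq]
      simp [hDv]
    obtain ⟨f, hfI, hfg⟩ := exists_mem_pderiv_eq (I := I) (v := v) g' (by
      intro c hc
      obtain ⟨t, rfl⟩ := htan c hc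
      rw [dd_sum_vec]
      refine Finset.sum_eq_zero fun i _ => ?_
      rw [dd_smul_vec, hgD, mul_zero])
    have h5 := sub_taylor_mem v (g' - f)
    have h6 : g' - f ∈ (RingHom.ker (eval v)) ^ 2 := by
      have : ∀ j, eval v (pderiv j (g' - f)) = 0 := fun j => by rw [map_sub, map_sub, hfg, sub_self]
      have h8 : eval v (g' - f) = 0 := by rw [map_sub, hg0, hv f hfI, sub_zero]
      rw [h8] at h5
      simp only [this] at h5
      simpa using h5
    rw [e1, Ideal.neg_mem_iff]
    have h7 : π g' = π (g' - f) := by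
      rw [map_sub π g' f]
      have : π f = 0 := Ideal.Quotient.eq_zero_iff_mem.2 hfI
      rw [this, sub_zero]
    rw [h7]
    have := Ideal.mem_map_of_mem (Ideal.Quotient.mk I) h6
    rwa [Ideal.map_pow] at this

end Arc

namespace MapChart

variable {k : Type} [Field k] [CharZero k] {M N : ℕ} {X : Set (Pr k M)} {φ : Pr k M → Pr k N}

lemma exists_arc_iff (C : MapChart X φ) (hp : (Van X).IsPrime) {v : Fin (M + 1) → k} (hv : v ∈ cone X)
    (hΔ : eval v C.Δ ≠ 0) :
    ∃ P : MvPolynomial (Fin (M + 1)) k →ₐ[k] PowerSeries (MvPolynomial (Fin 3) k),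
      (∀ f, P f = 0 ↔ f ∈ Van X) ∧ ∀ f m a, eval a (PowerSeries.coeff m (P f)) =
        (m.factorial : k)⁻¹ * eval v ((C.Dc a)^[m] f) := by
  obtain ⟨P, hP⟩ := exists_arc C.D v
  have hDc : ∀ a, C.Dc a = ∑ i, a i • C.D i := fun a => by
    ext1 f; simp [Dc, Fin.sum_univ_three]
  simp only [hDc]
  refine ⟨P, fun f => ⟨fun h => ?_, fun h => ?_⟩, hP⟩
  · refine mem_of_arc_eq_zero (v := v) hp C.D P hP C.pres (fun f hf => hf v hv) ?_ (C.tan k v hΔ) h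
    have h1 := C.li k v hΔ
    have h2 : (fun i j => aeval v (C.D i (C.Φ j))) =
        dmap C.Φ v ∘ fun i j => eval v (C.D i (MvPolynomial.X j)) := by
      funext i
      exact (C.dmap_D i).symm
    rw [h2] at h1
    exact h1.of_comp
  · exact arc_eq_zero_of_mem (v := v) C.D P hP C.pres (fun f hf => hf v hv) h

end MapChart

section Power

variable {k : Type} [Field k]

lemma exists_eq_X_pow_mul {A : Type} [CommRing A] {ι : Type} (f : ι → PowerSeries A)
    (h : ∃ j, f j ≠ 0) : ∃ (m : ℕ) (Q : ι → PowerSeries A), (∀ j, f j = PowerSeries.X ^ m * Q j) ∧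
      ∃ j, PowerSeries.coeff 0 (Q j) ≠ 0 := by
  classical
  have hex : ∃ m, ∃ j, PowerSeries.coeff m (f j) ≠ 0 := by
    obtain ⟨j, hj⟩ := h
    by_contra! hc
    exact hj (PowerSeries.ext fun m => hc m j)
  have hdvd : ∀ j, PowerSeries.X ^ (Nat.find hex) ∣ f j := by
    intro j
    rw [PowerSeries.X_pow_dvd_iff]
    intro m hm
    by_contra hne
    exact Nat.find_min hex hm ⟨j, hne⟩
  choose Q hQ using hdvd
  refine ⟨Nat.find hex, Q, hQ, ?_⟩
  obtain ⟨j, hj⟩ := Nat.find_spec hex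
  refine ⟨j, ?_⟩
  rw [hQ j] at hj
  have := PowerSeries.coeff_X_pow_mul (Q j) (Nat.find hex) 0
  rw [zero_add] at this
  rwa [this] at hj

/-- A ring homomorphism to a field together with a derivation over it. -/
structure PointDer (S F : Type) [CommRing S] [Field F] where
  e : S →+* F
  d : S →+ F
  leibniz : ∀ x y, d (x * y) = e x * d y + e y * d x

lemma PointDer.mem_of_parallel {S F : Type} [CommRing S] [Field F] (δ : PointDer S F) {n : ℕ}
    {A B : Fin n → S} (hAB : ∀ i j, A i * B j = A j * B i) (hA : (fun i => δ.e (A i)) ≠ 0)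
    (hB : (fun i => δ.e (B i)) ≠ 0) {J : Submodule F (Fin n → F)} (hJ : (fun i => δ.e (A i)) ∈ J)
    (hJ' : (fun i => δ.d (A i)) ∈ J) : (fun i => δ.e (B i)) ∈ J ∧ (fun i => δ.d (B i)) ∈ J := by
  obtain ⟨i, hi⟩ := Function.ne_iff.1 hA
  simp only [Pi.zero_apply] at hi
  have h1 : (fun j => δ.e (B j)) = (δ.e (B i) / δ.e (A i)) • fun j => δ.e (A j) := by
    funext j
    have := congrArg δ.e (hAB i j)
    rw [map_mul, map_mul] at this
    rw [Pi.smul_apply, smul_eq_mul]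
    field_simp
    linear_combination this
  have hm := J.smul_mem (δ.e (B i) / δ.e (A i)) hJ
  rw [← h1] at hm
  refine ⟨hm, ?_⟩
  have h2 : (fun j => δ.d (B j)) = (δ.e (B i) / δ.e (A i)) • (fun j => δ.d (A j)) +
      (δ.d (B i) / δ.e (A i)) • (fun j => δ.e (A j)) - (δ.d (A i) / δ.e (A i)) • fun j => δ.e (B j) := by
    funext j
    have := congrArg δ.d (hAB i j)
    rw [δ.leibniz, δ.leibniz] at this
    simp only [Pi.smul_apply, Pi.add_apply, Pi.sub_apply, smul_eq_mul]
    field_simp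
    linear_combination this
  rw [h2]
  exact J.sub_mem (J.add_mem (J.smul_mem _ hJ') (J.smul_mem _ hJ)) (J.smul_mem _ hm)

/-- Evaluation of a family of arcs at its center. -/
noncomputable def arcEval (a : Fin 3 → k) : PowerSeries (MvPolynomial (Fin 3) k) →+* k :=
  (eval a).comp (PowerSeries.constantCoeff (R := MvPolynomial (Fin 3) k))

lemma arcEval_apply (a : Fin 3 → k) (f : PowerSeries (MvPolynomial (Fin 3) k)) :
    arcEval a f = eval a (PowerSeries.coeff 0 f) := by
  rw [PowerSeries.coeff_zero_eq_constantCoeff_apply]; rfl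

lemma arcEval_algebraMap (a : Fin 3 → k) (r : k) :
    arcEval a (algebraMap k (PowerSeries (MvPolynomial (Fin 3) k)) r) = r := by
  rw [arcEval_apply, PowerSeries.algebraMap_apply, PowerSeries.coeff_zero_C, algebraMap_eq, eval_C]

/-- Differentiation along the arc parameter. -/
noncomputable def arcDer (a : Fin 3 → k) : PointDer (PowerSeries (MvPolynomial (Fin 3) k)) k where
  e := arcEval a
  d := (eval a).toAddMonoidHom.comp (PowerSeries.coeff 1).toAddMonoidHom
  leibniz x y := by
    change eval a (PowerSeries.coeff 1 (x * y)) = arcEval a x * eval a (PowerSeries.coeff 1 y) +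
      arcEval a y * eval a (PowerSeries.coeff 1 x)
    rw [arcEval_apply, arcEval_apply, PowerSeries.coeff_one_mul, map_add, map_mul, map_mul,
      PowerSeries.coeff_zero_eq_constantCoeff_apply, PowerSeries.coeff_zero_eq_constantCoeff_apply]
    ring

/-- Differentiation along the parameters of the family of arcs. -/
noncomputable def arcPderiv (a : Fin 3 → k) (i : Fin 3) :
    PointDer (PowerSeries (MvPolynomial (Fin 3) k)) k where
  e := arcEval a
  d := (eval a).toAddMonoidHom.comp
    ((pderiv i).toLinearMap.toAddMonoidHom.comp (PowerSeries.coeff 0).toAddMonoidHom)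
  leibniz x y := by
    change eval a (pderiv i (PowerSeries.coeff 0 (x * y))) =
      arcEval a x * eval a (pderiv i (PowerSeries.coeff 0 y)) +
      arcEval a y * eval a (pderiv i (PowerSeries.coeff 0 x))
    have : PowerSeries.coeff 0 (x * y) = PowerSeries.coeff 0 x * PowerSeries.coeff 0 y := by simp
    rw [arcEval_apply, arcEval_apply, this, Derivation.leibniz, map_add,
      smul_eq_mul, smul_eq_mul, map_mul, map_mul]

lemma arcDer_d (a : Fin 3 → k) (f : PowerSeries (MvPolynomial (Fin 3) k)) :
    (arcDer a).d f = eval a (PowerSeries.coeff 1 f) := rfl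

lemma arcPderiv_d (a : Fin 3 → k) (i : Fin 3) (f : PowerSeries (MvPolynomial (Fin 3) k)) :
    (arcPderiv a i).d f = eval a (pderiv i (PowerSeries.coeff 0 f)) := rfl

lemma arcDer_algebraMap (a : Fin 3 → k) (r : k) :
    (arcDer a).d (algebraMap k (PowerSeries (MvPolynomial (Fin 3) k)) r) = 0 := by
  rw [arcDer_d, PowerSeries.algebraMap_apply, PowerSeries.coeff_C]; simp

lemma arcPderiv_algebraMap (a : Fin 3 → k) (i : Fin 3) (r : k) :
    (arcPderiv a i).d (algebraMap k (PowerSeries (MvPolynomial (Fin 3) k)) r) = 0 := by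
  rw [arcPderiv_d, PowerSeries.algebraMap_apply, PowerSeries.coeff_zero_C, algebraMap_eq, pderiv_C,
    map_zero]

lemma PointDer.mem_Tg {σ : Type} [Fintype σ] {S : Type} [CommRing S] [Algebra k S] (δ : PointDer S k)
    (he : ∀ r, δ.e (algebraMap k S r) = r) (hd : ∀ r, δ.d (algebraMap k S r) = 0)
    {I : Ideal (MvPolynomial σ k)} {Q : σ → S} (hQ : ∀ f ∈ I, aeval Q f = 0) :
    (fun j => δ.d (Q j)) ∈ Tg I fun j => δ.e (Q j) := by
  intro f hf
  rw [← eq_dd_of_leibniz δ.e δ.d δ.leibniz hd he, hQ f hf, map_zero]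

lemma PointDer.mem_Sp {σ m : Type} [Fintype σ] {S : Type} [CommRing S] [Algebra k S]
    (δ : PointDer S k)
    (he : ∀ r, δ.e (algebraMap k S r) = r) (hd : ∀ r, δ.d (algebraMap k S r) = 0)
    {I : Ideal (MvPolynomial σ k)} {Q : σ → S} (hQ : ∀ f ∈ I, aeval Q f = 0)
    (Ψ : m → MvPolynomial σ k) :
    (fun j => δ.d (aeval Q (Ψ j))) ∈ Sp I Ψ fun j => δ.e (Q j) := by
  refine ⟨_, δ.mem_Tg he hd hQ, ?_⟩
  funext j
  rw [dmap_apply, ← eq_dd_of_leibniz δ.e δ.d δ.leibniz hd he]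

lemma PointDer.eval_aeval {σ : Type} {S : Type} [CommRing S] [Algebra k S] (δ : PointDer S k)
    (he : ∀ r, δ.e (algebraMap k S r) = r) (Q : σ → S) (f : MvPolynomial σ k) :
    δ.e (aeval Q f) = eval (fun j => δ.e (Q j)) f := by
  induction f using MvPolynomial.induction_on with
  | C r => simp [he]
  | add p q hp hq => simp [hp, hq]
  | mul_X p i hp => simp [hp]

end Power

section Lift

variable {k : Type} [Field k] [IsAlgClosed k] [CharZero k] {M M' : ℕ}
  {X : Set (Pr k M)} {Xt : Set (Pr k M')} {β : Pr k M' → Pr k M} {x : Pr k M}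

/-- Arcs lift to a blow-up after removing a common factor. -/
lemma exists_arc_lift (hX : IsVariety X) (hb : IsBlowupAt Xt X β x)
    (P : MvPolynomial (Fin (M + 1)) k →ₐ[k] PowerSeries (MvPolynomial (Fin 3) k))
    (hP : ∀ f, P f = 0 ↔ f ∈ Van X) :
    ∃ Q : Fin (M' + 1) → PowerSeries (MvPolynomial (Fin 3) k),
      (∃ j, PowerSeries.coeff 0 (Q j) ≠ 0) ∧ (∀ f ∈ Van Xt, aeval Q f = 0) ∧
      ∀ (n : ℕ) (Ψ : Fin (n + 1) → MvPolynomial (Fin (M' + 1)) k)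
        (Θ : Fin (n + 1) → MvPolynomial (Fin (M + 1)) k) (d : ℕ), (∀ i, (Ψ i).IsHomogeneous d) →
        (∀ (q : Fin (M' + 1) → k) (v : Fin (M + 1) → k) (hq : q ≠ 0) (hv : v ≠ 0),
          Projectivization.mk k q hq ∈ Xt →
          β (Projectivization.mk k q hq) = Projectivization.mk k v hv →
          Projectivization.mk k v hv ≠ x →
          ∀ i j, eval q (Ψ i) * eval v (Θ j) = eval q (Ψ j) * eval v (Θ i)) →
        ∀ i j, aeval Q (Ψ i) * P (Θ j) = aeval Q (Ψ j) * P (Θ i) := by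
  have hinf : Infinite k := IsAlgClosed.instInfinite
  obtain ⟨G, ⟨j, hj⟩, hGI, hG⟩ := exists_blowup_inverse hX hb
  obtain ⟨m, Q, hQ, hQ0⟩ := exists_eq_X_pow_mul (fun j => P (G j)) ⟨j, fun h => hj ((hP _).1 h)⟩
  have hcomp : ∀ f : MvPolynomial (Fin (M' + 1)) k, P (aeval G f) = aeval (fun j => P (G j)) f := by
    intro f
    rw [← AlgHom.comp_apply, comp_aeval]
  have hhom : ∀ (f : MvPolynomial (Fin (M' + 1)) k) (d : ℕ), f.IsHomogeneous d →
      P (aeval G f) = (PowerSeries.X ^ m) ^ d * aeval Q f := by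
    intro f d hf
    have hfun : (fun j => P (G j)) = fun j => PowerSeries.X ^ m * Q j := funext hQ
    rw [hcomp, hfun, aeval_mul_of_isHomogeneous hf]
  have hXm : ∀ d, ((PowerSeries.X : PowerSeries (MvPolynomial (Fin 3) k)) ^ m) ^ d ≠ 0 := fun d =>
    pow_ne_zero _ (pow_ne_zero _ PowerSeries.X_ne_zero)
  refine ⟨Q, hQ0, fun f hf => ?_, fun n Ψ Θ d hd hrel i j => ?_⟩
  · rw [← sum_homogeneousComponent f, map_sum]
    refine Finset.sum_eq_zero fun d _ => ?_
    have h1 := (hP _).2 (hGI _ (homogeneousComponent_mem_Van hf d))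
    rw [hhom _ d (homogeneousComponent_isHomogeneous d f)] at h1
    exact (mul_eq_zero.1 h1).resolve_left (hXm d)
  · have h1 := (hP _).2 (hG n Ψ Θ d hd hrel i j)
    rw [map_sub, map_mul, map_mul, hhom _ d (hd i), hhom _ d (hd j), mul_assoc, mul_assoc,
      ← mul_sub] at h1
    exact sub_eq_zero.1 ((mul_eq_zero.1 h1).resolve_left (hXm d))

end Lift

section LinComp

variable {k : Type} [Field k] {σ : Type} {N N' : ℕ}

/-- The composition of a polynomial map with a linear map. -/
noncomputable def linComp (L : (Fin (N + 1) → k) →ₗ[k] (Fin (N' + 1) → k))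
    (Φ : Fin (N + 1) → MvPolynomial σ k) : Fin (N' + 1) → MvPolynomial σ k :=
  fun j => ∑ i, L (Pi.single i 1) j • Φ i

lemma map_linComp (L : (Fin (N + 1) → k) →ₗ[k] (Fin (N' + 1) → k))
    (Φ : Fin (N + 1) → MvPolynomial σ k) (T : MvPolynomial σ k →ₗ[k] k) (j : Fin (N' + 1)) :
    T (linComp L Φ j) = L (fun i => T (Φ i)) j := by
  classical
  have h := pi_eq_sum_univ' (fun i => T (Φ i))
  rw [h, map_sum, linComp, map_sum, Finset.sum_apply]
  refine Finset.sum_congr rfl fun i _ => ?_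
  rw [map_smul, map_smul, Pi.smul_apply, smul_eq_mul, smul_eq_mul, mul_comm]

lemma eval_linComp (L : (Fin (N + 1) → k) →ₗ[k] (Fin (N' + 1) → k))
    (Φ : Fin (N + 1) → MvPolynomial σ k) (v : σ → k) (j : Fin (N' + 1)) :
    eval v (linComp L Φ j) = L (fun i => eval v (Φ i)) j :=
  map_linComp L Φ (aeval v).toLinearMap j

lemma eval_derivation_linComp (L : (Fin (N + 1) → k) →ₗ[k] (Fin (N' + 1) → k))
    (Φ : Fin (N + 1) → MvPolynomial σ k) (v : σ → k)
    (D : Derivation k (MvPolynomial σ k) (MvPolynomial σ k)) (j : Fin (N' + 1)) :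
    eval v (D (linComp L Φ j)) = L (fun i => eval v (D (Φ i))) j :=
  map_linComp L Φ ((aeval v).toLinearMap.comp D.toLinearMap) j

lemma eval_derivation_derivation_linComp (L : (Fin (N + 1) → k) →ₗ[k] (Fin (N' + 1) → k))
    (Φ : Fin (N + 1) → MvPolynomial σ k) (v : σ → k)
    (D : Derivation k (MvPolynomial σ k) (MvPolynomial σ k)) (j : Fin (N' + 1)) :
    eval v (D (D (linComp L Φ j))) = L (fun i => eval v (D (D (Φ i)))) j :=
  map_linComp L Φ ((aeval v).toLinearMap.comp (D.toLinearMap.comp D.toLinearMap)) j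

end LinComp

section Lift

variable {k : Type} [Field k] [IsAlgClosed k] [CharZero k] {M M' N N' : ℕ}
  {X : Set (Pr k M)} {φ : Pr k M → Pr k N} {Xt : Set (Pr k M')} {β : Pr k M' → Pr k M} {x : Pr k M}
  {φt : Pr k M' → Pr k N'} {L : (Fin (N + 1) → k) →ₗ[k] (Fin (N' + 1) → k)}

/-- `Ψ` represents the map `φ` on `X` wherever it does not vanish. -/
def IsRep (X : Set (Pr k M)) (φ : Pr k M → Pr k N) (Φ : Fin (N + 1) → MvPolynomial (Fin (M + 1)) k) :
    Prop :=
  ∀ (v : Fin (M + 1) → k) (hv : v ≠ 0), Projectivization.mk k v hv ∈ X →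
    ∀ h : (fun j => eval v (Φ j)) ≠ 0,
      φ (Projectivization.mk k v hv) = Projectivization.mk k (fun j => eval v (Φ j)) h

lemma ResolvesInnerProj.mul_eq_mul (hres : ResolvesInnerProj X φ x Xt β φt L)
    {Ψ : Fin (N' + 1) → MvPolynomial (Fin (M' + 1)) k} (hΨ : IsRep Xt φt Ψ)
    {Φ : Fin (N + 1) → MvPolynomial (Fin (M + 1)) k} (hΦ : IsRep X φ Φ) (him : β '' Xt = X)
    (q : Fin (M' + 1) → k) (v : Fin (M + 1) → k) (hq : q ≠ 0) (hv : v ≠ 0)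
    (hqX : Projectivization.mk k q hq ∈ Xt)
    (hβ : β (Projectivization.mk k q hq) = Projectivization.mk k v hv)
    (hx : Projectivization.mk k v hv ≠ x) (i j : Fin (N' + 1)) :
    eval q (Ψ i) * eval v (linComp L Φ j) = eval q (Ψ j) * eval v (linComp L Φ i) := by
  rw [eval_linComp, eval_linComp]
  by_cases h1 : (fun j => eval q (Ψ j)) = 0
  · have := fun j => congrFun h1 j
    simp only [Pi.zero_apply] at this
    rw [this, this, zero_mul, zero_mul]
  by_cases h2 : L (fun i => eval v (Φ i)) = 0
  · rw [h2, Pi.zero_apply, Pi.zero_apply, mul_zero, mul_zero]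
  have h3 : (fun i => eval v (Φ i)) ≠ 0 := fun h => h2 (by rw [h, map_zero])
  have hvX : Projectivization.mk k v hv ∈ X := by
    rw [← him, ← hβ]; exact ⟨_, hqX, rfl⟩
  have h4 := hres.2.2 _ hqX (by rwa [hβ]) _ h3 (by rw [hβ, hΦ v hv hvX h3]) h2
  rw [hΨ q hq hqX h1] at h4
  exact mul_eq_mul_of_mk_eq h4 i j

lemma MapChart.exists_lift (hX : IsVariety X) (hb : IsBlowupAt Xt X β x)
    (hres : ResolvesInnerProj X φ x Xt β φt L) (C : MapChart X φ) {v : Fin (M + 1) → k}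
    (hv : v ≠ 0) (hvX : Projectivization.mk k v hv ∈ X) (hΔ : eval v C.Δ ≠ 0) :
    ∃ q : Fin (M' + 1) → MvPolynomial (Fin 3) k, (∃ j, q j ≠ 0) ∧
      ∀ (a : Fin 3 → k) (w : Fin (M' + 1) → k) (hw : w ≠ 0), (w = fun j => eval a (q j)) →
        Projectivization.mk k w hw ∈ Xt ∧ β (Projectivization.mk k w hw) = Projectivization.mk k v hv ∧
        ∀ (Ψ : Fin (N' + 1) → MvPolynomial (Fin (M' + 1)) k) (d : ℕ), d ≠ 0 →
          (∀ i, (Ψ i).IsHomogeneous d) → IsRep Xt φt Ψ → (fun i => eval w (Ψ i)) ≠ 0 →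
          (L (fun i => eval v (C.Φ i)) ≠ 0 → L (fun i => eval v (C.Φ i)) ∈ Sp (Van Xt) Ψ w ∧
            L (fun i => eval v (C.Dc a (C.Φ i))) ∈ Sp (Van Xt) Ψ w) ∧
          (L (fun i => eval v (C.Φ i)) = 0 → L (fun i => eval v (C.Dc a (C.Φ i))) ≠ 0 →
            (∀ l, L (fun i => eval v (C.D l (C.Φ i))) ∈ Sp (Van Xt) Ψ w) ∧
            L (fun i => eval v (C.Dc a (C.Dc a (C.Φ i)))) ∈ Sp (Van Xt) Ψ w) := by
  have hinf : Infinite k := IsAlgClosed.instInfinite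
  obtain ⟨P, hPker, hP⟩ := C.exists_arc_iff (Van_isPrime hX) ⟨hv, hvX⟩ hΔ
  obtain ⟨Q, ⟨j0, hj0⟩, hQ, hrel⟩ := exists_arc_lift hX hb P hPker
  refine ⟨fun j => PowerSeries.coeff 0 (Q j), ⟨j0, hj0⟩, fun a w hw hwq => ?_⟩
  have hwe : w = fun j => (arcDer a).e (Q j) := by
    rw [hwq]; funext j; exact (arcEval_apply a _).symm
  have hwe' : ∀ i, w = fun j => (arcPderiv a i).e (Q j) := fun i => hwe
  have hwV : ∀ f ∈ Van Xt, eval w f = 0 := by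
    intro f hf
    rw [hwe, ← (arcDer a).eval_aeval (arcEval_algebraMap a), hQ f hf, map_zero]
  have hwX : Projectivization.mk k w hw ∈ Xt := mem_of_Van hb.2.1.1 hw hwV
  have heP : ∀ f, arcEval a (P f) = eval v f := by
    intro f
    rw [arcEval_apply, hP]; simp
  refine ⟨hwX, ?_, fun Ψ d hd hΨ hΨr hΨw => ?_⟩
  · obtain ⟨B, ⟨d, hBd⟩, hBne, hBr⟩ := hb.2.2.2.1 _ hwX
    have hBw : (fun i => eval w (B i)) ≠ 0 := by
      obtain ⟨t, ht⟩ := (Projectivization.mk_eq_mk_iff' k _ _ (Projectivization.rep_nonzero _) hw).1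
        (Projectivization.mk_rep (Projectivization.mk k w hw))
      intro h0
      refine hBne (funext fun i => ?_)
      rw [← ht]
      exact (eval_mul_of_isHomogeneous (hBd i) t w).trans
        (by rw [show eval w (B i) = 0 from congrFun h0 i, mul_zero]; rfl)
    rw [hBr _ hwX w hw rfl hBw]
    have h1 := hrel M B MvPolynomial.X d hBd (by
      intro q u hq hu hqX hβ hux i j
      rw [eval_X, eval_X]
      by_cases h1 : (fun j => eval q (B j)) = 0
      · have := fun j => congrFun h1 j
        simp only [Pi.zero_apply] at this
        rw [this, this, zero_mul, zero_mul]
      have := hBr _ hqX q hq rfl h1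
      rw [hβ] at this
      exact (mul_eq_mul_of_mk_eq this.symm i j))
    have h2 : ∀ i j, eval w (B i) * v j = eval w (B j) * v i := by
      intro i j
      have := congrArg (arcEval a) (h1 i j)
      rw [map_mul, map_mul, heP, heP, eval_X, eval_X] at this
      rw [hwe, ← (arcDer a).eval_aeval (arcEval_algebraMap a),
        ← (arcDer a).eval_aeval (arcEval_algebraMap a)]
      exact this
    obtain ⟨i, hi⟩ := Function.ne_iff.1 hv
    simp only [Pi.zero_apply] at hi
    rw [Projectivization.mk_eq_mk_iff']
    refine ⟨eval w (B i) / v i, ?_⟩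
    funext j
    rw [Pi.smul_apply, smul_eq_mul]
    field_simp
    linear_combination h2 i j
  · have h1 := hrel N' Ψ (linComp L C.Φ) d hΨ fun q u hq hu hqX hβ hux =>
      hres.mul_eq_mul hΨr C.rep hb.2.2.2.2.1 q u hq hu hqX hβ hux
    have hA : ∀ i, arcEval a (aeval Q (Ψ i)) = eval w (Ψ i) := by
      intro i
      rw [hwe]
      exact (arcDer a).eval_aeval (arcEval_algebraMap a) Q (Ψ i)
    have hA0 : (fun i => arcEval a (aeval Q (Ψ i))) ≠ 0 := by
      simpa only [hA] using hΨw
    have hAJ : (fun i => arcEval a (aeval Q (Ψ i))) ∈ Sp (Van Xt) Ψ w := by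
      simp only [hA]
      exact self_mem_Sp hwV hd hΨ
    have hdJ : (fun i => (arcDer a).d (aeval Q (Ψ i))) ∈ Sp (Van Xt) Ψ w := by
      rw [hwe]
      exact (arcDer a).mem_Sp (arcEval_algebraMap a) (arcDer_algebraMap a) hQ Ψ
    have hpJ : ∀ l, (fun i => (arcPderiv a l).d (aeval Q (Ψ i))) ∈ Sp (Van Xt) Ψ w := by
      intro l
      rw [hwe' l]
      exact (arcPderiv a l).mem_Sp (arcEval_algebraMap a) (arcPderiv_algebraMap a l) hQ Ψ
    constructor
    · intro hL
      have e0 : (fun i => (arcDer a).e (P (linComp L C.Φ i))) = L (fun i => eval v (C.Φ i)) := by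
        funext i
        rw [← eval_linComp]; exact heP _
      have e1 : (fun i => (arcDer a).d (P (linComp L C.Φ i))) =
          L (fun i => eval v (C.Dc a (C.Φ i))) := by
        funext i
        rw [← eval_derivation_linComp, arcDer_d, hP]; simp
      have := (arcDer a).mem_of_parallel h1 hA0 (by rw [e0]; exact hL) hAJ hdJ
      rwa [e0, e1] at this
    · intro hL hL1
      have hX1 : ∀ i, PowerSeries.X ∣ P (linComp L C.Φ i) := by
        intro i
        rw [PowerSeries.X_dvd_iff, ← PowerSeries.coeff_zero_eq_constantCoeff_apply]
        refine MvPolynomial.funext fun a => ?_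
        rw [hP]
        simp [eval_linComp, hL]
      choose B hB using hX1
      have h2 : ∀ i j, aeval Q (Ψ i) * B j = aeval Q (Ψ j) * B i := by
        intro i j
        have := h1 i j
        rw [hB, hB] at this
        refine mul_left_cancel₀ (PowerSeries.X_ne_zero (R := MvPolynomial (Fin 3) k)) ?_
        linear_combination this
      have hBc : ∀ m i, PowerSeries.coeff m (B i) = PowerSeries.coeff (m + 1) (P (linComp L C.Φ i)) := by
        intro m i
        rw [hB, PowerSeries.coeff_succ_X_mul]
      have e0 : (fun i => arcEval a (B i)) = L (fun i => eval v (C.Dc a (C.Φ i))) := by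
        funext i
        rw [← eval_derivation_linComp, arcEval_apply, hBc, hP]; simp
      have e1 : (fun i => (arcDer a).d (B i)) =
          (2 : k)⁻¹ • L (fun i => eval v (C.Dc a (C.Dc a (C.Φ i)))) := by
        funext i
        rw [Pi.smul_apply, ← eval_derivation_derivation_linComp, arcDer_d, hBc, hP]; simp
      have e2 : ∀ l, (fun i => (arcPderiv a l).d (B i)) = L (fun i => eval v (C.D l (C.Φ i))) := by
        intro l
        funext i
        have : PowerSeries.coeff 1 (P (linComp L C.Φ i)) =
            ∑ l, MvPolynomial.X l * MvPolynomial.C (eval v (C.D l (linComp L C.Φ i))) := by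
          refine MvPolynomial.funext fun a => ?_
          rw [hP]
          simp [Dc_apply, smul_eq_C_mul]
        rw [← eval_derivation_linComp, arcPderiv_d, hBc, this]
        simp [Derivation.leibniz, pderiv_X, Pi.single_apply]
      have hB0 : (fun i => arcEval a (B i)) ≠ 0 := by rw [e0]; exact hL1
      refine ⟨fun l => ?_, ?_⟩
      · have := ((arcPderiv a l).mem_of_parallel h2 hA0 hB0 hAJ (hpJ l)).2
        rwa [e2] at this
      · have := ((arcDer a).mem_of_parallel h2 hA0 hB0 hAJ hdJ).2
        rw [e1] at this
        simpa using Submodule.smul_mem _ (2 : k) this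

end Lift

section Aux

variable {k : Type} [Field k] [Infinite k] {M N : ℕ} {X : Set (Pr k M)} {φ : Pr k M → Pr k N}

lemma Sp_rep {m : Type} {Φ : m → MvPolynomial (Fin (M + 1)) k} {d : ℕ} (hΦ : ∀ j, (Φ j).IsHomogeneous d)
    {w : Fin (M + 1) → k} (hw : w ≠ 0) :
    Sp (Van X) Φ (Projectivization.mk k w hw).rep = Sp (Van X) Φ w := by
  obtain ⟨t, ht⟩ := (Projectivization.mk_eq_mk_iff' k _ _ (Projectivization.rep_nonzero _) hw).1
    (Projectivization.mk_rep (Projectivization.mk k w hw))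
  have ht0 : t ≠ 0 := by
    rintro rfl
    rw [zero_smul] at ht
    exact Projectivization.rep_nonzero _ ht.symm
  rw [← ht]
  exact Sp_smul X hΦ w ht0

omit [Infinite k] in
lemma eval_rep_ne_zero_iff {m : Type} {Φ : m → MvPolynomial (Fin (M + 1)) k} {d : ℕ}
    (hΦ : ∀ j, (Φ j).IsHomogeneous d) {w : Fin (M + 1) → k} (hw : w ≠ 0) :
    (fun j => eval (Projectivization.mk k w hw).rep (Φ j)) ≠ 0 ↔ (fun j => eval w (Φ j)) ≠ 0 := by
  obtain ⟨t, ht⟩ := (Projectivization.mk_eq_mk_iff' k _ _ (Projectivization.rep_nonzero _) hw).1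
    (Projectivization.mk_rep (Projectivization.mk k w hw))
  have ht0 : t ≠ 0 := by
    rintro rfl
    rw [zero_smul] at ht
    exact Projectivization.rep_nonzero _ ht.symm
  have : (fun j => eval (Projectivization.mk k w hw).rep (Φ j)) = t ^ d • fun j => eval w (Φ j) := by
    funext j
    rw [← ht]
    exact eval_mul_of_isHomogeneous (hΦ j) t w
  rw [this, Ne, smul_eq_zero, not_or]
  exact ⟨fun h => h.2, fun h => ⟨pow_ne_zero _ ht0, h⟩⟩

lemma not_ramifiedAt_of_le_finrank {p : Pr k M} {Φ : Fin (N + 1) → MvPolynomial (Fin (M + 1)) k}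
    (hΦ : LocalRep X φ p Φ) (h : 3 ≤ finrank k (Sp (Van X) Φ p.rep)) : ¬ RamifiedAt X φ p := by
  intro hr
  have h3 := hr Φ hΦ
  rw [embTangent_eq] at h3
  have : jacobian Φ p.rep = dmap Φ p.rep := LinearMap.ext fun c => jacobian_apply _ _ _
  rw [this] at h3
  exact absurd (h.trans h3) (by norm_num)

omit [Infinite k] in
lemma exists_localRep_pos (h : IsMorphismOn X φ) {p : Pr k M} (hp : p ∈ X) :
    ∃ (Φ : Fin (N + 1) → MvPolynomial (Fin (M + 1)) k) (d : ℕ), d ≠ 0 ∧ (∀ i, (Φ i).IsHomogeneous d) ∧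
      LocalRep X φ p Φ ∧ IsRep X φ Φ := by
  obtain ⟨F, ⟨d, hd⟩, hF0, hF⟩ := h p hp
  obtain ⟨l, hl⟩ := Function.ne_iff.1 (Projectivization.rep_nonzero p)
  have key : ∀ (v : Fin (M + 1) → k) (hv : v ≠ 0), Projectivization.mk k v hv ∈ X →
      ∀ h : (fun j => eval v (MvPolynomial.X l * F j)) ≠ 0,
      φ (Projectivization.mk k v hv) =
        Projectivization.mk k (fun j => eval v (MvPolynomial.X l * F j)) h := by
    intro v hv hvX h
    have e : (fun j => eval v (MvPolynomial.X l * F j)) = v l • fun j => eval v (F j) := by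
      funext j; simp
    have h1 : (fun j => eval v (F j)) ≠ 0 := fun h0 => h (by rw [e, h0, smul_zero])
    rw [hF _ hvX v hv rfl h1, eq_comm, Projectivization.mk_eq_mk_iff']
    exact ⟨v l, e.symm⟩
  have hne : (fun i => eval p.rep (MvPolynomial.X l * F i)) ≠ 0 := by
    have e : (fun j => eval p.rep (MvPolynomial.X l * F j)) = p.rep l • fun j => eval p.rep (F j) := by
      funext j; simp
    rw [e]
    exact smul_ne_zero hl hF0
  have hhom : ∀ i, (MvPolynomial.X l * F i).IsHomogeneous (1 + d) := fun i =>
    (isHomogeneous_X k l).mul (hd i)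
  refine ⟨fun i => MvPolynomial.X l * F i, 1 + d, by omega, hhom, ⟨⟨_, hhom⟩, hne, ?_⟩, key⟩
  rintro _ hq v hv rfl h
  exact key v hv hq h

/-- The generic values of a linear map determine its range. -/
lemma forall_mem_of_generic {V : Type} [AddCommGroup V] [Module k V] {n : ℕ} (T : (Fin n → k) →ₗ[k] V)
    (J : Submodule k V) {g : MvPolynomial (Fin n) k} (hg : g ≠ 0)
    (h : ∀ a, eval a g ≠ 0 → T a ∈ J) (a : Fin n → k) : T a ∈ J := by
  classical
  by_contra hne
  have hW : a ∉ J.comap T := hne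
  obtain ⟨ℓ, hℓ, hker⟩ := Submodule.exists_le_ker_of_notMem hW
  let lp : MvPolynomial (Fin n) k := ∑ i, MvPolynomial.C (ℓ (Pi.single i 1)) * MvPolynomial.X i
  have hlp : ∀ b, eval b lp = ℓ b := by
    intro b
    conv_rhs => rw [pi_eq_sum_univ' b]
    simp [lp, map_sum, mul_comm]
  have : g * lp = 0 := by
    refine MvPolynomial.funext fun b => ?_
    rw [map_mul, map_zero, mul_eq_zero, or_iff_not_imp_left]
    intro hb
    rw [hlp]
    exact hker (h b hb)
  rcases mul_eq_zero.1 this with h1 | h1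
  · exact hg h1
  · exact hℓ (by rw [← hlp, h1, map_zero])

end Aux

section Lift

variable {k : Type} [Field k] [IsAlgClosed k] [CharZero k] {M M' N N' : ℕ}
  {X : Set (Pr k M)} {φ : Pr k M → Pr k N} {Xt : Set (Pr k M')} {β : Pr k M' → Pr k M} {x : Pr k M}
  {φt : Pr k M' → Pr k N'} {L : (Fin (N + 1) → k) →ₗ[k] (Fin (N' + 1) → k)}

namespace MapChart

variable (C : MapChart X φ)

/-- The directional derivative of the representing tuple as a linear map. -/
noncomputable def dirMap (v : Fin (M + 1) → k) : (Fin 3 → k) →ₗ[k] (Fin (N + 1) → k) :=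
  Fintype.linearCombination k fun l j => eval v (C.D l (C.Φ j))

omit [IsAlgClosed k] [CharZero k] in
lemma dirMap_apply (v : Fin (M + 1) → k) (a : Fin 3 → k) :
    C.dirMap v a = fun j => eval v (C.Dc a (C.Φ j)) := by
  funext j
  rw [dirMap, Fintype.linearCombination_apply, Finset.sum_apply, Dc_apply, map_sum]
  refine Finset.sum_congr rfl fun i _ => ?_
  rw [Pi.smul_apply, smul_eval, smul_eq_mul]

omit [IsAlgClosed k] [CharZero k] in
lemma dirMap_single (v : Fin (M + 1) → k) (l : Fin 3) :
    C.dirMap v (Pi.single l 1) = fun j => eval v (C.D l (C.Φ j)) := by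
  classical
  rw [dirMap, Fintype.linearCombination_apply_single, one_smul]

lemma range_dirMap {v : Fin (M + 1) → k} (hv : v ∈ cone X) (hΔ : eval v C.Δ ≠ 0) :
    LinearMap.range (C.dirMap v) = Sp (Van X) C.Φ v := by
  rw [C.Sp_eq_span (a := v) (fun f hf => hf v hv) hΔ, dirMap, Fintype.range_linearCombination]
  rfl

/-- Away from the exceptional curve, the projection is unramified unless the center lies on the tangent
plane. -/
lemma not_ramifiedAt_of_notMem (hX : IsVariety X) (hb : IsBlowupAt Xt X β x)
    (hres : ResolvesInnerProj X φ x Xt β φt L) {q : Pr k M'} (hq : q ∈ Xt) (hqx : β q ≠ x)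
    (hΔ : eval (β q).rep C.Δ ≠ 0) {u : Fin (N + 1) → k} (hu : u ≠ 0) (hux : φ x = Projectivization.mk k u hu)
    (huS : u ∉ Sp (Van X) C.Φ (β q).rep) : ¬ RamifiedAt Xt φt q := by
  have hinf : Infinite k := IsAlgClosed.instInfinite
  obtain ⟨Ψ, d, hd, hΨ, hΨl, hΨr⟩ := exists_localRep_pos hres.1 hq
  have hpX : β q ∈ X := by rw [← hb.2.2.2.2.1]; exact ⟨q, hq, rfl⟩
  set v := (β q).rep with hv
  have hv0 : v ≠ 0 := Projectivization.rep_nonzero _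
  have hvp : Projectivization.mk k v hv0 = β q := Projectivization.mk_rep _
  have hvX : Projectivization.mk k v hv0 ∈ X := by rw [hvp]; exact hpX
  obtain ⟨q0, ⟨j0, hj0⟩, hq0⟩ := C.exists_lift hX hb hres hv0 hvX hΔ
  set J := Sp (Van Xt) Ψ q.rep with hJ
  have hker : LinearMap.ker L = Submodule.span k {u} := by
    rw [hres.2.1, hux, Projectivization.submodule_mk]
  have hdisj : ∀ s ∈ Sp (Van X) C.Φ v, L s = 0 → s = 0 := by
    intro s hs hLs
    have : s ∈ LinearMap.ker L := hLs
    rw [hker, Submodule.mem_span_singleton] at this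
    obtain ⟨t, rfl⟩ := this
    by_cases ht : t = 0
    · rw [ht, zero_smul]
    · exact absurd ((Submodule.smul_mem_iff _ ht).1 hs) huS
  have hLv : L (fun i => eval v (C.Φ i)) ≠ 0 := fun h =>
    C.ne k v hΔ (hdisj _ (C.eval_mem_Sp (a := v) (fun f hf => hf v ⟨hv0, hvX⟩) hΔ) h)
  have hgen : ∀ a, eval a (q0 j0) ≠ 0 → (L ∘ₗ C.dirMap v) a ∈ J := by
    intro a ha
    have hw : (fun j => eval a (q0 j)) ≠ 0 := fun h => ha (congrFun h j0)
    obtain ⟨h1, h2, h3⟩ := hq0 a _ hw rfl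
    have hwq : Projectivization.mk k _ hw = q :=
      hb.2.2.2.2.2.1 ⟨h1, by rw [h2, hvp]; exact hqx⟩ ⟨hq, hqx⟩ (h2.trans hvp)
    have h4 := ((h3 Ψ d hd hΨ hΨr ((eval_rep_ne_zero_iff hΨ hw).1
      (by rw [hwq]; exact hΨl.2.1))).1 hLv).2
    rw [← Sp_rep hΨ hw, hwq] at h4
    rw [LinearMap.comp_apply, dirMap_apply]
    exact h4
  have hall := forall_mem_of_generic (L ∘ₗ C.dirMap v) J hj0 hgen
  have hle : (Sp (Van X) C.Φ v).map L ≤ J := by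
    rw [← C.range_dirMap ⟨hv0, hvX⟩ hΔ]
    rintro _ ⟨_, ⟨a, rfl⟩, rfl⟩
    exact hall a
  refine not_ramifiedAt_of_le_finrank hΨl ?_
  have hfr : finrank k ((Sp (Van X) C.Φ v).map L) = 3 := by
    rw [← C.finrank_Sp (a := v) (fun f hf => hf v ⟨hv0, hvX⟩) hΔ, ← LinearMap.range_domRestrict]
    refine LinearMap.finrank_range_of_inj ?_
    rintro ⟨s, hs⟩ ⟨r, hr⟩ h
    exact Subtype.ext (sub_eq_zero.1 (hdisj _ (Submodule.sub_mem _ hs hr)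
      (by rw [map_sub]; exact sub_eq_zero.2 h)))
  rw [← hfr]
  exact Submodule.finrank_mono hle

end MapChart

end Lift

lemma finrank_le_map_add_ker {k V W : Type} [Field k] [AddCommGroup V] [Module k V] [AddCommGroup W]
    [Module k W] [FiniteDimensional k V] (L : V →ₗ[k] W) (S : Submodule k V) :
    finrank k S ≤ finrank k (S.map L) + finrank k (LinearMap.ker L) := by
  rw [← LinearMap.finrank_range_add_finrank_ker (L.domRestrict S), LinearMap.range_domRestrict]
  refine Nat.add_le_add_left ?_ _
  let T : LinearMap.ker (L.domRestrict S) →ₗ[k] LinearMap.ker L :=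
    LinearMap.codRestrict _ (S.subtype ∘ₗ (LinearMap.ker (L.domRestrict S)).subtype) fun c => c.2
  refine LinearMap.finrank_le_finrank_of_injective (f := T) ?_
  intro a b h
  exact Subtype.ext (Subtype.ext (congrArg (fun z : LinearMap.ker L => (z : V)) h))

section Lift

variable {k : Type} [Field k] [IsAlgClosed k] [CharZero k] {M M' N N' : ℕ}
  {X : Set (Pr k M)} {φ : Pr k M → Pr k N} {Xt : Set (Pr k M')} {β : Pr k M' → Pr k M} {x : Pr k M}
  {φt : Pr k M' → Pr k N'} {L : (Fin (N + 1) → k) →ₗ[k] (Fin (N' + 1) → k)}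

namespace MapChart

variable (C : MapChart X φ)

omit [IsAlgClosed k] [CharZero k] in
lemma eval_second_order (v : Fin (M + 1) → k) (ℓ : (Fin (N + 1) → k) →ₗ[k] k) (a : Fin 3 → k) :
    eval a (∑ i, ∑ l, MvPolynomial.X i * MvPolynomial.X l *
      MvPolynomial.C (ℓ fun j => eval v (C.D i (C.D l (C.Φ j)))) : MvPolynomial (Fin 3) k) =
      ℓ fun j => eval v (C.Dc a (C.Dc a (C.Φ j))) := by
  have h : (fun j => eval v (C.Dc a (C.Dc a (C.Φ j)))) =
      ∑ i, ∑ l, (a i * a l) • fun j => eval v (C.D i (C.D l (C.Φ j))) := by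
    funext j
    simp only [Dc_apply, map_sum, Derivation.map_smul, smul_eval, Finset.sum_apply, Pi.smul_apply,
      smul_eq_mul, Finset.smul_sum, mul_assoc]
    rw [Finset.sum_comm]
    exact Finset.sum_congr rfl fun i _ => Finset.sum_congr rfl fun l _ => mul_left_comm _ _ _
  rw [h]
  simp [map_sum]

/-- Some point of the exceptional curve is unramified. -/
lemma exists_not_ramifiedAt (hX : IsVariety X) (hb : IsBlowupAt Xt X β x)
    (hres : ResolvesInnerProj X φ x Xt β φt L) {v : Fin (M + 1) → k} (hv : v ≠ 0)
    (hvx : Projectivization.mk k v hv = x) (hΔ : eval v C.Δ ≠ 0) {t : Fin 3 → k}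
    (ht : (fun j => eval v (C.Dc t (C.Dc t (C.Φ j)))) ∉ Sp (Van X) C.Φ v) :
    ∃ q ∈ Xt, β q = x ∧ ¬ RamifiedAt Xt φt q := by
  classical
  have hinf : Infinite k := IsAlgClosed.instInfinite
  have hvX : Projectivization.mk k v hv ∈ X := by rw [hvx]; exact hb.1
  have ha : ∀ f ∈ Van X, aeval v f = 0 := fun f hf => hf v ⟨hv, hvX⟩
  have hΦv : (fun i => eval v (C.Φ i)) ≠ 0 := C.ne k v hΔ
  have hker : LinearMap.ker L = Submodule.span k {fun i => eval v (C.Φ i)} := by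
    rw [hres.2.1, ← hvx, C.rep v hv hvX hΦv, Projectivization.submodule_mk]
  have hLv : L (fun i => eval v (C.Φ i)) = 0 := by
    rw [← LinearMap.mem_ker, hker]; exact Submodule.mem_span_singleton_self _
  have hk1 : finrank k (LinearMap.ker L) = 1 := by rw [hker]; exact finrank_span_singleton hΦv
  have hS3 : finrank k (Sp (Van X) C.Φ v) = 3 := C.finrank_Sp (a := v) ha hΔ
  obtain ⟨q0, ⟨j0, hj0⟩, hq0⟩ := C.exists_lift hX hb hres hv hvX hΔ
  obtain ⟨ℓ, hℓ, hℓS⟩ := Submodule.exists_le_ker_of_notMem ht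
  have h1 : ∃ l, L (fun i => eval v (C.D l (C.Φ i))) ≠ 0 := by
    by_contra! hcon
    have : Sp (Van X) C.Φ v ≤ LinearMap.ker L := by
      rw [C.Sp_eq_span (a := v) ha hΔ, Submodule.span_le]
      rintro _ ⟨l, rfl⟩
      exact hcon l
    have := Submodule.finrank_mono this
    omega
  obtain ⟨l, hl⟩ := h1
  obtain ⟨j, hj⟩ := Function.ne_iff.1 hl
  let hq : MvPolynomial (Fin 3) k := ∑ i, ∑ l, MvPolynomial.X i * MvPolynomial.X l *
      MvPolynomial.C (ℓ fun j => eval v (C.D i (C.D l (C.Φ j))))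
  have hq_ne : hq ≠ 0 := fun h => hℓ (by rw [← C.eval_second_order v ℓ t]; change eval t hq = 0; rw [h, map_zero])
  let hl : MvPolynomial (Fin 3) k := ∑ i, MvPolynomial.X i *
      MvPolynomial.C (L (fun r => eval v (C.D i (C.Φ r))) j)
  have hl_eval : ∀ a, eval a hl = L (fun r => eval v (C.Dc a (C.Φ r))) j := by
    intro a
    rw [← dirMap_apply, dirMap, Fintype.linearCombination_apply, map_sum, map_sum, Finset.sum_apply]
    refine Finset.sum_congr rfl fun i _ => ?_
    rw [map_mul, eval_X, eval_C, map_smul, Pi.smul_apply, smul_eq_mul]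
  have hl_ne : hl ≠ 0 := by
    intro h
    apply hj
    rw [← dirMap_single, dirMap_apply, ← hl_eval, h, map_zero]
    rfl
  obtain ⟨a, hane⟩ : ∃ a, eval a (q0 j0 * hq * hl) ≠ 0 := by
    by_contra! hcon
    exact mul_ne_zero (mul_ne_zero hj0 hq_ne) hl_ne (MvPolynomial.funext fun a => by rw [hcon, map_zero])
  rw [map_mul, map_mul] at hane
  have hw : (fun j => eval a (q0 j)) ≠ 0 := fun h =>
    hane (by rw [show eval a (q0 j0) = 0 from congrFun h j0, zero_mul, zero_mul])
  obtain ⟨hmem, hβ, hrest⟩ := hq0 a _ hw rfl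
  refine ⟨_, hmem, hβ.trans hvx, ?_⟩
  obtain ⟨Ψ, d, hd, hΨ, hΨl, hΨr⟩ := exists_localRep_pos hres.1 hmem
  obtain ⟨hD, hDD⟩ := (hrest Ψ d hd hΨ hΨr ((eval_rep_ne_zero_iff hΨ hw).1 hΨl.2.1)).2 hLv
    (fun h => right_ne_zero_of_mul hane (by rw [hl_eval, h]; rfl))
  refine not_ramifiedAt_of_le_finrank hΨl ?_
  rw [Sp_rep hΨ hw]
  set s := fun j => eval v (C.Dc a (C.Dc a (C.Φ j))) with hs
  have hsS : s ∉ Sp (Van X) C.Φ v := by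
    intro h
    refine right_ne_zero_of_mul (left_ne_zero_of_mul hane) ?_
    change eval a hq = 0
    rw [C.eval_second_order v ℓ a]
    exact hℓS h
  have h4 : finrank k (Sp (Van X) C.Φ v ⊔ Submodule.span k {s} : Submodule k _) = 4 := by
    rw [finrank_sup_span _ hsS, hS3]
  have h5 := finrank_le_map_add_ker L (Sp (Van X) C.Φ v ⊔ Submodule.span k {s})
  have h6 : (Sp (Van X) C.Φ v ⊔ Submodule.span k {s}).map L ≤ Sp (Van Xt) Ψ (fun j => eval a (q0 j)) := by
    rw [Submodule.map_le_iff_le_comap, C.Sp_eq_span (a := v) ha hΔ, sup_le_iff, Submodule.span_le,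
      Submodule.span_le]
    refine ⟨?_, ?_⟩
    · rintro _ ⟨l, rfl⟩
      exact hD l
    · rintro _ rfl
      exact hDD
  have h7 := Submodule.finrank_mono h6
  omega

end MapChart

end Lift

section Curve

variable {k : Type} [Field k] {M : ℕ}

/-- Two vectors with vanishing minors represent the same point. -/
lemma mk_eq_mk_of_mul_eq {n : ℕ} {u w : Fin (n + 1) → k} (hu : u ≠ 0) (hw : w ≠ 0)
    (h : ∀ i j, u i * w j = u j * w i) : Projectivization.mk k w hw = Projectivization.mk k u hu := by
  obtain ⟨i, hi⟩ := Function.ne_iff.1 hu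
  rw [Projectivization.mk_eq_mk_iff']
  refine ⟨w i / u i, funext fun j => ?_⟩
  rw [Pi.smul_apply, smul_eq_mul, div_mul_eq_mul_div, div_eq_iff hi, mul_comm (w i), ← h, mul_comm]

lemma isVariety_singleton (p : Pr k M) : IsVariety ({p} : Set (Pr k M)) := by
  refine ⟨?_, singleton_nonempty p, fun Z₁ Z₂ _ _ h => by simpa using h⟩
  induction p using Projectivization.ind with | h u hu =>
  have hhom : ∀ i j, (MvPolynomial.C (u i) * MvPolynomial.X j - MvPolynomial.C (u j) * MvPolynomial.X i :
      MvPolynomial (Fin (M + 1)) k).IsHomogeneous 1 := fun i j => by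
    have h1 := ((isHomogeneous_C (Fin (M + 1)) (u i)).mul (isHomogeneous_X k j)).sub
      ((isHomogeneous_C (Fin (M + 1)) (u j)).mul (isHomogeneous_X k i))
    simpa using h1
  refine ⟨Set.range fun ij : Fin (M + 1) × Fin (M + 1) => MvPolynomial.C (u ij.1) * MvPolynomial.X ij.2 -
    MvPolynomial.C (u ij.2) * MvPolynomial.X ij.1, ?_, ?_⟩
  · rintro _ ⟨ij, rfl⟩
    exact ⟨1, hhom _ _⟩
  · ext q
    induction q using Projectivization.ind with | h w hw =>
    simp only [mem_singleton_iff, mem_setOf_eq, forall_mem_range, vanishes_iff (hhom _ _) hw, map_sub,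
      map_mul, eval_C, eval_X, sub_eq_zero]
    exact ⟨fun h ij => by linear_combination -mul_eq_mul_of_mk_eq h ij.1 ij.2,
      fun h => mk_eq_mk_of_mul_eq hu hw fun i j => h (i, j)⟩

/-- The closed set defined by the homogeneous elements of an ideal. -/
def zeros (I : Ideal (MvPolynomial (Fin (M + 1)) k)) : Set (Pr k M) :=
  {p | ∀ g ∈ {g | g ∈ I ∧ ∃ d, g.IsHomogeneous d}, Vanishes g p}

lemma isAlgSet_zeros (I : Ideal (MvPolynomial (Fin (M + 1)) k)) : IsAlgSet (zeros I) :=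
  ⟨_, fun _ hg => hg.2, rfl⟩

lemma subset_zeros (T : Set (Pr k M)) : T ⊆ zeros (Van T) := by
  rintro p hp g ⟨hg, d, hd⟩ v hv rfl
  exact hg v ⟨hv, hp⟩

lemma zeros_subset {T Z : Set (Pr k M)} (hZ : IsAlgSet Z) (h : T ⊆ Z) : zeros (Van T) ⊆ Z := by
  obtain ⟨S, hS, rfl⟩ := hZ
  refine fun p hp g hg => hp g ⟨?_, hS g hg⟩
  rintro v ⟨hv, hvT⟩
  exact h hvT g hg v hv rfl

lemma mem_Van_zeros [Infinite k] {T : Set (Pr k M)} {f : MvPolynomial (Fin (M + 1)) k} (hf : f ∈ Van T) :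
    f ∈ Van (zeros (Van T)) := by
  refine mem_Van_of_subset_homZero fun p hp => ?_
  rintro _ ⟨d, rfl⟩
  exact hp _ ⟨homogeneousComponent_mem_Van hf d, d, homogeneousComponent_isHomogeneous d f⟩

lemma Van_anti {S T : Set (Pr k M)} (h : S ⊆ T) : Van T ≤ Van S :=
  fun _ hf v hv => hf v ⟨hv.1, h hv.2⟩

/-- An infinite set contains an infinite subset with irreducible closure. -/
lemma exists_infinite_isVariety {T : Set (Pr k M)} (hT : T.Infinite) :
    ∃ S ⊆ T, S.Infinite ∧ IsVariety (zeros (Van S)) := by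
  obtain ⟨I, ⟨S, hST, hS, rfl⟩, hmax⟩ := set_has_maximal_iff_noetherian.2
    (inferInstance : IsNoetherian (MvPolynomial (Fin (M + 1)) k) (MvPolynomial (Fin (M + 1)) k))
    {I | ∃ S ⊆ T, S.Infinite ∧ Van S = I} ⟨_, T, subset_rfl, hT, rfl⟩
  have key : ∀ Z, IsAlgSet Z → (S ∩ Z).Infinite → zeros (Van S) ⊆ Z := by
    intro Z hZ hinf
    have h1 := hmax (Van (S ∩ Z)) ⟨S ∩ Z, inter_subset_left.trans hST, hinf, rfl⟩
    have h2 : Van S = Van (S ∩ Z) := eq_of_le_of_not_lt (Van_anti inter_subset_left) h1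
    rw [h2]
    exact zeros_subset hZ inter_subset_right
  refine ⟨S, hST, hS, isAlgSet_zeros _, hS.nonempty.mono (subset_zeros S), fun Z₁ Z₂ h₁ h₂ h => ?_⟩
  have hcov : S = (S ∩ Z₁) ∪ (S ∩ Z₂) := by
    rw [← inter_union_distrib_left, eq_comm, inter_eq_left]
    exact (subset_zeros S).trans h
  rw [hcov, infinite_union] at hS
  exact hS.imp (key Z₁ h₁) (key Z₂ h₂)

/-- A polynomial which does not vanish on a curve has finitely many zeros on it. -/
lemma finite_of_mem_Van [Infinite k] {E T : Set (Pr k M)} (hE : IsVariety E) (hd : HasDim E 1) (hTE : T ⊆ E)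
    {f : MvPolynomial (Fin (M + 1)) k} (hf : f ∉ Van E) (hfT : f ∈ Van T) : T.Finite := by
  by_contra hT
  obtain ⟨S, hST, hS, hW⟩ := exists_infinite_isVariety hT
  obtain ⟨p, hp⟩ := hS.nonempty
  have hWE : zeros (Van S) ⊆ E := zeros_subset hE.1 (hST.trans hTE)
  let a : {W : Set (Pr k M) // IsVariety W ∧ W ⊆ E} :=
    ⟨{p}, isVariety_singleton p, singleton_subset_iff.2 (hTE (hST hp))⟩
  let b : {W : Set (Pr k M) // IsVariety W ∧ W ⊆ E} := ⟨zeros (Van S), hW, hWE⟩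
  let c : {W : Set (Pr k M) // IsVariety W ∧ W ⊆ E} := ⟨E, hE, subset_rfl⟩
  have hab : a < b := by
    refine lt_of_le_of_ne (singleton_subset_iff.2 (subset_zeros S hp) : ({p} : Set _) ⊆ zeros (Van S)) ?_
    intro h
    have h1 : ({p} : Set (Pr k M)) = zeros (Van S) := congrArg Subtype.val h
    exact hS ((finite_singleton p).subset (h1 ▸ subset_zeros S))
  have hbc : b < c := by
    refine lt_of_le_of_ne hWE ?_
    intro h
    have h1 : zeros (Van S) = E := congrArg Subtype.val h
    exact hf (h1 ▸ mem_Van_zeros (Van_anti hST hfT))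
  have h1 : Order.krullDim {W : Set (Pr k M) // IsVariety W ∧ W ⊆ E} ≤ 1 := by rw [hd]; rfl
  rcases Order.krullDim_le_one_iff.1 h1 b with h | h
  · exact hab.not_ge (h hab.le)
  · exact hbc.not_ge (h hbc.le)

lemma IsVariety.subsingleton [Infinite k] {W : Set (Pr k M)} (hW : IsVariety W) (hfin : W.Finite) :
    W.Subsingleton := by
  have h1 : (hfin.toFinset.inf fun p => Van ({p} : Set (Pr k M))) ≤ Van W := by
    rintro f hf v ⟨hv, hvW⟩
    rw [Submodule.mem_finsetInf] at hf
    exact hf _ (hfin.mem_toFinset.2 hvW) v ⟨hv, rfl⟩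
  obtain ⟨p, -, hp⟩ := ((Van_isPrime hW).inf_le' (s := hfin.toFinset)).1 h1
  have h2 : W ⊆ {p} := by
    intro q hq
    induction q using Projectivization.ind with | h v hv =>
    exact mem_of_Van (isVariety_singleton p).1 hv fun f hf => hp hf v ⟨hv, hq⟩
  exact subsingleton_singleton.anti h2

/-- A surface has infinitely many points. -/
lemma infinite_of_hasDim_two [Infinite k] {Z : Set (Pr k M)} (hd : HasDim Z 2) : Z.Infinite := by
  intro hfin
  have h1 : 1 ≤ Order.krullDim {W : Set (Pr k M) // IsVariety W ∧ W ⊆ Z} := by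
    rw [hd]; exact_mod_cast (by norm_num : (1 : ℕ) ≤ 2)
  obtain ⟨⟨A, hA, hAZ⟩, ⟨B, hB, hBZ⟩, hAB⟩ := Order.one_le_krullDim_iff.1 h1
  have hsub : A ⊆ B := hAB.le
  obtain ⟨p, hp⟩ := hA.2.1
  refine hAB.not_ge (?_ : B ⊆ A)
  intro q hq
  rwa [hB.subsingleton (hfin.subset hBZ) hq (hsub hp)]

end Curve

section Generic

variable {k : Type} [Field k] [Infinite k] {M : ℕ}

lemma exists_mem_cone_eval_ne_zero {X : Set (Pr k M)} {f : MvPolynomial (Fin (M + 1)) k} {p : Pr k M}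
    (hp : p ∈ X) (hpf : p ∉ homZero f) :
    ∃ v ∈ cone X, ∃ hv : v ≠ 0, Projectivization.mk k v hv = p ∧ eval v f ≠ 0 := by
  induction p using Projectivization.ind with | h v hv =>
  obtain ⟨t, ht, hne⟩ : ∃ t : k, t ≠ 0 ∧ eval (fun j => t * v j) f ≠ 0 := by
    by_contra! hcon
    apply hpf
    rw [mk_mem_homZero]
    ext d
    rw [coeff_lineP]
    simpa using eval_homogeneousComponent_eq_zero hcon d
  have hc := smul_mem_cone (X := X) ⟨hv, hp⟩ ht
  exact ⟨_, hc, hc.1, (Projectivization.mk_eq_mk_iff' ..).2 ⟨t, rfl⟩, hne⟩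

omit [Infinite k] in
lemma exists_notMem_Van {X Z : Set (Pr k M)} (hZ : IsAlgSet Z) (hXZ : ¬ X ⊆ Z) :
    ∃ f ∉ Van X, f ∈ Van Z := by
  obtain ⟨p, hp, hpZ⟩ := not_subset.1 hXZ
  by_contra! hcon
  refine hpZ ?_
  rw [← p.mk_rep]
  refine mem_of_Van hZ p.rep_nonzero fun f hf => ?_
  by_contra h
  exact hcon f (fun hX => h (hX _ (rep_mem_cone hp))) hf

end Generic

section Lift

variable {k : Type} [Field k] [IsAlgClosed k] [CharZero k] {M M' N N' : ℕ}
  {X : Set (Pr k M)} {φ : Pr k M → Pr k N} {Xt : Set (Pr k M')} {β : Pr k M' → Pr k M} {x : Pr k M}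
  {φt : Pr k M' → Pr k N'} {L : (Fin (N + 1) → k) →ₗ[k] (Fin (N' + 1) → k)}

omit [CharZero k] in
lemma nondegenerate_image (hb : IsBlowupAt Xt X β x) (hres : ResolvesInnerProj X φ x Xt β φt L)
    (hN : N' + 1 = N) (hnd : Nondegenerate (φ '' X)) : Nondegenerate (φt '' Xt) := by
  have hinf : Infinite k := IsAlgClosed.instInfinite
  intro f hf hvan
  have hk : finrank k (LinearMap.ker L) = 1 := by rw [hres.2.1]; exact Projectivization.finrank_submodule _
  have hsurj : Function.Surjective L := by
    rw [← LinearMap.range_eq_top]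
    refine Submodule.eq_top_of_finrank_eq ?_
    have := LinearMap.finrank_range_add_finrank_ker L
    simp only [finrank_fintype_fun_eq_card, Fintype.card_fin] at this ⊢
    omega
  have hG : ∀ u, eval u (aeval (linComp L (MvPolynomial.X : _ → MvPolynomial (Fin (N + 1)) k)) f) =
      eval (L u) f := by
    intro u
    rw [eval_aeval_eq]
    congr 2
    funext j
    rw [eval_linComp]
    simp
  have h0 := hnd (aeval (linComp L (MvPolynomial.X : _ → MvPolynomial (Fin (N + 1)) k)) f) ?_ ?_
  · refine MvPolynomial.funext fun w => ?_
    obtain ⟨u, rfl⟩ := hsurj w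
    rw [← hG, h0, map_zero, map_zero]
  · have := hf.aeval (n := 1) (linComp L (MvPolynomial.X : _ → MvPolynomial (Fin (N + 1)) k)) fun j =>
      IsHomogeneous.sum _ _ _ fun i _ => by
        rw [smul_eq_C_mul]
        simpa using (isHomogeneous_C _ _).mul (isHomogeneous_X k i)
    simpa using this
  · rintro _ ⟨y, hy, rfl⟩ u hu huy
    rw [hG]
    by_cases hLu : L u = 0
    · rw [hLu]
      have := eval_mul_of_isHomogeneous hf 0 0
      simpa using this
    · rw [← hb.2.2.2.2.1] at hy
      obtain ⟨q, hq, rfl⟩ := hy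
      have hne : β q ≠ x := by
        intro h
        apply hLu
        rw [← LinearMap.mem_ker, hres.2.1, ← h, ← huy, Projectivization.submodule_mk]
        exact Submodule.mem_span_singleton_self _
      exact hvan _ ⟨q, hq, rfl⟩ _ hLu (hres.2.2 q hq hne u hu huy hLu).symm

omit [CharZero k] in
lemma genericallyInjectiveOn_of_no_trisecant (hX : IsVariety X) (hXt : IsVariety Xt)
    (hb : IsBlowupAt Xt X β x) (hres : ResolvesInnerProj X φ x Xt β φt L) (C : MapChart X φ)
    (hΔ : C.Δ ∉ Van X) {v : Fin (M + 1) → k} (hv : v ≠ 0) (hvx : Projectivization.mk k v hv = x)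
    (hvΔ : eval v C.Δ ≠ 0)
    (htri : Gen X fun y => ∀ z ∈ cone X, eval z C.Δ ≠ 0 → ∀ α β : k, α ≠ 0 → β ≠ 0 →
      ¬ ∀ j, eval z (C.Φ j) = α * eval v (C.Φ j) + β * eval y (C.Φ j))
    {Z : Set (Pr k M)} (hZ : IsAlgSet Z) (hXZ : ¬ X ⊆ Z) (hinj : InjOn φ (X \ Z)) (hxZ : x ∉ Z) :
    GenericallyInjectiveOn Xt φt := by
  have hinf : Infinite k := IsAlgClosed.instInfinite
  have hp := Van_isPrime hX
  have hpt := Van_isPrime hXt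
  have him := hb.2.2.2.2.1
  obtain ⟨g₁, hg₁, htri⟩ := htri
  obtain ⟨g₂, hg₂, hg₂Z⟩ := exists_notMem_Van hZ hXZ
  obtain ⟨O⟩ := exists_offChart hb
  refine ⟨homZero (aeval O.B (g₁ * g₂ * C.Δ) * O.E), isAlgSet_homZero _, ?_, ?_⟩
  · intro h
    rcases hpt.mem_or_mem (mem_Van_of_subset_homZero h) with h1 | h1
    · rcases hp.mem_or_mem (O.mem_of_comp_mem hpt hb.2.2.2.1 him h1) with h2 | h2
      · exact (hp.mem_or_mem h2).elim hg₁ hg₂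
      · exact hΔ h2
    · exact O.E_notMem h1
  have hΦv : (fun j => eval v (C.Φ j)) ≠ 0 := C.ne k v hvΔ
  have hvX : Projectivization.mk k v hv ∈ X := by rw [hvx]; exact hb.1
  have hφx : φ x = Projectivization.mk k _ hΦv := by rw [← hvx]; exact C.rep v hv hvX hΦv
  have hker : LinearMap.ker L = Submodule.span k {fun j => eval v (C.Φ j)} := by
    rw [hres.2.1, hφx, Projectivization.submodule_mk]
  have main : ∀ q ∈ Xt \ homZero (aeval O.B (g₁ * g₂ * C.Δ) * O.E), β q ≠ x ∧ β q ∈ X \ Z ∧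
      ∃ y ∈ cone X, eval y g₁ ≠ 0 ∧ eval y C.Δ ≠ 0 ∧ ∃ hy : (fun j => eval y (C.Φ j)) ≠ 0,
        φ (β q) = Projectivization.mk k _ hy ∧ ∃ hL : L (fun j => eval y (C.Φ j)) ≠ 0,
          φt q = Projectivization.mk k _ hL := by
    rintro q ⟨hq, hqZ⟩
    obtain ⟨w, hwc, hw, rfl, hne⟩ := exists_mem_cone_eval_ne_zero hq hqZ
    rw [map_mul] at hne
    have hE := right_ne_zero_of_mul hne
    have hg := left_ne_zero_of_mul hne
    rw [eval_aeval_eq, map_mul, map_mul] at hg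
    have hyc := O.mem_cone him hwc hE
    have hβ := O.rep w hw hq (O.ne w hE)
    have hoff := O.off w hw hq hE
    set y := fun i => eval w (O.B i) with hy
    have hβX : β (Projectivization.mk k w hw) ∈ X := by rw [hβ]; exact hyc.2
    have hβZ : β (Projectivization.mk k w hw) ∉ Z := by
      intro h
      rw [hβ] at h
      exact right_ne_zero_of_mul (left_ne_zero_of_mul hg) (hg₂Z y ⟨_, h⟩)
    have hΦy := C.ne k y (right_ne_zero_of_mul hg)
    have hφy : φ (β (Projectivization.mk k w hw)) = Projectivization.mk k _ hΦy := by
      rw [hβ]; exact C.rep y _ hyc.2 hΦy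
    refine ⟨hoff, ⟨hβX, hβZ⟩, y, hyc, left_ne_zero_of_mul (left_ne_zero_of_mul hg),
      right_ne_zero_of_mul hg, hΦy, hφy, ?_⟩
    have hL : L (fun j => eval y (C.Φ j)) ≠ 0 := by
      intro h
      rw [← LinearMap.mem_ker, hker, Submodule.mem_span_singleton] at h
      obtain ⟨c, hc⟩ := h
      refine hoff (hinj ⟨hβX, hβZ⟩ ⟨hb.1, hxZ⟩ ?_)
      rw [hφy, hφx, Projectivization.mk_eq_mk_iff']
      exact ⟨c, hc⟩
    exact ⟨hL, hres.2.2 _ hq hoff _ hΦy hφy.symm hL⟩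
  intro q₁ hq₁ q₂ hq₂ heq
  obtain ⟨ho₁, hX₁, y, hyc, hyg, hyΔ, hΦy, hφy, hLy, hty⟩ := main q₁ hq₁
  obtain ⟨ho₂, hX₂, z, hzc, hzg, hzΔ, hΦz, hφz, hLz, htz⟩ := main q₂ hq₂
  refine hb.2.2.2.2.2.1 ⟨hq₁.1, ho₁⟩ ⟨hq₂.1, ho₂⟩ (hinj hX₁ hX₂ ?_)
  rw [hty, htz, Projectivization.mk_eq_mk_iff'] at heq
  obtain ⟨c, hc⟩ := heq
  have hc0 : c ≠ 0 := by
    rintro rfl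
    exact hLy (by rw [← hc, zero_smul])
  have hmem : (fun j => eval y (C.Φ j)) - c • (fun j => eval z (C.Φ j)) ∈ LinearMap.ker L := by
    rw [LinearMap.mem_ker, map_sub, map_smul, hc, sub_self]
  rw [hker, Submodule.mem_span_singleton] at hmem
  obtain ⟨a, ha⟩ := hmem
  by_cases ha0 : a = 0
  · rw [hφy, hφz, Projectivization.mk_eq_mk_iff']
    refine ⟨c, ?_⟩
    rw [ha0, zero_smul] at ha
    exact (sub_eq_zero.1 ha.symm).symm
  · refine absurd (fun j => ?_) (htri z hzc hzg y hyc hyΔ a c ha0 hc0)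
    have := congrFun ha j
    simp only [Pi.smul_apply, Pi.sub_apply, smul_eq_mul] at this
    linear_combination -this

/-- Finiteness of the ramification locus of the projected map. -/
lemma ramLocus_finite (hX : IsVariety X) (hXt : IsSmoothSurface Xt)
    (hb : IsBlowupAt Xt X β x) (hres : ResolvesInnerProj X φ x Xt β φt L) (hram : (RamLocus X φ).Finite)
    {v : Fin (M + 1) → k} (hv : v ≠ 0) (hvx : Projectivization.mk k v hv = x)
    (s : Finset (MapChart X φ)) (hs : ∀ p ∈ X, ¬ RamifiedAt X φ p → ∃ C ∈ s, eval p.rep C.Δ ≠ 0)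
    (hfin : ∀ C ∈ s, C.Δ ∉ Van X → eval v C.Δ ≠ 0 ∧ {p | p ∈ X ∧ eval p.rep C.Δ ≠ 0 ∧
      (fun j => eval v (C.Φ j)) ∈ Sp (Van X) C.Φ p.rep}.Finite)
    (C : MapChart X φ) (hΔ : eval v C.Δ ≠ 0) {t : Fin 3 → k}
    (ht : (fun j => eval v (C.Dc t (C.Dc t (C.Φ j)))) ∉ Sp (Van X) C.Φ v) :
    (RamLocus Xt φt).Finite := by
  classical
  have hinf : Infinite k := IsAlgClosed.instInfinite
  have him := hb.2.2.2.2.1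
  have hvX : Projectivization.mk k v hv ∈ X := by rw [hvx]; exact hb.1
  have hsplit : RamLocus Xt φt = (RamLocus Xt φt ∩ {q | β q ≠ x}) ∪ (RamLocus Xt φt ∩ {q | β q = x}) := by
    ext q
    by_cases h : β q = x <;> simp [h]
  rw [hsplit]
  refine Finite.union ?_ ?_
  · have hsub : RamLocus Xt φt ∩ {q | β q ≠ x} ⊆ {q | q ∈ Xt ∧ β q ≠ x} :=
      fun q hq => ⟨hq.1.1, hq.2⟩
    refine Finite.of_finite_image (f := β) ?_ (hb.2.2.2.2.2.1.mono hsub)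
    refine (hram.union (Set.Finite.biUnion (s.filter fun C => C.Δ ∉ Van X).finite_toSet
      fun C hC => (hfin C (Finset.mem_filter.1 hC).1 (Finset.mem_filter.1 hC).2).2)).subset ?_
    rintro _ ⟨q, ⟨⟨hq, hqr⟩, hqx⟩, rfl⟩
    have hpX : β q ∈ X := by rw [← him]; exact ⟨q, hq, rfl⟩
    by_contra hnot
    rw [mem_union, not_or, mem_iUnion₂] at hnot
    obtain ⟨A, hAs, hA⟩ := hs _ hpX fun h => hnot.1 ⟨hpX, h⟩
    have hAV : A.Δ ∉ Van X := fun h => hA (h _ (rep_mem_cone hpX))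
    have hne := A.ne k v (hfin A hAs hAV).1
    refine A.not_ramifiedAt_of_notMem hX hb hres hq hqx hA hne
      (by rw [← hvx]; exact A.rep v hv hvX hne) (fun hS => hnot.2 ?_) hqr
    exact ⟨A, Finset.mem_filter.2 ⟨hAs, hAV⟩, hpX, hA, hS⟩
  · obtain ⟨q₀, hq₀, hq₀x, hq₀r⟩ := C.exists_not_ramifiedAt hX hb hres hv hvx hΔ ht
    obtain ⟨A, hA⟩ := exists_mapChart hXt hq₀ hq₀r
    refine finite_of_mem_Van (E := ExcFiber Xt β x) (f := A.Δ) hb.2.2.2.2.2.2.1 hb.2.2.2.2.2.2.2.1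
      (fun q hq => ⟨hq.1.1, hq.2⟩) (fun h => hA (h _ (rep_mem_cone ⟨hq₀, hq₀x⟩))) ?_
    rintro w ⟨hw, hwr, -⟩
    by_contra h
    exact A.not_ramifiedAt hw hwr.1 h hwr.2

end Lift

/-- **Theorem.** If `φ : X → ℙ^N` (`N ≥ 4`) is uncrumpled and `Y = φ(X)` is not ruled by
lines, then the resolved inner projection from a general point is again uncrumpled. -/
theorem stmt_5
    (k : Type) [Field k] [IsAlgClosed k] [CharZero k]
    (M N : ℕ) (hN : 4 ≤ N)
    (X : Set (Pr k M)) (φ : Pr k M → Pr k N)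
    (hX : IsSmoothSurface X) (hφ : Uncrumpled X φ)
    (hnr : ¬ RuledByLines (φ '' X)) :
    ForGeneralPointOn X (fun x =>
      ∀ (M' : ℕ) (Xt : Set (Pr k M')) (β : Pr k M' → Pr k M)
        (φt : Pr k M' → Pr k (N - 1)) (L : (Fin (N + 1) → k) →ₗ[k] (Fin (N - 1 + 1) → k)),
        IsSmoothSurface Xt → IsBlowupAt Xt X β x →
        ResolvesInnerProj X φ x Xt β φt L →
        Uncrumpled Xt φt) := by
  have hinf : Infinite k := IsAlgClosed.instInfinite
  obtain ⟨hmor, hnd, ⟨Z, hZ, hXZ, hinj⟩, hram⟩ := hφ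
  have hp := Van_isPrime hX.1
  obtain ⟨p₀, hp₀, hp₀r⟩ : ∃ p ∈ X, ¬ RamifiedAt X φ p := by
    by_contra! hcon
    exact infinite_of_hasDim_two hX.2.1 (hram.subset fun p hpX => ⟨hpX, hcon p hpX⟩)
  obtain ⟨C, hC⟩ := exists_mapChart hX hp₀ hp₀r
  have hΔ : C.Δ ∉ Van X := fun h => hC (h _ (rep_mem_cone hp₀))
  obtain ⟨t, μ, hμ, ht⟩ := C.exists_second_order hN hp hΔ hmor hnd
  obtain ⟨s, hs, hsfin⟩ := exists_charts_gen_finite hN hX hmor hnd hnr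
  obtain ⟨g, hg, hgZ⟩ := exists_notMem_Van hZ hXZ
  have h₁ : Gen X fun v => eval v C.Δ ≠ 0 := ⟨_, hΔ, fun _ _ h => h⟩
  have h₂ : Gen X fun v => eval v μ ≠ 0 := ⟨_, hμ, fun _ _ h => h⟩
  have h₃ : Gen X fun v => eval v g ≠ 0 := ⟨_, hg, fun _ _ h => h⟩
  refine Gen.forGeneral (h₁.and hp (h₂.and hp (h₃.and hp
    (hsfin.and hp (C.gen_no_trisecant hN hX.1 hΔ hmor hnd))))) ?_
  rintro v hv hvX ⟨hvΔ, hvμ, hvg, hvs, hvtri⟩ M' Xt β φt L hXt hb hres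
  refine ⟨hres.1, nondegenerate_image hb hres (by omega) hnd,
    genericallyInjectiveOn_of_no_trisecant hX.1 hXt.1 hb hres C hΔ hv rfl hvΔ hvtri hZ hXZ hinj
      fun h => hvg (hgZ v ⟨hv, h⟩),
    ramLocus_finite hX.1 hXt hb hres hram hv rfl s hs hvs C hvΔ (t := t) ?_⟩
  rw [C.Sp_eq_span (a := v) (fun f hf => hf v ⟨hv, hvX⟩) hvΔ]
  exact ht v hvμ

end PinchPaper
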